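/- Let Ω be the open unit disk in ℝ², let W ∈ C¹((−∞,1],ℝ) satisfy W(0)=0, W(t)>0 for all t ∈ (−∞,1]\{0}, and W strictly convex, and let k ∈ ℤ\{0}. Let the boundary data be u_bd(cos φ, sin φ) = (cos(kφ), sin(kφ), 0) ∈ ℝ³ for φ ∈ [0,2π). Then for every ε > 0, any minimiser u_ε of E_ε over 𝒜 (with target ℝ³) has the representation u_ε(r cos φ, r sin φ) = f_ε(r)(cos(kφ), sin(kφ), 0) ± g_ε(r)(0,0,1), r ∈ (0,1), φ ∈ [0,2π), where f_ε > 0 and g_ε ≥ 0 on (0,1) and the pair (f_ε, g_ε) solves the ODE system −f_ε'' − (1/r) f_ε' + (k²/r²) f_ε = (1/ε²) f_ε W'(1 − f_ε² − g_ε²), −g_ε'' − (1/r) g_ε' = (1/ε²) g_ε W'(1 − f_ε² − g_ε²) on (0,1), with boundary conditions f_ε(0)=0, f_ε(1)=1, g_ε'(0)=0, g_ε(1)=0. -/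

import Mathlib

open MeasureTheory Set Bornology

noncomputable section

/-- Euclidean dot product on `Fin n → ℝ`. -/
def dotR {n : ℕ} (a b : Fin n → ℝ) : ℝ := ∑ j, a j * b j

/-- Squared Euclidean norm on `Fin n → ℝ`. -/
def normSq {n : ℕ} (a : Fin n → ℝ) : ℝ := ∑ j, a j ^ 2

/-- Pointwise (Frobenius) inner product of gradients `∇u · ∇v`. -/
def gradDot {m n : ℕ} (u v : (Fin m → ℝ) → Fin n → ℝ) (x : Fin m → ℝ) : ℝ :=
  ∑ i, ∑ j, fderiv ℝ u x (Pi.single i (1:ℝ)) j * fderiv ℝ v x (Pi.single i (1:ℝ)) j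

/-- `|∇u|²`. -/
def gradSq {m n : ℕ} (u : (Fin m → ℝ) → Fin n → ℝ) (x : Fin m → ℝ) : ℝ := gradDot u u x

/-- Scalar version of `gradDot`. -/
def gradDotS {m : ℕ} (φ ψ : (Fin m → ℝ) → ℝ) (x : Fin m → ℝ) : ℝ :=
  ∑ i, fderiv ℝ φ x (Pi.single i (1:ℝ)) * fderiv ℝ ψ x (Pi.single i (1:ℝ))

/-- `|∇φ|²` for scalar `φ`. -/
def gradSqS {m : ℕ} (φ : (Fin m → ℝ) → ℝ) (x : Fin m → ℝ) : ℝ := gradDotS φ φ x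

/-- `W'`, the (one-sided) derivative of the potential on `(-∞, 1]`. -/
def Wd (W : ℝ → ℝ) : ℝ → ℝ := derivWithin W (Iic (1:ℝ))

/-- The Ginzburg–Landau energy `E_ε`. -/
def GLenergy {m n : ℕ} (W : ℝ → ℝ) (ε : ℝ) (Ω : Set (Fin m → ℝ))
    (u : (Fin m → ℝ) → Fin n → ℝ) : ℝ :=
  ∫ x in Ω, (gradSq u x / 2 + W (1 - normSq (u x)) / (2 * ε ^ 2))

/-- The admissible class `𝒜`: `H¹` maps attaining the boundary data `ubd` on `∂Ω`. -/
def Admissible {m n : ℕ} (Ω : Set (Fin m → ℝ)) (ubd u : (Fin m → ℝ) → Fin n → ℝ) : Prop :=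
  ContDiffOn ℝ 1 u Ω ∧ ContinuousOn u (closure Ω) ∧
  IntegrableOn (gradSq u) Ω ∧ IntegrableOn (fun x => normSq (u x)) Ω ∧
  EqOn u ubd (frontier Ω)

/-- `H¹₀(Ω; ℝⁿ)`. -/
def H10 {m n : ℕ} (Ω : Set (Fin m → ℝ)) (v : (Fin m → ℝ) → Fin n → ℝ) : Prop :=
  ContDiffOn ℝ 1 v Ω ∧ ContinuousOn v (closure Ω) ∧
  IntegrableOn (gradSq v) Ω ∧ IntegrableOn (fun x => normSq (v x)) Ω ∧
  EqOn v 0 (frontier Ω)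

/-- `H¹₀(Ω; ℝ)`. -/
def H10S {m : ℕ} (Ω : Set (Fin m → ℝ)) (φ : (Fin m → ℝ) → ℝ) : Prop :=
  ContDiffOn ℝ 1 φ Ω ∧ ContinuousOn φ (closure Ω) ∧
  IntegrableOn (gradSqS φ) Ω ∧ IntegrableOn (fun x => φ x ^ 2) Ω ∧
  EqOn φ 0 (frontier Ω)

/-- Critical point of `E_ε`: weak solution of `-Δu = ε⁻² u W'(1-|u|²)` in `Ω`. -/
def IsCritical {m n : ℕ} (W : ℝ → ℝ) (ε : ℝ) (Ω : Set (Fin m → ℝ))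
    (u : (Fin m → ℝ) → Fin n → ℝ) : Prop :=
  ∀ v, H10 Ω v →
    (∫ x in Ω, (gradDot u v x - 1 / ε ^ 2 * Wd W (1 - normSq (u x)) * dotR (u x) (v x))) = 0

/-- Minimiser of `E_ε` over `𝒜`. -/
def IsMinimiser {m n : ℕ} (W : ℝ → ℝ) (ε : ℝ) (Ω : Set (Fin m → ℝ))
    (ubd u : (Fin m → ℝ) → Fin n → ℝ) : Prop :=
  Admissible Ω ubd u ∧ ∀ v, Admissible Ω ubd v → GLenergy W ε Ω u ≤ GLenergy W ε Ω v

/-- Orthogonal transformation of `ℝⁿ` (element of `O(n)`). -/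
def IsOrth {n : ℕ} (R : (Fin n → ℝ) →ₗ[ℝ] (Fin n → ℝ)) : Prop :=
  Function.Bijective R ∧ ∀ a b, dotR (R a) (R b) = dotR a b

/-- The radial ODE system \eqref{syst:ode}-\eqref{syst:bc} for the profiles `(f, g)`. -/
def SolvesSystem (W : ℝ → ℝ) (ε : ℝ) (k : ℤ) (f g : ℝ → ℝ) : Prop :=
  ContinuousOn f (Icc 0 1) ∧ ContinuousOn g (Icc 0 1) ∧
  ContDiffOn ℝ 2 f (Ioo 0 1) ∧ ContDiffOn ℝ 2 g (Ioo 0 1) ∧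
  (∀ r ∈ Ioo (0:ℝ) 1,
    -deriv (deriv f) r - 1 / r * deriv f r + (k : ℝ) ^ 2 / r ^ 2 * f r
      = 1 / ε ^ 2 * f r * Wd W (1 - f r ^ 2 - g r ^ 2)) ∧
  (∀ r ∈ Ioo (0:ℝ) 1,
    -deriv (deriv g) r - 1 / r * deriv g r
      = 1 / ε ^ 2 * g r * Wd W (1 - f r ^ 2 - g r ^ 2)) ∧
  f 0 = 0 ∧ f 1 = 1 ∧ derivWithin g (Icc 0 1) 0 = 0 ∧ g 1 = 0

/-- The open unit disk in `ℝ²`. -/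
def unitDisk : Set (Fin 2 → ℝ) := {x | x 0 ^ 2 + x 1 ^ 2 < 1}

/-- The boundary data of winding number `k`:
`u_bd (cos φ, sin φ) = (cos (k φ), sin (k φ), 0)`. -/
def ubdDeg (k : ℤ) (x : Fin 2 → ℝ) : Fin 3 → ℝ :=
  ![Real.cos ((k : ℝ) * Complex.arg ((x 0 : ℂ) + (x 1 : ℂ) * Complex.I)),
    Real.sin ((k : ℝ) * Complex.arg ((x 0 : ℂ) + (x 1 : ℂ) * Complex.I)), 0]

/-- The rotationally symmetric map with radial profiles `(f, s • g)`:
`(r cos φ, r sin φ) ↦ (f r cos (k φ), f r sin (k φ), s · g r)`. -/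
def radialMap (k : ℤ) (f g : ℝ → ℝ) (s : ℝ) (x : Fin 2 → ℝ) : Fin 3 → ℝ :=
  ![f (Real.sqrt (normSq x)) * Real.cos ((k : ℝ) * Complex.arg ((x 0 : ℂ) + (x 1 : ℂ) * Complex.I)),
    f (Real.sqrt (normSq x)) * Real.sin ((k : ℝ) * Complex.arg ((x 0 : ℂ) + (x 1 : ℂ) * Complex.I)),
    s * g (Real.sqrt (normSq x))]

/-! ### The unit disk -/

lemma isOpen_unitDisk : IsOpen unitDisk :=
  isOpen_lt (by fun_prop) continuous_const

lemma closure_unitDisk : closure unitDisk = {x | x 0 ^ 2 + x 1 ^ 2 ≤ 1} := by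
  apply Subset.antisymm
  · exact closure_minimal (fun x (hx : x 0 ^ 2 + x 1 ^ 2 < 1) => hx.le)
      (isClosed_le (by fun_prop) continuous_const)
  · intro x hx
    have hx' : x 0 ^ 2 + x 1 ^ 2 ≤ 1 := hx
    have h1 : Filter.Tendsto (fun t : ℝ => t • x) (nhdsWithin 1 (Iio 1)) (nhds x) := by
      have : Filter.Tendsto (fun t : ℝ => t • x) (nhds 1) (nhds ((1 : ℝ) • x)) :=
        (by fun_prop : Continuous fun t : ℝ => t • x).tendsto 1
      rw [one_smul] at this
      exact this.mono_left nhdsWithin_le_nhds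
    refine mem_closure_of_tendsto h1 ?_
    filter_upwards [Ioo_mem_nhdsLT (show (0 : ℝ) < 1 by norm_num)] with t ht
    show (t • x) 0 ^ 2 + (t • x) 1 ^ 2 < 1
    simp only [Pi.smul_apply, smul_eq_mul]
    nlinarith [ht.1, ht.2, mul_nonneg ht.1.le (sub_nonneg.2 ht.2.le), sq_nonneg (x 0),
      sq_nonneg (x 1), mul_nonneg (mul_nonneg ht.1.le ht.1.le) (sub_nonneg.2 hx')]

lemma frontier_unitDisk : frontier unitDisk = {x | x 0 ^ 2 + x 1 ^ 2 = 1} := by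
  rw [frontier, isOpen_unitDisk.interior_eq, closure_unitDisk]
  ext x
  simp only [unitDisk, mem_sdiff, mem_ofPred_eq, not_lt]
  exact ⟨fun h => le_antisymm h.1 h.2, fun h => ⟨h.le, h.ge⟩⟩

lemma measurableSet_unitDisk : MeasurableSet unitDisk := isOpen_unitDisk.measurableSet

lemma isCompact_closure_unitDisk : IsCompact (closure unitDisk) := by
  refine Metric.isCompact_of_isClosed_isBounded isClosed_closure ?_
  refine (Metric.isBounded_closedBall (x := (0 : Fin 2 → ℝ)) (r := 1)).subset ?_
  rw [closure_unitDisk]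
  intro x hx
  have hx' : x 0 ^ 2 + x 1 ^ 2 ≤ 1 := hx
  rw [mem_closedBall_zero_iff, pi_norm_le_iff_of_nonneg zero_le_one]
  intro i
  rw [Real.norm_eq_abs, ← sq_le_one_iff_abs_le_one]
  fin_cases i
  · show x 0 ^ 2 ≤ 1
    nlinarith [sq_nonneg (x 1)]
  · show x 1 ^ 2 ≤ 1
    nlinarith [sq_nonneg (x 0)]

lemma integrableOn_unitDisk_of_continuousOn {F : (Fin 2 → ℝ) → ℝ}
    (hF : ContinuousOn F (closure unitDisk)) : IntegrableOn F unitDisk :=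
  (hF.integrableOn_compact isCompact_closure_unitDisk).mono_set subset_closure

lemma volume_unitDisk_lt_top : volume unitDisk < ⊤ :=
  (measure_mono subset_closure).trans_lt isCompact_closure_unitDisk.measure_lt_top

lemma exists_bound_unitDisk {F : (Fin 2 → ℝ) → ℝ} (hF : ContinuousOn F (closure unitDisk)) :
    ∃ C, 0 ≤ C ∧ ∀ x ∈ unitDisk, |F x| ≤ C := by
  obtain ⟨C, hC⟩ := isCompact_closure_unitDisk.exists_bound_of_continuousOn hF
  exact ⟨max C 0, le_max_right _ _, fun x hx => (hC x (subset_closure hx)).trans (le_max_left _ _)⟩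

/-- A nonnegative function that is continuous on the disk and has zero integral vanishes there. -/
lemma eq_zero_of_setIntegral_eq_zero {F : (Fin 2 → ℝ) → ℝ} (hF : ContinuousOn F unitDisk)
    (hint : IntegrableOn F unitDisk) (h0 : ∀ x ∈ unitDisk, 0 ≤ F x)
    (h : ∫ x in unitDisk, F x = 0) : ∀ x ∈ unitDisk, F x = 0 := by
  have h1 : F =ᵐ[volume.restrict unitDisk] 0 :=
    (integral_eq_zero_iff_of_nonneg_ae
      ((ae_restrict_iff' measurableSet_unitDisk).2 (ae_of_all _ h0)) hint).1 h
  exact Measure.eqOn_open_of_ae_eq h1 isOpen_unitDisk hF continuousOn_const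

/-! ### Scalar `H¹` functions on the disk -/

/-- The `i`-th partial derivative. -/
def pd (i : Fin 2) (ψ : (Fin 2 → ℝ) → ℝ) (x : Fin 2 → ℝ) : ℝ :=
  fderiv ℝ ψ x (Pi.single i (1:ℝ))

lemma gradDotS_eq (φ ψ : (Fin 2 → ℝ) → ℝ) (x : Fin 2 → ℝ) :
    gradDotS φ ψ x = pd 0 φ x * pd 0 ψ x + pd 1 φ x * pd 1 ψ x := by
  simp [gradDotS, pd, Fin.sum_univ_two]

lemma gradSqS_eq (φ : (Fin 2 → ℝ) → ℝ) (x : Fin 2 → ℝ) :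
    gradSqS φ x = pd 0 φ x ^ 2 + pd 1 φ x ^ 2 := by
  rw [gradSqS, gradDotS_eq]; ring

/-- `C¹` functions on the disk, continuous up to the boundary, with finite Dirichlet energy. -/
structure DiskH1 (ψ : (Fin 2 → ℝ) → ℝ) : Prop where
  smooth : ContDiffOn ℝ 1 ψ unitDisk
  cont : ContinuousOn ψ (closure unitDisk)
  finite : IntegrableOn (gradSqS ψ) unitDisk

/-- Functions in `DiskH1` vanishing on the boundary circle. -/
structure DiskH10 (ψ : (Fin 2 → ℝ) → ℝ) : Prop extends DiskH1 ψ where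
  bdry : ∀ x : Fin 2 → ℝ, x 0 ^ 2 + x 1 ^ 2 = 1 → ψ x = 0

lemma ContDiffOn.differentiableAt_unitDisk {ψ : (Fin 2 → ℝ) → ℝ}
    (h : ContDiffOn ℝ 1 ψ unitDisk) {x : Fin 2 → ℝ} (hx : x ∈ unitDisk) :
    DifferentiableAt ℝ ψ x :=
  (h.contDiffAt (isOpen_unitDisk.mem_nhds hx)).differentiableAt one_ne_zero

lemma ContDiffOn.continuousOn_pd {ψ : (Fin 2 → ℝ) → ℝ} (h : ContDiffOn ℝ 1 ψ unitDisk)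
    (i : Fin 2) : ContinuousOn (pd i ψ) unitDisk :=
  (h.continuousOn_fderiv_of_isOpen isOpen_unitDisk le_rfl).clm_apply continuousOn_const

lemma ContDiffOn.continuousOn_gradDotS {φ ψ : (Fin 2 → ℝ) → ℝ} (h : ContDiffOn ℝ 1 φ unitDisk)
    (h' : ContDiffOn ℝ 1 ψ unitDisk) : ContinuousOn (gradDotS φ ψ) unitDisk := by
  rw [show gradDotS φ ψ = fun x => pd 0 φ x * pd 0 ψ x + pd 1 φ x * pd 1 ψ x from
    funext (gradDotS_eq φ ψ)]
  exact ((h.continuousOn_pd 0).mul (h'.continuousOn_pd 0)).add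
    ((h.continuousOn_pd 1).mul (h'.continuousOn_pd 1))

lemma integrableOn_unitDisk_of_le {F G : (Fin 2 → ℝ) → ℝ} (hF : ContinuousOn F unitDisk)
    (hG : IntegrableOn G unitDisk) (h : ∀ x ∈ unitDisk, |F x| ≤ G x) :
    IntegrableOn F unitDisk :=
  Integrable.mono' hG (hF.aestronglyMeasurable measurableSet_unitDisk)
    ((ae_restrict_iff' measurableSet_unitDisk).2 (ae_of_all _ h))

lemma DiskH1.integrableOn_gradDotS {φ ψ : (Fin 2 → ℝ) → ℝ} (h : DiskH1 φ) (h' : DiskH1 ψ) :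
    IntegrableOn (gradDotS φ ψ) unitDisk := by
  refine integrableOn_unitDisk_of_le (h.smooth.continuousOn_gradDotS h'.smooth)
    (h.finite.add h'.finite) fun x _ => ?_
  simp only [Pi.add_apply, gradSqS_eq, gradDotS_eq]
  rw [abs_le]
  constructor <;>
  nlinarith [sq_nonneg (pd 0 φ x + pd 0 ψ x), sq_nonneg (pd 1 φ x + pd 1 ψ x),
    sq_nonneg (pd 0 φ x - pd 0 ψ x), sq_nonneg (pd 1 φ x - pd 1 ψ x), sq_nonneg (pd 0 φ x),
    sq_nonneg (pd 1 φ x), sq_nonneg (pd 0 ψ x), sq_nonneg (pd 1 ψ x)]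

lemma DiskH1.of_le {φ a b : (Fin 2 → ℝ) → ℝ} (hs : ContDiffOn ℝ 1 φ unitDisk)
    (hc : ContinuousOn φ (closure unitDisk)) (ha : DiskH1 a) (hb : DiskH1 b) (C : ℝ)
    (h : ∀ x ∈ unitDisk, gradSqS φ x ≤ C * (gradSqS a x + gradSqS b x)) : DiskH1 φ := by
  refine ⟨hs, hc, integrableOn_unitDisk_of_le (hs.continuousOn_gradDotS hs)
    ((ha.finite.add hb.finite).const_mul C) fun x hx => ?_⟩
  have h0 : 0 ≤ gradSqS φ x := by rw [gradSqS_eq]; positivity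
  rw [abs_of_nonneg h0]
  exact h x hx

section pd

variable {φ ψ : (Fin 2 → ℝ) → ℝ} {x : Fin 2 → ℝ}

lemma pd_add (hφ : DifferentiableAt ℝ φ x) (hψ : DifferentiableAt ℝ ψ x) (i : Fin 2) :
    pd i (fun y => φ y + ψ y) x = pd i φ x + pd i ψ x := by
  simp [pd, fderiv_fun_add hφ hψ]

lemma pd_const_mul (hφ : DifferentiableAt ℝ φ x) (c : ℝ) (i : Fin 2) :
    pd i (fun y => c * φ y) x = c * pd i φ x := by
  simp [pd, fderiv_const_mul hφ c]

lemma pd_sub (hφ : DifferentiableAt ℝ φ x) (hψ : DifferentiableAt ℝ ψ x) (i : Fin 2) :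
    pd i (fun y => φ y - ψ y) x = pd i φ x - pd i ψ x := by
  simp [pd, fderiv_fun_sub hφ hψ]

end pd

lemma DiskH1.lincomb {φ ψ : (Fin 2 → ℝ) → ℝ} (h : DiskH1 φ) (h' : DiskH1 ψ) (s t : ℝ) :
    DiskH1 (fun x => s * φ x + t * ψ x) := by
  refine DiskH1.of_le ((contDiffOn_const.mul h.smooth).add (contDiffOn_const.mul h'.smooth))
    ((continuousOn_const.mul h.cont).add (continuousOn_const.mul h'.cont)) h h'
    (2 * s ^ 2 + 2 * t ^ 2) fun x hx => ?_
  have d := h.smooth.differentiableAt_unitDisk hx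
  have d' := h'.smooth.differentiableAt_unitDisk hx
  simp only [gradSqS_eq]
  rw [pd_add (d.const_mul s) (d'.const_mul t), pd_add (d.const_mul s) (d'.const_mul t),
    pd_const_mul d, pd_const_mul d, pd_const_mul d', pd_const_mul d']
  nlinarith [sq_nonneg (s * pd 0 φ x - t * pd 0 ψ x), sq_nonneg (s * pd 1 φ x - t * pd 1 ψ x),
    sq_nonneg (t * pd 0 φ x), sq_nonneg (t * pd 1 φ x), sq_nonneg (s * pd 0 ψ x),
    sq_nonneg (s * pd 1 ψ x), sq_nonneg (s * pd 0 φ x), sq_nonneg (s * pd 1 φ x),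
    sq_nonneg (t * pd 0 ψ x), sq_nonneg (t * pd 1 ψ x)]

lemma DiskH10.lincomb {φ ψ : (Fin 2 → ℝ) → ℝ} (h : DiskH10 φ) (h' : DiskH10 ψ) (s t : ℝ) :
    DiskH10 (fun x => s * φ x + t * ψ x) :=
  ⟨h.toDiskH1.lincomb h'.toDiskH1 s t, fun x hx => by simp [h.bdry x hx, h'.bdry x hx]⟩

/-! ### A regularised modulus of a pair of functions -/

/-- The regularisation `√(a² + b² + δ²) - δ` of `|(a, b)|`. -/
def softNorm (δ : ℝ) (a b : (Fin 2 → ℝ) → ℝ) (x : Fin 2 → ℝ) : ℝ :=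
  Real.sqrt (a x ^ 2 + b x ^ 2 + δ ^ 2) - δ

lemma pd_softNorm {δ : ℝ} (hδ : 0 < δ) {a b : (Fin 2 → ℝ) → ℝ} {x : Fin 2 → ℝ}
    (ha : DifferentiableAt ℝ a x) (hb : DifferentiableAt ℝ b x) (i : Fin 2) :
    pd i (softNorm δ a b) x =
      (a x * pd i a x + b x * pd i b x) / Real.sqrt (a x ^ 2 + b x ^ 2 + δ ^ 2) := by
  have hpos : 0 < a x ^ 2 + b x ^ 2 + δ ^ 2 := by positivity
  have h := ((((ha.hasFDerivAt.pow 2).add (hb.hasFDerivAt.pow 2)).add_const (δ ^ 2)).sqrt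
    hpos.ne').sub_const δ
  have h' : HasFDerivAt (softNorm δ a b) _ x := h
  have hs : 0 < Real.sqrt (a x ^ 2 + b x ^ 2 + δ ^ 2) := Real.sqrt_pos.2 hpos
  rw [pd, h'.fderiv]
  simp [pd]
  field_simp

/-- Lagrange's identity for the gradient of `softNorm`. -/
lemma gradSqS_softNorm {δ : ℝ} (hδ : 0 < δ) {a b : (Fin 2 → ℝ) → ℝ} {x : Fin 2 → ℝ}
    (ha : DifferentiableAt ℝ a x) (hb : DifferentiableAt ℝ b x) :
    gradSqS (softNorm δ a b) x ≤ gradSqS a x + gradSqS b x -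
      ((a x * pd 0 b x - b x * pd 0 a x) ^ 2 + (a x * pd 1 b x - b x * pd 1 a x) ^ 2) /
        (a x ^ 2 + b x ^ 2 + δ ^ 2) := by
  have hpos : 0 < a x ^ 2 + b x ^ 2 + δ ^ 2 := by positivity
  simp only [gradSqS_eq, pd_softNorm hδ ha hb]
  rw [div_pow, div_pow, Real.sq_sqrt hpos.le, ← add_div, le_sub_iff_add_le, ← add_div,
    div_le_iff₀ hpos]
  nlinarith [mul_nonneg (sq_nonneg δ) (sq_nonneg (pd 0 a x)),
    mul_nonneg (sq_nonneg δ) (sq_nonneg (pd 1 a x)),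
    mul_nonneg (sq_nonneg δ) (sq_nonneg (pd 0 b x)),
    mul_nonneg (sq_nonneg δ) (sq_nonneg (pd 1 b x))]

lemma DiskH1.softNorm {δ : ℝ} (hδ : 0 < δ) {a b : (Fin 2 → ℝ) → ℝ} (ha : DiskH1 a)
    (hb : DiskH1 b) : DiskH1 (softNorm δ a b) := by
  refine DiskH1.of_le ?_ ?_ ha hb 1 fun x hx => ?_
  · refine ContDiffOn.sub (ContDiffOn.sqrt (((ha.smooth.pow 2).add (hb.smooth.pow 2)).add
      contDiffOn_const) fun x _ => ?_) contDiffOn_const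
    positivity
  · exact (((ha.cont.pow 2).add (hb.cont.pow 2)).add continuousOn_const).sqrt.sub
      continuousOn_const
  · have := gradSqS_softNorm hδ (ha.smooth.differentiableAt_unitDisk hx)
      (hb.smooth.differentiableAt_unitDisk hx)
    have h0 : 0 ≤ ((a x * pd 0 b x - b x * pd 0 a x) ^ 2 +
      (a x * pd 1 b x - b x * pd 1 a x) ^ 2) / (a x ^ 2 + b x ^ 2 + δ ^ 2) := by positivity
    linarith

lemma DiskH10.softNorm {δ : ℝ} (hδ : 0 < δ) {a b : (Fin 2 → ℝ) → ℝ} (ha : DiskH10 a)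
    (hb : DiskH10 b) : DiskH10 (softNorm δ a b) :=
  ⟨ha.toDiskH1.softNorm hδ hb.toDiskH1, fun x hx => by
    simp [_root_.softNorm, ha.bdry x hx, hb.bdry x hx, Real.sqrt_sq hδ.le]⟩

/-! ### The quadratic form of a Schrödinger operator on the disk -/

/-- The bilinear form `∫ ∇φ · ∇ψ - V φ ψ` on the unit disk. -/
def formB (V φ ψ : (Fin 2 → ℝ) → ℝ) : ℝ :=
  ∫ x in unitDisk, (gradDotS φ ψ x - V x * φ x * ψ x)

lemma integrableOn_formB {V φ ψ : (Fin 2 → ℝ) → ℝ} (hV : ContinuousOn V (closure unitDisk))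
    (hφ : DiskH1 φ) (hψ : DiskH1 ψ) :
    IntegrableOn (fun x => gradDotS φ ψ x - V x * φ x * ψ x) unitDisk :=
  (hφ.integrableOn_gradDotS hψ).sub
    (integrableOn_unitDisk_of_continuousOn ((hV.mul hφ.cont).mul hψ.cont))

lemma formB_eq_sub {V φ ψ : (Fin 2 → ℝ) → ℝ} (hV : ContinuousOn V (closure unitDisk))
    (hφ : DiskH1 φ) (hψ : DiskH1 ψ) :
    formB V φ ψ = (∫ x in unitDisk, gradDotS φ ψ x) - ∫ x in unitDisk, V x * φ x * ψ x :=
  integral_sub (hφ.integrableOn_gradDotS hψ)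
    (integrableOn_unitDisk_of_continuousOn ((hV.mul hφ.cont).mul hψ.cont))

lemma formB_lincomb_left {V a b ψ : (Fin 2 → ℝ) → ℝ} (hV : ContinuousOn V (closure unitDisk))
    (ha : DiskH1 a) (hb : DiskH1 b) (hψ : DiskH1 ψ) (s t : ℝ) :
    formB V (fun x => s * a x + t * b x) ψ = s * formB V a ψ + t * formB V b ψ := by
  simp only [formB]
  rw [← integral_const_mul, ← integral_const_mul, ← integral_add
    ((integrableOn_formB hV ha hψ).const_mul s) ((integrableOn_formB hV hb hψ).const_mul t)]
  refine setIntegral_congr_fun measurableSet_unitDisk fun x hx => ?_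
  have d := ha.smooth.differentiableAt_unitDisk hx
  have d' := hb.smooth.differentiableAt_unitDisk hx
  simp only [gradDotS_eq, pd_add (d.const_mul s) (d'.const_mul t), pd_const_mul d,
    pd_const_mul d']
  ring

lemma formB_neg_right (V φ ψ : (Fin 2 → ℝ) → ℝ) (hψ : DiskH1 ψ) :
    formB V φ (fun x => (-1) * ψ x) = -formB V φ ψ := by
  simp only [formB]
  rw [← integral_neg]
  refine setIntegral_congr_fun measurableSet_unitDisk fun x hx => ?_
  have d := hψ.smooth.differentiableAt_unitDisk hx
  simp only [gradDotS_eq, pd_const_mul d]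
  ring

/-- Dominated convergence on the disk with a constant bound. -/
lemma tendsto_setIntegral_unitDisk {F : ℝ → (Fin 2 → ℝ) → ℝ} {f : (Fin 2 → ℝ) → ℝ} {C : ℝ}
    (hF : ∀ t ∈ Ioc (0:ℝ) 1, ContinuousOn (F t) unitDisk)
    (hb : ∀ t ∈ Ioc (0:ℝ) 1, ∀ x ∈ unitDisk, |F t x| ≤ C)
    (hl : ∀ x ∈ unitDisk, Filter.Tendsto (fun t => F t x) (nhdsWithin 0 (Ioi 0)) (nhds (f x))) :
    Filter.Tendsto (fun t => ∫ x in unitDisk, F t x) (nhdsWithin 0 (Ioi 0))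
      (nhds (∫ x in unitDisk, f x)) := by
  have hev : ∀ᶠ t : ℝ in nhdsWithin 0 (Ioi 0), t ∈ Ioc (0:ℝ) 1 :=
    Ioc_mem_nhdsGT one_pos
  refine tendsto_integral_filter_of_dominated_convergence (fun _ => C) ?_ ?_ ?_ ?_
  · filter_upwards [hev] with t ht
    exact (hF t ht).aestronglyMeasurable measurableSet_unitDisk
  · filter_upwards [hev] with t ht
    exact (ae_restrict_iff' measurableSet_unitDisk).2 (ae_of_all _ (hb t ht))
  · exact integrableOn_const volume_unitDisk_lt_top.ne
  · exact (ae_restrict_iff' measurableSet_unitDisk).2 (ae_of_all _ hl)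

/-- Two functions annihilated by a nonnegative Schrödinger form have zero Wronskian. -/
theorem wronskian_eq_zero {V a b : (Fin 2 → ℝ) → ℝ} (hV : ContinuousOn V (closure unitDisk))
    (hpos : ∀ ψ, DiskH10 ψ → 0 ≤ formB V ψ ψ) (ha : DiskH10 a) (hb : DiskH10 b)
    (qa : formB V a a = 0) (qb : formB V b b = 0) :
    ∀ x ∈ unitDisk, ∀ i, a x * pd i b x = b x * pd i a x := by
  set wr : (Fin 2 → ℝ) → ℝ := fun x =>
    ((a x * pd 0 b x - b x * pd 0 a x) ^ 2 + (a x * pd 1 b x - b x * pd 1 a x) ^ 2) /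
      (a x ^ 2 + b x ^ 2 + 1) with hwr
  have hac := ha.cont.mono subset_closure
  have hbc := hb.cont.mono subset_closure
  have hwrc : ContinuousOn wr unitDisk := by
    refine ContinuousOn.div ?_ (by fun_prop) fun x _ => by positivity
    exact (((hac.mul (hb.smooth.continuousOn_pd 0)).sub
      (hbc.mul (ha.smooth.continuousOn_pd 0))).pow 2).add
      (((hac.mul (hb.smooth.continuousOn_pd 1)).sub
      (hbc.mul (ha.smooth.continuousOn_pd 1))).pow 2)
  have hwr0 : ∀ x, 0 ≤ wr x := fun x => by positivity
  have hwrle : ∀ x, wr x ≤ gradSqS a x + gradSqS b x := by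
    intro x
    rw [hwr, gradSqS_eq, gradSqS_eq]
    simp only
    rw [div_le_iff₀ (by positivity)]
    nlinarith [sq_nonneg (a x * pd 0 a x + b x * pd 0 b x),
      sq_nonneg (a x * pd 1 a x + b x * pd 1 b x), sq_nonneg (pd 0 a x), sq_nonneg (pd 1 a x),
      sq_nonneg (pd 0 b x), sq_nonneg (pd 1 b x)]
  have hwri : IntegrableOn wr unitDisk :=
    integrableOn_unitDisk_of_le hwrc (ha.finite.add hb.finite) fun x _ => by
      rw [abs_of_nonneg (hwr0 x)]; exact hwrle x
  have hia : IntegrableOn (fun x => V x * a x * a x) unitDisk :=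
    integrableOn_unitDisk_of_continuousOn ((hV.mul ha.cont).mul ha.cont)
  have hib : IntegrableOn (fun x => V x * b x * b x) unitDisk :=
    integrableOn_unitDisk_of_continuousOn ((hV.mul hb.cont).mul hb.cont)
  obtain ⟨CV, hCV0, hCV⟩ := exists_bound_unitDisk hV
  obtain ⟨Ca, hCa0, hCa⟩ := exists_bound_unitDisk ha.cont
  obtain ⟨Cb, hCb0, hCb⟩ := exists_bound_unitDisk hb.cont
  have hsq : ∀ δ > 0, ∀ x, softNorm δ a b x * softNorm δ a b x ≤ a x ^ 2 + b x ^ 2 := by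
    intro δ hδ x
    have h1 : 0 ≤ a x ^ 2 + b x ^ 2 + δ ^ 2 := by positivity
    have h2 := Real.sq_sqrt h1
    have h3 : δ ≤ Real.sqrt (a x ^ 2 + b x ^ 2 + δ ^ 2) :=
      Real.le_sqrt_of_sq_le (by nlinarith [sq_nonneg (a x), sq_nonneg (b x)])
    simp only [softNorm]
    nlinarith
  have key : ∀ δ ∈ Ioc (0:ℝ) 1, ∫ x in unitDisk, wr x ≤
      (∫ x in unitDisk, (gradSqS a x + gradSqS b x)) -
        ∫ x in unitDisk, V x * softNorm δ a b x * softNorm δ a b x := by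
    intro δ hδ
    have h1 := hpos _ (ha.softNorm hδ.1 hb)
    have hs := (ha.softNorm hδ.1 hb).toDiskH1
    rw [formB_eq_sub hV hs hs] at h1
    have h2 : ∫ x in unitDisk, gradDotS (softNorm δ a b) (softNorm δ a b) x ≤
        ∫ x in unitDisk, ((gradSqS a x + gradSqS b x) - wr x) := by
      refine setIntegral_mono_on hs.finite ((ha.finite.add hb.finite).sub hwri)
        measurableSet_unitDisk fun x hx => ?_
      refine (gradSqS_softNorm hδ.1 (ha.smooth.differentiableAt_unitDisk hx)
        (hb.smooth.differentiableAt_unitDisk hx)).trans ?_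
      simp only [hwr]
      have hδ2 : 0 < δ ^ 2 := pow_pos hδ.1 2
      exact sub_le_sub_left (div_le_div_of_nonneg_left (by positivity) (by positivity)
        (by nlinarith [hδ.1, hδ.2])) _
    have h3 : ∫ x in unitDisk, ((gradSqS a x + gradSqS b x) - wr x) =
        (∫ x in unitDisk, (gradSqS a x + gradSqS b x)) - ∫ x in unitDisk, wr x :=
      integral_sub (ha.finite.add hb.finite) hwri
    linarith
  have hlim : Filter.Tendsto (fun δ => ∫ x in unitDisk, V x * softNorm δ a b x * softNorm δ a b x)
      (nhdsWithin 0 (Ioi 0)) (nhds (∫ x in unitDisk, (V x * a x * a x + V x * b x * b x))) := by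
    refine tendsto_setIntegral_unitDisk (C := CV * (Ca ^ 2 + Cb ^ 2)) ?_ ?_ ?_
    · intro δ hδ
      have hs := (ha.softNorm hδ.1 hb).cont.mono subset_closure
      exact ((hV.mono subset_closure).mul hs).mul hs
    · intro δ hδ x hx
      rw [mul_assoc, abs_mul, abs_of_nonneg (mul_self_nonneg (softNorm δ a b x))]
      refine mul_le_mul (hCV x hx) ((hsq δ hδ.1 x).trans ?_) (mul_self_nonneg _) hCV0
      exact add_le_add (sq_le_sq' (abs_le.1 (hCa x hx)).1 (abs_le.1 (hCa x hx)).2)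
        (sq_le_sq' (abs_le.1 (hCb x hx)).1 (abs_le.1 (hCb x hx)).2)
    · intro x _
      have hc : Continuous fun δ : ℝ => V x * softNorm δ a b x * softNorm δ a b x := by
        unfold softNorm; fun_prop
      have h2 := (hc.tendsto 0).mono_left (nhdsWithin_le_nhds (s := Ioi 0))
      have h0 : V x * softNorm 0 a b x * softNorm 0 a b x = V x * a x * a x + V x * b x * b x := by
        have h1 : 0 ≤ a x ^ 2 + b x ^ 2 + 0 ^ 2 := by positivity
        have h2 := Real.mul_self_sqrt h1
        simp only [softNorm, sub_zero]
        rw [mul_assoc, h2]; ring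
      rwa [h0] at h2
  have hle : ∫ x in unitDisk, wr x ≤ 0 := by
    have h1 := ge_of_tendsto (tendsto_const_nhds.sub hlim)
      (Filter.mem_of_superset (Ioc_mem_nhdsGT (one_pos (α := ℝ))) key)
    have h2 : ∫ x in unitDisk, (gradSqS a x + gradSqS b x) =
      (∫ x in unitDisk, gradDotS a a x) + ∫ x in unitDisk, gradDotS b b x :=
      integral_add ha.finite hb.finite
    rw [h2, integral_add hia hib] at h1
    rw [formB_eq_sub hV ha.toDiskH1 ha.toDiskH1] at qa
    rw [formB_eq_sub hV hb.toDiskH1 hb.toDiskH1] at qb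
    linarith
  have hzero := eq_zero_of_setIntegral_eq_zero hwrc hwri (fun x _ => hwr0 x)
    (le_antisymm hle (integral_nonneg hwr0))
  intro x hx i
  have h := hzero x hx
  simp only [hwr] at h
  rw [div_eq_zero_iff, or_iff_left (by positivity)] at h
  have e0 : a x * pd 0 b x - b x * pd 0 a x = 0 := by
    nlinarith [sq_nonneg (a x * pd 0 b x - b x * pd 0 a x),
      sq_nonneg (a x * pd 1 b x - b x * pd 1 a x)]
  have e1 : a x * pd 1 b x - b x * pd 1 a x = 0 := by
    nlinarith [sq_nonneg (a x * pd 0 b x - b x * pd 0 a x),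
      sq_nonneg (a x * pd 1 b x - b x * pd 1 a x)]
  fin_cases i
  · exact sub_eq_zero.1 e0
  · exact sub_eq_zero.1 e1

/-! ### The potential -/

section potential

variable {W : ℝ → ℝ}

lemma continuousOn_Wd (hW : ContDiffOn ℝ 1 W (Iic (1:ℝ))) : ContinuousOn (Wd W) (Iic 1) :=
  hW.continuousOn_derivWithin (uniqueDiffOn_Iic 1) le_rfl

lemma Wd_mul_lt (hW : ContDiffOn ℝ 1 W (Iic (1:ℝ))) (hc : StrictConvexOn ℝ (Iic (1:ℝ)) W)
    {a b : ℝ} (ha : a ≤ 1) (hb : b ≤ 1) (hab : a ≠ b) : Wd W a * (b - a) < W b - W a := by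
  have hd : ∀ t ≤ (1:ℝ), DifferentiableWithinAt ℝ W (Iic 1) t := fun t ht =>
    hW.differentiableOn one_ne_zero t ht
  rcases lt_or_gt_of_ne hab with h | h
  · have := hc.derivWithin_lt_slope ha hb h (hd a ha)
    rw [slope_def_field, lt_div_iff₀ (sub_pos.2 h)] at this
    exact this
  · have := hc.slope_lt_derivWithin hb ha h (hd a ha)
    rw [slope_def_field, div_lt_iff₀ (sub_pos.2 h)] at this
    have e : Wd W a * (b - a) = -(derivWithin W (Iic 1) a * (a - b)) := by
      rw [Wd]; ring
    linarith

lemma Wd_mul_le (hW : ContDiffOn ℝ 1 W (Iic (1:ℝ))) (hc : StrictConvexOn ℝ (Iic (1:ℝ)) W)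
    {a b : ℝ} (ha : a ≤ 1) (hb : b ≤ 1) : Wd W a * (b - a) ≤ W b - W a := by
  by_cases h : a = b
  · simp [h]
  · exact (Wd_mul_lt hW hc ha hb h).le

lemma tendsto_setIntegral_Wd (hW : ContDiffOn ℝ 1 W (Iic (1:ℝ)))
    {n K : ℝ → (Fin 2 → ℝ) → ℝ} {M C : ℝ}
    (hn : ∀ t ∈ Ioc (0:ℝ) 1, ContinuousOn (n t) unitDisk)
    (hK : ∀ t ∈ Ioc (0:ℝ) 1, ContinuousOn (K t) unitDisk)
    (hn0 : ∀ t, ∀ x, 0 ≤ n t x)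
    (hnM : ∀ t ∈ Ioc (0:ℝ) 1, ∀ x ∈ unitDisk, n t x ≤ M)
    (hKC : ∀ t ∈ Ioc (0:ℝ) 1, ∀ x ∈ unitDisk, |K t x| ≤ C)
    (hnl : ∀ x ∈ unitDisk, Filter.Tendsto (fun t => n t x) (nhdsWithin 0 (Ioi 0)) (nhds (n 0 x)))
    (hKl : ∀ x ∈ unitDisk,
      Filter.Tendsto (fun t => K t x) (nhdsWithin 0 (Ioi 0)) (nhds (K 0 x))) :
    Filter.Tendsto (fun t => ∫ x in unitDisk, Wd W (1 - n t x) * K t x) (nhdsWithin 0 (Ioi 0))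
      (nhds (∫ x in unitDisk, Wd W (1 - n 0 x) * K 0 x)) := by
  have hWd := continuousOn_Wd hW
  obtain ⟨B, hB⟩ := (isCompact_Icc (a := 1 - M) (b := 1)).exists_bound_of_continuousOn
    (hWd.mono Icc_subset_Iic_self)
  have hmem : ∀ t, ∀ x, 1 - n t x ∈ Iic (1:ℝ) := fun t x => by
    rw [mem_Iic]; linarith [hn0 t x]
  refine tendsto_setIntegral_unitDisk (C := max B 0 * C) ?_ ?_ ?_
  · intro t ht
    exact (hWd.comp (continuousOn_const.sub (hn t ht)) fun x _ => hmem t x).mul (hK t ht)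
  · intro t ht x hx
    rw [abs_mul]
    refine mul_le_mul ((hB _ ⟨?_, hmem t x⟩).trans (le_max_left _ _)) (hKC t ht x hx)
      (abs_nonneg _) (le_max_right _ _)
    linarith [hnM t ht x hx]
  · intro x hx
    refine Filter.Tendsto.mul ?_ (hKl x hx)
    have h1 : Filter.Tendsto (Wd W) (nhdsWithin (1 - n 0 x) (Iic 1)) (nhds (Wd W (1 - n 0 x))) :=
      hWd _ (hmem 0 x)
    refine h1.comp (tendsto_nhdsWithin_iff.2 ⟨tendsto_const_nhds.sub (hnl x hx), ?_⟩)
    exact Filter.Eventually.of_forall fun t => hmem t x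

end potential

/-! ### Components of admissible maps -/

section components

variable {ubd u v : (Fin 2 → ℝ) → Fin 3 → ℝ}

lemma fderiv_apply_component {x : Fin 2 → ℝ} (hu : DifferentiableAt ℝ u x) (i : Fin 2)
    (j : Fin 3) : fderiv ℝ u x (Pi.single i (1:ℝ)) j = pd i (fun y => u y j) x := by
  rw [pd, fderiv_apply hu]
  rfl

lemma gradSq_eq_sum {x : Fin 2 → ℝ} (hu : DifferentiableAt ℝ u x) :
    gradSq u x = ∑ j, gradSqS (fun y => u y j) x := by
  simp only [gradSq, gradDot, fderiv_apply_component hu, gradSqS_eq, Fin.sum_univ_two]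
  rw [← Finset.sum_add_distrib]
  exact Finset.sum_congr rfl fun j _ => by ring

lemma Admissible.differentiableAt (hu : Admissible unitDisk ubd u) {x : Fin 2 → ℝ}
    (hx : x ∈ unitDisk) : DifferentiableAt ℝ u x :=
  (hu.1.contDiffAt (isOpen_unitDisk.mem_nhds hx)).differentiableAt one_ne_zero

lemma Admissible.component (hu : Admissible unitDisk ubd u) (j : Fin 3) :
    DiskH1 (fun x => u x j) := by
  have hs : ContDiffOn ℝ 1 (fun x => u x j) unitDisk := contDiffOn_pi.1 hu.1 j
  refine ⟨hs, continuousOn_pi.1 hu.2.1 j,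
    integrableOn_unitDisk_of_le (hs.continuousOn_gradDotS hs) hu.2.2.1 fun x hx => ?_⟩
  rw [gradSq_eq_sum (hu.differentiableAt hx)]
  have h0 : ∀ i, 0 ≤ gradSqS (fun y => u y i) x := fun i => by rw [gradSqS_eq]; positivity
  change |gradSqS (fun y => u y j) x| ≤ _
  rw [abs_of_nonneg (h0 j)]
  exact Finset.single_le_sum (f := fun i => gradSqS (fun y => u y i) x) (fun i _ => h0 i)
    (Finset.mem_univ j)

lemma continuousOn_normSq (hu : ContinuousOn u (closure unitDisk)) :
    ContinuousOn (fun x => normSq (u x)) (closure unitDisk) := by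
  have := continuousOn_pi.1 hu
  unfold normSq
  fun_prop

lemma admissible_of_components (h : ∀ j, DiskH1 (fun x => v x j))
    (hb : ∀ x : Fin 2 → ℝ, x 0 ^ 2 + x 1 ^ 2 = 1 → v x = ubd x) :
    Admissible unitDisk ubd v := by
  have hs : ContDiffOn ℝ 1 v unitDisk := contDiffOn_pi.2 fun j => (h j).smooth
  have hc : ContinuousOn v (closure unitDisk) := continuousOn_pi.2 fun j => (h j).cont
  refine ⟨hs, hc, ?_, integrableOn_unitDisk_of_continuousOn (continuousOn_normSq hc), ?_⟩
  · have h1 : IntegrableOn (fun x => ∑ j, gradSqS (fun y => v y j) x) unitDisk :=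
      integrable_finsetSum _ fun j _ => (h j).finite
    refine h1.congr_fun (fun x hx => (gradSq_eq_sum ?_).symm) measurableSet_unitDisk
    exact (hs.contDiffAt (isOpen_unitDisk.mem_nhds hx)).differentiableAt one_ne_zero
  · rw [frontier_unitDisk]
    exact fun x hx => hb x hx

lemma Admissible.bdry (hu : Admissible unitDisk ubd u) {x : Fin 2 → ℝ}
    (hx : x 0 ^ 2 + x 1 ^ 2 = 1) : u x = ubd x :=
  hu.2.2.2.2 (by rw [frontier_unitDisk]; exact hx)

lemma normSq_nonneg (a : Fin 3 → ℝ) : 0 ≤ normSq a :=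
  Finset.sum_nonneg fun _ _ => sq_nonneg _

end components

/-! ### Variations of minimisers -/

/-- The potential of the linearised equation at `u`. -/
def potV (W : ℝ → ℝ) (ε : ℝ) (u : (Fin 2 → ℝ) → Fin 3 → ℝ) (x : Fin 2 → ℝ) : ℝ :=
  1 / ε ^ 2 * Wd W (1 - normSq (u x))

section minimisers

variable {W : ℝ → ℝ} {ε : ℝ} {ubd u v : (Fin 2 → ℝ) → Fin 3 → ℝ}

lemma continuousOn_comp_one_sub_normSq {G : ℝ → ℝ} (hG : ContinuousOn G (Iic 1))
    (hu : Admissible unitDisk ubd u) :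
    ContinuousOn (fun x => G (1 - normSq (u x))) (closure unitDisk) :=
  hG.comp (continuousOn_const.sub (continuousOn_normSq hu.2.1)) fun x _ => by
    simp only [mem_Iic, sub_le_self_iff]; exact normSq_nonneg _

lemma continuousOn_potV (hW : ContDiffOn ℝ 1 W (Iic (1:ℝ))) (hu : Admissible unitDisk ubd u) :
    ContinuousOn (potV W ε u) (closure unitDisk) :=
  continuousOn_const.mul (continuousOn_comp_one_sub_normSq (continuousOn_Wd hW) hu)

lemma two_mul_energy_sub (hW : ContDiffOn ℝ 1 W (Iic (1:ℝ)))
    (hu : Admissible unitDisk ubd u) (hv : Admissible unitDisk ubd v) :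
    2 * (GLenergy W ε unitDisk v - GLenergy W ε unitDisk u) =
      ∫ x in unitDisk, (gradSq v x - gradSq u x +
        1 / ε ^ 2 * (W (1 - normSq (v x)) - W (1 - normSq (u x)))) := by
  have hi : ∀ w, Admissible unitDisk ubd w → IntegrableOn
      (fun x => gradSq w x / 2 + W (1 - normSq (w x)) / (2 * ε ^ 2)) unitDisk := fun w hw =>
    (hw.2.2.1.div_const 2).add ((integrableOn_unitDisk_of_continuousOn
      (continuousOn_comp_one_sub_normSq hW.continuousOn hw)).div_const _)
  rw [GLenergy, GLenergy, ← integral_sub (hi v hv) (hi u hu), ← integral_const_mul]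
  congr 1
  ext x
  ring

lemma IsMinimiser.variation (hW : ContDiffOn ℝ 1 W (Iic (1:ℝ)))
    (hc : StrictConvexOn ℝ (Iic (1:ℝ)) W) (hu : IsMinimiser W ε unitDisk ubd u)
    (hv : Admissible unitDisk ubd v) :
    0 ≤ ∫ x in unitDisk, (gradSq v x - gradSq u x -
      1 / ε ^ 2 * (Wd W (1 - normSq (v x)) * (normSq (v x) - normSq (u x)))) := by
  have h1 := two_mul_energy_sub (ε := ε) hW hu.1 hv
  have h2 := hu.2 v hv
  refine le_trans (by linarith : (0:ℝ) ≤ _) (h1.le.trans ?_)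
  have c1 := integrableOn_unitDisk_of_continuousOn
    (continuousOn_comp_one_sub_normSq hW.continuousOn hv)
  have c2 := integrableOn_unitDisk_of_continuousOn
    (continuousOn_comp_one_sub_normSq hW.continuousOn hu.1)
  have c3 := integrableOn_unitDisk_of_continuousOn
    ((continuousOn_comp_one_sub_normSq (continuousOn_Wd hW) hv).mul
      ((continuousOn_normSq hv.2.1).sub (continuousOn_normSq hu.1.2.1)))
  refine setIntegral_mono_on ((hv.2.2.1.sub hu.1.2.2.1).add ((c1.sub c2).const_mul _))
    ((hv.2.2.1.sub hu.1.2.2.1).sub (c3.const_mul _)) measurableSet_unitDisk fun x _ => ?_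
  have h3 := Wd_mul_le hW hc (a := 1 - normSq (v x)) (b := 1 - normSq (u x))
    (by linarith [normSq_nonneg (v x)]) (by linarith [normSq_nonneg (u x)])
  have h4 : (0:ℝ) ≤ 1 / ε ^ 2 := by positivity
  have h5 : W (1 - normSq (v x)) - W (1 - normSq (u x)) ≤
      -(Wd W (1 - normSq (v x)) * (normSq (v x) - normSq (u x))) := by
    linarith
  have h6 := mul_le_mul_of_nonneg_left h5 h4
  linarith

lemma normSq_update (a : Fin 3 → ℝ) (j : Fin 3) (s : ℝ) :
    normSq (Function.update a j s) = normSq a + (s ^ 2 - a j ^ 2) := by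
  fin_cases j <;> simp [normSq, Fin.sum_univ_three, Function.update] <;> ring

/-- Variation of a single component of a minimiser. -/
lemma IsMinimiser.variation_component (hW : ContDiffOn ℝ 1 W (Iic (1:ℝ)))
    (hc : StrictConvexOn ℝ (Iic (1:ℝ)) W) (hu : IsMinimiser W ε unitDisk ubd u) (j : Fin 3)
    {φ : (Fin 2 → ℝ) → ℝ} (hφ : DiskH1 φ)
    (hb : ∀ x : Fin 2 → ℝ, x 0 ^ 2 + x 1 ^ 2 = 1 → φ x = u x j) :
    0 ≤ ∫ x in unitDisk, (gradSqS φ x - gradSqS (fun y => u y j) x -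
      1 / ε ^ 2 * (Wd W (1 - (normSq (u x) + (φ x ^ 2 - u x j ^ 2))) *
        (φ x ^ 2 - u x j ^ 2))) := by
  set v : (Fin 2 → ℝ) → Fin 3 → ℝ := fun x => Function.update (u x) j (φ x) with hv
  have hvi : ∀ i, (fun x => v x i) = if i = j then φ else fun x => u x i := by
    intro i
    by_cases h : i = j
    · subst h; simp [hv]
    · simp [hv, h]
  have hvA : Admissible unitDisk ubd v := by
    refine admissible_of_components (fun i => ?_) fun x hx => ?_
    · rw [hvi]
      split_ifs
      · exact hφ
      · exact hu.1.component i
    · simp only [hv, hb x hx, Function.update_eq_self]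
      exact hu.1.bdry hx
  refine (hu.variation hW hc hvA).trans_eq (setIntegral_congr_fun measurableSet_unitDisk ?_)
  intro x hx
  have e1 : gradSq v x - gradSq u x = gradSqS φ x - gradSqS (fun y => u y j) x := by
    rw [gradSq_eq_sum (hvA.differentiableAt hx), gradSq_eq_sum (hu.1.differentiableAt hx),
      ← Finset.sum_sub_distrib, Finset.sum_eq_single j]
    · rw [hvi, if_pos rfl]
    · intro i _ hij
      rw [hvi, if_neg hij, sub_self]
    · simp
  have e2 : normSq (v x) = normSq (u x) + (φ x ^ 2 - u x j ^ 2) := normSq_update _ _ _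
  simp only [e1, e2]
  ring_nf

end minimisers

section minimisers

variable {W : ℝ → ℝ} {ε : ℝ} {ubd u v : (Fin 2 → ℝ) → Fin 3 → ℝ}

/-- First-order consequence of minimality along a family of variations of one component. -/
lemma IsMinimiser.variation_limit (hW : ContDiffOn ℝ 1 W (Iic (1:ℝ)))
    (hc : StrictConvexOn ℝ (Iic (1:ℝ)) W) (hu : IsMinimiser W ε unitDisk ubd u) (j : Fin 3)
    {φ K : ℝ → (Fin 2 → ℝ) → ℝ} {τ : ℝ → ℝ} {a b : (Fin 2 → ℝ) → ℝ} {C : ℝ}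
    (hτ : ∀ t ∈ Ioc (0:ℝ) 1, 0 < τ t ∧ τ t ≤ 1) (hτ0 : τ 0 = 0)
    (hτl : Filter.Tendsto τ (nhdsWithin 0 (Ioi 0)) (nhds 0))
    (hφ : ∀ t ∈ Ioc (0:ℝ) 1, DiskH1 (φ t))
    (hbd : ∀ t ∈ Ioc (0:ℝ) 1, ∀ x : Fin 2 → ℝ, x 0 ^ 2 + x 1 ^ 2 = 1 → φ t x = u x j)
    (hK : ∀ t ∈ Ioc (0:ℝ) 1, ContinuousOn (K t) (closure unitDisk))
    (hKC : ∀ t ∈ Ioc (0:ℝ) 1, ∀ x ∈ unitDisk, |K t x| ≤ C)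
    (hKl : ∀ x ∈ unitDisk,
      Filter.Tendsto (fun t => K t x) (nhdsWithin 0 (Ioi 0)) (nhds (K 0 x)))
    (hsq : ∀ t ∈ Ioc (0:ℝ) 1, ∀ x, φ t x ^ 2 - u x j ^ 2 = τ t * K t x)
    (ha : IntegrableOn a unitDisk) (hb : IntegrableOn b unitDisk)
    (hg : ∀ t ∈ Ioc (0:ℝ) 1, ∀ x ∈ unitDisk,
      gradSqS (φ t) x - gradSqS (fun y => u y j) x ≤ τ t * (a x + t * b x)) :
    0 ≤ (∫ x in unitDisk, a x) - ∫ x in unitDisk, potV W ε u x * K 0 x := by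
  set n : ℝ → (Fin 2 → ℝ) → ℝ := fun t x => |normSq (u x) + τ t * K t x| with hn
  have hnc := continuousOn_normSq hu.1.2.1
  obtain ⟨Cn, hCn0, hCn⟩ := exists_bound_unitDisk hnc
  have hn0 : ∀ t x, 0 ≤ n t x := fun t x => abs_nonneg _
  have hncont : ∀ t ∈ Ioc (0:ℝ) 1, ContinuousOn (n t) (closure unitDisk) := fun t ht =>
    (hnc.add (continuousOn_const.mul (hK t ht))).abs
  have hlim := tendsto_setIntegral_Wd hW (n := n) (K := K) (M := Cn + C) (C := C)
    (fun t ht => (hncont t ht).mono subset_closure) (fun t ht => (hK t ht).mono subset_closure)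
    hn0 (fun t ht x hx => by
      refine (abs_add_le _ _).trans (add_le_add (hCn x hx) ?_)
      rw [abs_mul, abs_of_pos (hτ t ht).1]
      have := hKC t ht x hx
      nlinarith [(hτ t ht).1, (hτ t ht).2, abs_nonneg (K t x)]) hKC
    (fun x hx => by
      simp only [hn, hτ0]
      exact (tendsto_const_nhds.add (hτl.mul (hKl x hx))).abs) hKl
  have hlim2 : Filter.Tendsto (fun t => (∫ x in unitDisk, a x) + t * (∫ x in unitDisk, b x) -
      1 / ε ^ 2 * ∫ x in unitDisk, Wd W (1 - n t x) * K t x) (nhdsWithin 0 (Ioi 0))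
      (nhds ((∫ x in unitDisk, a x) + 0 * (∫ x in unitDisk, b x) -
      1 / ε ^ 2 * ∫ x in unitDisk, Wd W (1 - n 0 x) * K 0 x)) := by
    refine (tendsto_const_nhds.add (Filter.Tendsto.mul_const _ ?_)).sub (hlim.const_mul _)
    exact Filter.tendsto_id.mono_left nhdsWithin_le_nhds
  have key : ∀ t ∈ Ioc (0:ℝ) 1, 0 ≤ (∫ x in unitDisk, a x) + t * (∫ x in unitDisk, b x) -
      1 / ε ^ 2 * ∫ x in unitDisk, Wd W (1 - n t x) * K t x := by
    intro t ht
    have hneq : ∀ x, normSq (u x) + (φ t x ^ 2 - u x j ^ 2) = n t x := fun x => by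
      have h0 := normSq_nonneg (Function.update (u x) j (φ t x))
      rw [normSq_update] at h0
      rw [← abs_of_nonneg h0, hsq t ht x]
    have h1 := hu.variation_component hW hc j (hφ t ht) (hbd t ht)
    have hWi : IntegrableOn (fun x => Wd W (1 - n t x) * K t x) unitDisk := by
      refine integrableOn_unitDisk_of_continuousOn (((continuousOn_Wd hW).comp
        (continuousOn_const.sub (hncont t ht)) fun x _ => ?_).mul (hK t ht))
      show 1 - n t x ≤ 1
      linarith [hn0 t x]
    have hWi' := hWi.const_mul (1 / ε ^ 2)
    have hab : IntegrableOn (fun x => a x + t * b x) unitDisk := ha.add (hb.const_mul t)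
    have h2 : ∫ x in unitDisk, (gradSqS (φ t) x - gradSqS (fun y => u y j) x -
      1 / ε ^ 2 * (Wd W (1 - (normSq (u x) + (φ t x ^ 2 - u x j ^ 2))) *
        (φ t x ^ 2 - u x j ^ 2))) ≤ ∫ x in unitDisk, τ t * ((a x + t * b x) -
          1 / ε ^ 2 * (Wd W (1 - n t x) * K t x)) := by
      have hWi2 : IntegrableOn (fun x => 1 / ε ^ 2 *
          (Wd W (1 - (normSq (u x) + (φ t x ^ 2 - u x j ^ 2))) *
          (φ t x ^ 2 - u x j ^ 2))) unitDisk := by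
        refine (hWi'.const_mul (τ t)).congr (ae_of_all _ fun x => ?_)
        simp only []
        rw [hneq x, hsq t ht x]
        ring
      refine setIntegral_mono_on ((((hφ t ht).finite).sub (hu.1.component j).finite).sub hWi2)
        ((hab.sub hWi').const_mul _) measurableSet_unitDisk fun x hx => ?_
      rw [hneq, hsq t ht]
      have := hg t ht x hx
      linarith
    rw [integral_const_mul, integral_sub hab hWi', integral_add ha (hb.const_mul t),
      integral_const_mul, integral_const_mul] at h2
    have h3 := h1.trans h2
    exact nonneg_of_mul_nonneg_right h3 (hτ t ht).1
  have h1 := ge_of_tendsto hlim2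
    (Filter.mem_of_superset (Ioc_mem_nhdsGT (one_pos (α := ℝ))) key)
  have h2 : 1 / ε ^ 2 * ∫ x in unitDisk, Wd W (1 - n 0 x) * K 0 x =
      ∫ x in unitDisk, potV W ε u x * K 0 x := by
    rw [← integral_const_mul]
    congr 1
    ext x
    simp only [hn, hτ0, potV, zero_mul, add_zero, abs_of_nonneg (normSq_nonneg (u x))]
    ring
  rw [h2] at h1
  linarith

lemma IsMinimiser.formB_nonneg (hW : ContDiffOn ℝ 1 W (Iic (1:ℝ)))
    (hc : StrictConvexOn ℝ (Iic (1:ℝ)) W) (hu : IsMinimiser W ε unitDisk ubd u) (j : Fin 3)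
    {η : (Fin 2 → ℝ) → ℝ} (hη : DiskH10 η) :
    0 ≤ formB (potV W ε u) (fun x => u x j) η := by
  have huj := hu.1.component j
  obtain ⟨Cu, hCu0, hCu⟩ := exists_bound_unitDisk huj.cont
  obtain ⟨Ce, hCe0, hCe⟩ := exists_bound_unitDisk hη.cont
  have h := hu.variation_limit (ε := ε) hW hc j (φ := fun t x => 1 * u x j + t * η x)
    (K := fun t x => 2 * u x j * η x + t * η x ^ 2) (τ := fun t => t)
    (a := fun x => 2 * gradDotS (fun y => u y j) η x) (b := gradSqS η)
    (C := 2 * (Cu * Ce) + Ce ^ 2) (fun t ht => ⟨ht.1, ht.2⟩) rfl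
    (Filter.tendsto_id.mono_left nhdsWithin_le_nhds) (fun t _ => huj.lincomb hη.toDiskH1 1 t)
    (fun t _ x hx => by simp [hη.bdry x hx])
    (fun t _ => ((continuousOn_const.mul huj.cont).mul hη.cont).add
      (continuousOn_const.mul (hη.cont.pow 2)))
    (fun t ht x hx => by
      have h1 := hCu x hx
      have h2 := hCe x hx
      refine (abs_add_le _ _).trans (add_le_add ?_ ?_)
      · rw [mul_assoc, abs_mul, abs_mul, abs_two]
        gcongr
      · rw [abs_mul, abs_of_pos ht.1, abs_of_nonneg (sq_nonneg _), ← sq_abs]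
        have h3 : |η x| ^ 2 ≤ Ce ^ 2 := by gcongr
        nlinarith [ht.1, ht.2, sq_nonneg |η x|])
    (fun x _ => ((by fun_prop : Continuous fun t : ℝ => 2 * u x j * η x + t * η x ^ 2).tendsto
      0).mono_left nhdsWithin_le_nhds)
    (fun t _ x => by ring) ((huj.integrableOn_gradDotS hη.toDiskH1).const_mul 2) hη.finite
    (fun t _ x hx => by
      have d := huj.smooth.differentiableAt_unitDisk hx
      have d' := hη.smooth.differentiableAt_unitDisk hx
      simp only [gradSqS_eq, gradDotS_eq, pd_add (d.const_mul 1) (d'.const_mul t),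
        pd_const_mul d, pd_const_mul d']
      apply le_of_eq
      ring)
  rw [formB_eq_sub (continuousOn_potV hW hu.1) huj hη.toDiskH1]
  rw [integral_const_mul] at h
  have e : ∫ x in unitDisk, potV W ε u x * (2 * u x j * η x + 0 * η x ^ 2) =
      2 * ∫ x in unitDisk, potV W ε u x * u x j * η x := by
    rw [← integral_const_mul]
    congr 1
    ext x
    ring
  rw [e] at h
  linarith

/-- The Euler–Lagrange equation of a minimiser, componentwise. -/
lemma IsMinimiser.formB_eq_zero (hW : ContDiffOn ℝ 1 W (Iic (1:ℝ)))
    (hc : StrictConvexOn ℝ (Iic (1:ℝ)) W) (hu : IsMinimiser W ε unitDisk ubd u) (j : Fin 3)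
    {η : (Fin 2 → ℝ) → ℝ} (hη : DiskH10 η) :
    formB (potV W ε u) (fun x => u x j) η = 0 := by
  have h1 := hu.formB_nonneg hW hc j hη
  have hη' : DiskH10 (fun x => (-1) * η x) := by
    have := hη.lincomb hη (-1) 0
    simpa only [zero_mul, add_zero] using this
  have h2 := hu.formB_nonneg hW hc j hη'
  rw [formB_neg_right _ _ _ hη.toDiskH1] at h2
  linarith

/-- If the last component vanishes on the boundary, then the linearised operator is nonnegative:
replacing `u₃` by `√(u₃² + ψ²)` acts like adding a fourth component `ψ`. -/
lemma IsMinimiser.form_nonneg (hW : ContDiffOn ℝ 1 W (Iic (1:ℝ)))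
    (hc : StrictConvexOn ℝ (Iic (1:ℝ)) W) (hu : IsMinimiser W ε unitDisk ubd u)
    (hb : ∀ x : Fin 2 → ℝ, x 0 ^ 2 + x 1 ^ 2 = 1 → u x 2 = 0)
    {ψ : (Fin 2 → ℝ) → ℝ} (hψ : DiskH10 ψ) : 0 ≤ formB (potV W ε u) ψ ψ := by
  have huj := hu.1.component 2
  have htψ : ∀ t : ℝ, DiskH1 (fun x => t * ψ x) := fun t => by
    have := hψ.toDiskH1.lincomb hψ.toDiskH1 t 0
    simpa only [zero_mul, add_zero] using this
  obtain ⟨Cu, hCu0, hCu⟩ := exists_bound_unitDisk huj.cont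
  obtain ⟨Ce, hCe0, hCe⟩ := exists_bound_unitDisk hψ.cont
  have hpos3 : ∀ t : ℝ, 0 < t → 0 < t ^ 3 := fun t ht => pow_pos ht 3
  have hcs : ∀ t, ContinuousOn (fun x =>
      Real.sqrt (u x 2 ^ 2 + (t * ψ x) ^ 2 + (t ^ 3) ^ 2)) (closure unitDisk) := fun t =>
    (((huj.cont.pow 2).add ((continuousOn_const.mul hψ.cont).pow 2)).add
      continuousOn_const).sqrt
  have h := hu.variation_limit (ε := ε) hW hc 2
    (φ := fun t => softNorm (t ^ 3) (fun x => u x 2) (fun x => t * ψ x))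
    (K := fun t x => ψ x ^ 2 + 2 * t ^ 4 -
      2 * t * Real.sqrt (u x 2 ^ 2 + (t * ψ x) ^ 2 + (t ^ 3) ^ 2)) (τ := fun t => t ^ 2)
    (a := gradSqS ψ) (b := fun _ => 0)
    (C := Ce ^ 2 + 2 + 2 * (Cu + Ce + 1))
    (fun t ht => ⟨pow_pos ht.1 2, pow_le_one₀ ht.1.le ht.2⟩) (by norm_num)
    ((by simpa using (continuous_pow 2).tendsto (0:ℝ) :
      Filter.Tendsto (fun t : ℝ => t ^ 2) (nhds 0) (nhds 0)).mono_left nhdsWithin_le_nhds)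
    (fun t ht => huj.softNorm (hpos3 t ht.1) (htψ t))
    (fun t ht x hx => by
      simp [softNorm, hψ.bdry x hx, hb x hx, Real.sqrt_sq (hpos3 t ht.1).le])
    (fun t _ => ((hψ.cont.pow 2).add continuousOn_const).sub (continuousOn_const.mul (hcs t)))
    (fun t ht x hx => by
      have h1 := hCu x hx
      have h2 := hCe x hx
      have h3 : |ψ x| ^ 2 ≤ Ce ^ 2 := by gcongr
      rw [sq_abs] at h3
      have ht3 : t ^ 3 ≤ 1 := pow_le_one₀ ht.1.le ht.2
      have ht4 : t ^ 4 ≤ 1 := pow_le_one₀ ht.1.le ht.2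
      have ht30 := hpos3 t ht.1
      have ht40 : 0 < t ^ 4 := pow_pos ht.1 4
      have h4 : Real.sqrt (u x 2 ^ 2 + (t * ψ x) ^ 2 + (t ^ 3) ^ 2) ≤ Cu + Ce + 1 := by
        refine Real.sqrt_le_iff.2 ⟨by positivity, ?_⟩
        have a1 : u x 2 ^ 2 ≤ Cu ^ 2 := by
          rw [← sq_abs]; gcongr
        have a2 : (t * ψ x) ^ 2 ≤ Ce ^ 2 := by
          rw [← sq_abs, abs_mul, abs_of_pos ht.1]
          have : t * |ψ x| ≤ Ce := by nlinarith [abs_nonneg (ψ x), ht.1, ht.2]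
          have : 0 ≤ t * |ψ x| := mul_nonneg ht.1.le (abs_nonneg _)
          gcongr
        have a3 : (t ^ 3) ^ 2 ≤ 1 := pow_le_one₀ ht30.le ht3
        nlinarith [mul_nonneg hCu0 hCe0]
      have h5 := Real.sqrt_nonneg (u x 2 ^ 2 + (t * ψ x) ^ 2 + (t ^ 3) ^ 2)
      have h6 : t * Real.sqrt (u x 2 ^ 2 + (t * ψ x) ^ 2 + (t ^ 3) ^ 2) ≤ Cu + Ce + 1 := by
        nlinarith [ht.1, ht.2]
      have h7 : 0 ≤ t * Real.sqrt (u x 2 ^ 2 + (t * ψ x) ^ 2 + (t ^ 3) ^ 2) :=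
        mul_nonneg ht.1.le h5
      rw [abs_le]
      constructor <;> nlinarith [sq_nonneg (ψ x), sq_nonneg Ce])
    (fun x _ => ((by fun_prop : Continuous fun t : ℝ => ψ x ^ 2 + 2 * t ^ 4 -
      2 * t * Real.sqrt (u x 2 ^ 2 + (t * ψ x) ^ 2 + (t ^ 3) ^ 2)).tendsto
      0).mono_left nhdsWithin_le_nhds)
    (fun t _ x => by
      have := Real.sq_sqrt (show 0 ≤ u x 2 ^ 2 + (t * ψ x) ^ 2 + (t ^ 3) ^ 2 by positivity)
      simp only [softNorm]
      linear_combination this) hψ.finite (integrableOn_zero)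
    (fun t ht x hx => by
      have d := huj.smooth.differentiableAt_unitDisk hx
      have d' := hψ.smooth.differentiableAt_unitDisk hx
      have h1 := gradSqS_softNorm (hpos3 t ht.1) d (d'.const_mul t)
      have h0 : 0 ≤ ((u x 2 * pd 0 (fun y => t * ψ y) x - t * ψ x * pd 0 (fun y => u y 2) x) ^ 2 +
        (u x 2 * pd 1 (fun y => t * ψ y) x - t * ψ x * pd 1 (fun y => u y 2) x) ^ 2) /
        (u x 2 ^ 2 + (t * ψ x) ^ 2 + (t ^ 3) ^ 2) := by positivity
      have h2 : gradSqS (fun y => t * ψ y) x = t ^ 2 * gradSqS ψ x := by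
        simp only [gradSqS_eq, pd_const_mul d']; ring
      linarith)
  rw [formB_eq_sub (continuousOn_potV hW hu.1) hψ.toDiskH1 hψ.toDiskH1]
  have e : ∫ x in unitDisk, potV W ε u x * (ψ x ^ 2 + 2 * 0 ^ 4 -
      2 * 0 * Real.sqrt (u x 2 ^ 2 + (0 * ψ x) ^ 2 + (0 ^ 3) ^ 2)) =
      ∫ x in unitDisk, potV W ε u x * ψ x * ψ x := by
    congr 1
    ext x
    ring
  rw [e] at h
  exact h

/-- Two minimisers have equal modulus, and their difference is annihilated by the linearised
form. -/
lemma IsMinimiser.sub_eq_zero (hε : 0 < ε) (hW : ContDiffOn ℝ 1 W (Iic (1:ℝ)))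
    (hc : StrictConvexOn ℝ (Iic (1:ℝ)) W) (hu : IsMinimiser W ε unitDisk ubd u)
    (hb : ∀ x : Fin 2 → ℝ, x 0 ^ 2 + x 1 ^ 2 = 1 → u x 2 = 0)
    (hv : IsMinimiser W ε unitDisk ubd v) :
    (∀ x ∈ unitDisk, normSq (v x) = normSq (u x)) ∧
    (∀ j, DiskH10 (fun x => v x j - u x j)) ∧
    ∀ j, formB (potV W ε u) (fun x => v x j - u x j) (fun x => v x j - u x j) = 0 := by
  have hV := continuousOn_potV (ε := ε) hW hu.1
  have hw : ∀ j, DiskH10 (fun x => v x j - u x j) := fun j => by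
    refine ⟨?_, fun x hx => by rw [hv.1.bdry hx, hu.1.bdry hx, sub_self]⟩
    have := (hv.1.component j).lincomb (hu.1.component j) 1 (-1)
    refine (funext fun x => ?_ : (fun x => v x j - u x j) =
      fun x => 1 * v x j + (-1) * u x j) ▸ this
    ring
  set gap : (Fin 2 → ℝ) → ℝ := fun x => 1 / ε ^ 2 * (W (1 - normSq (v x)) - W (1 - normSq (u x)) -
    Wd W (1 - normSq (u x)) * (normSq (u x) - normSq (v x))) with hgap
  have hle : ∀ x, 1 - normSq (u x) ≤ 1 ∧ 1 - normSq (v x) ≤ 1 := fun x =>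
    ⟨by linarith [normSq_nonneg (u x)], by linarith [normSq_nonneg (v x)]⟩
  have hε2 : 0 < 1 / ε ^ 2 := by positivity
  have hgc : ContinuousOn gap (closure unitDisk) :=
    continuousOn_const.mul (((continuousOn_comp_one_sub_normSq hW.continuousOn hv.1).sub
      (continuousOn_comp_one_sub_normSq hW.continuousOn hu.1)).sub
      ((continuousOn_comp_one_sub_normSq (continuousOn_Wd hW) hu.1).mul
      ((continuousOn_normSq hu.1.2.1).sub (continuousOn_normSq hv.1.2.1))))
  have hg0 : ∀ x, 0 ≤ gap x := fun x => by
    refine mul_nonneg hε2.le ?_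
    have := Wd_mul_le hW hc (hle x).1 (hle x).2
    linarith [show 1 - normSq (v x) - (1 - normSq (u x)) = normSq (u x) - normSq (v x) by ring,
      congrArg (fun s => Wd W (1 - normSq (u x)) * s)
        (show 1 - normSq (v x) - (1 - normSq (u x)) = normSq (u x) - normSq (v x) by ring)]
  have hgi := integrableOn_unitDisk_of_continuousOn hgc
  have hE : GLenergy W ε unitDisk v - GLenergy W ε unitDisk u = 0 := by
    linarith [hu.2 v hv.1, hv.2 u hu.1]
  have h1 := two_mul_energy_sub (ε := ε) hW hu.1 hv.1
  rw [hE, mul_zero] at h1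
  have hwi : ∀ j, IntegrableOn (fun x =>
      (gradDotS (fun y => v y j - u y j) (fun y => v y j - u y j) x -
        potV W ε u x * (v x j - u x j) * (v x j - u x j)) +
      2 * (gradDotS (fun y => u y j) (fun y => v y j - u y j) x -
        potV W ε u x * u x j * (v x j - u x j))) unitDisk := fun j =>
    (integrableOn_formB hV (hw j).toDiskH1 (hw j).toDiskH1).add
      ((integrableOn_formB hV (hu.1.component j) (hw j).toDiskH1).const_mul 2)
  have h2 : ∫ x in unitDisk, (gradSq v x - gradSq u x +
        1 / ε ^ 2 * (W (1 - normSq (v x)) - W (1 - normSq (u x)))) =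
      ∫ x in unitDisk, ((∑ j, ((gradDotS (fun y => v y j - u y j) (fun y => v y j - u y j) x -
        potV W ε u x * (v x j - u x j) * (v x j - u x j)) +
      2 * (gradDotS (fun y => u y j) (fun y => v y j - u y j) x -
        potV W ε u x * u x j * (v x j - u x j)))) + gap x) := by
    refine setIntegral_congr_fun measurableSet_unitDisk fun x hx => ?_
    have d := fun j => (hu.1.component j).smooth.differentiableAt_unitDisk hx
    have d' := fun j => (hv.1.component j).smooth.differentiableAt_unitDisk hx
    simp only [gradSq_eq_sum (hu.1.differentiableAt hx), gradSq_eq_sum (hv.1.differentiableAt hx),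
      gradSqS_eq, gradDotS_eq, Fin.sum_univ_three, hgap, potV, normSq]
    rw [pd_sub (d' 0) (d 0), pd_sub (d' 0) (d 0), pd_sub (d' 1) (d 1), pd_sub (d' 1) (d 1),
      pd_sub (d' 2) (d 2), pd_sub (d' 2) (d 2)]
    ring
  rw [h2, integral_add (integrable_finsetSum _ fun j _ => hwi j) hgi,
    integral_finsetSum _ fun j _ => hwi j] at h1
  have h3 : ∀ j, ∫ x in unitDisk,
      ((gradDotS (fun y => v y j - u y j) (fun y => v y j - u y j) x -
        potV W ε u x * (v x j - u x j) * (v x j - u x j)) +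
      2 * (gradDotS (fun y => u y j) (fun y => v y j - u y j) x -
        potV W ε u x * u x j * (v x j - u x j))) =
      formB (potV W ε u) (fun x => v x j - u x j) (fun x => v x j - u x j) := fun j => by
    rw [integral_add (integrableOn_formB hV (hw j).toDiskH1 (hw j).toDiskH1)
      ((integrableOn_formB hV (hu.1.component j) (hw j).toDiskH1).const_mul 2),
      integral_const_mul]
    have := hu.formB_eq_zero hW hc j (hw j)
    rw [formB] at this
    rw [this, formB]
    ring
  simp only [h3] at h1
  have h4 : ∀ j, 0 ≤ formB (potV W ε u) (fun x => v x j - u x j) (fun x => v x j - u x j) :=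
    fun j => hu.form_nonneg hW hc hb (hw j)
  have h5 : 0 ≤ ∫ x in unitDisk, gap x := integral_nonneg hg0
  have h6 := Finset.sum_nonneg fun j (_ : j ∈ Finset.univ) => h4 j
  refine ⟨fun x hx => ?_, hw, fun j => ?_⟩
  · have h7 := eq_zero_of_setIntegral_eq_zero (hgc.mono subset_closure) hgi (fun x _ => hg0 x)
      (by linarith) x hx
    by_contra hne
    have h8 := Wd_mul_lt hW hc (hle x).1 (hle x).2 (fun h => hne (by linarith))
    rw [hgap] at h7
    rcases mul_eq_zero.1 h7 with h9 | h9
    · exact hε2.ne' h9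
    · rw [show 1 - normSq (v x) - (1 - normSq (u x)) = normSq (u x) - normSq (v x) by ring] at h8
      linarith
  · exact (Finset.sum_eq_zero_iff_of_nonneg fun j _ => h4 j).1 (by linarith) j (Finset.mem_univ j)

end minimisers

/-! ### Rotations and reflections of the disk -/

/-- The rotation by `α`, composed with the reflection `φ ↦ -φ` if `σ = -1`. -/
def rot (α σ : ℝ) : (Fin 2 → ℝ) →L[ℝ] (Fin 2 → ℝ) :=
  LinearMap.toContinuousLinearMap (Matrix.toLin'
    !![Real.cos α, -(σ * Real.sin α); Real.sin α, σ * Real.cos α])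

/-- The point with polar coordinates `(r, φ)`. -/
def pt (r φ : ℝ) : Fin 2 → ℝ := ![r * Real.cos φ, r * Real.sin φ]

@[simp] lemma pt_zero (r φ : ℝ) : pt r φ 0 = r * Real.cos φ := rfl
@[simp] lemma pt_one (r φ : ℝ) : pt r φ 1 = r * Real.sin φ := rfl

lemma rot_apply (α σ : ℝ) (x : Fin 2 → ℝ) :
    rot α σ x = ![Real.cos α * x 0 - σ * Real.sin α * x 1,
      Real.sin α * x 0 + σ * Real.cos α * x 1] := by
  ext i
  fin_cases i <;> simp [rot, Matrix.toLin'_apply, Matrix.mulVec, dotProduct, Fin.sum_univ_two]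
  ring

lemma rot_apply_zero (α σ : ℝ) (x : Fin 2 → ℝ) :
    rot α σ x 0 = Real.cos α * x 0 - σ * Real.sin α * x 1 := by
  rw [rot_apply]; rfl

lemma rot_apply_one (α σ : ℝ) (x : Fin 2 → ℝ) :
    rot α σ x 1 = Real.sin α * x 0 + σ * Real.cos α * x 1 := by
  rw [rot_apply]; rfl

section rot

variable {σ : ℝ}

lemma sq_eq_one_of_sign (hσ : σ = 1 ∨ σ = -1) : σ ^ 2 = 1 := by
  rcases hσ with h | h <;> simp [h]

lemma rot_normSq (hσ : σ = 1 ∨ σ = -1) (α : ℝ) (x : Fin 2 → ℝ) :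
    rot α σ x 0 ^ 2 + rot α σ x 1 ^ 2 = x 0 ^ 2 + x 1 ^ 2 := by
  have h := Real.sin_sq_add_cos_sq α
  have h2 := sq_eq_one_of_sign hσ
  rw [rot_apply_zero, rot_apply_one]
  linear_combination (x 0 ^ 2 + σ ^ 2 * x 1 ^ 2) * h + x 1 ^ 2 * h2

lemma rot_mem_unitDisk (hσ : σ = 1 ∨ σ = -1) (α : ℝ) {x : Fin 2 → ℝ} :
    rot α σ x ∈ unitDisk ↔ x ∈ unitDisk := by
  simp only [unitDisk, mem_ofPred_eq, rot_normSq hσ]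

lemma rot_mem_closure (hσ : σ = 1 ∨ σ = -1) (α : ℝ) {x : Fin 2 → ℝ} :
    rot α σ x ∈ closure unitDisk ↔ x ∈ closure unitDisk := by
  simp only [closure_unitDisk, mem_ofPred_eq, rot_normSq hσ]

lemma rot_pt (hσ : σ = 1 ∨ σ = -1) (α r φ : ℝ) : rot α σ (pt r φ) = pt r (α + σ * φ) := by
  rw [rot_apply, pt, pt]
  rcases hσ with rfl | rfl
  · ext i
    fin_cases i
    · simp [Real.cos_add]; ring
    · simp [Real.sin_add]; ring
  · ext i
    fin_cases i
    · simp [Real.cos_add]; ring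
    · simp [Real.sin_add]; ring

lemma det_rot (hσ : σ = 1 ∨ σ = -1) (α : ℝ) :
    |LinearMap.det (rot α σ : (Fin 2 → ℝ) →ₗ[ℝ] (Fin 2 → ℝ))| = 1 := by
  have : LinearMap.det (rot α σ : (Fin 2 → ℝ) →ₗ[ℝ] (Fin 2 → ℝ)) = σ := by
    rw [rot, LinearMap.coe_toContinuousLinearMap, LinearMap.det_toLin', Matrix.det_fin_two_of]
    linear_combination σ * Real.sin_sq_add_cos_sq α
  rw [this]
  rcases hσ with rfl | rfl <;> simp

lemma measurePreserving_rot (hσ : σ = 1 ∨ σ = -1) (α : ℝ) :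
    MeasurePreserving (rot α σ) volume volume := by
  refine ⟨(rot α σ).continuous.measurable, ?_⟩
  have hd := det_rot hσ α
  have h := Real.map_linearMap_volume_pi_eq_smul_volume_pi
    (f := (rot α σ : (Fin 2 → ℝ) →ₗ[ℝ] (Fin 2 → ℝ))) (fun h => by simp [h] at hd)
  rw [abs_inv, hd] at h
  simpa using h

lemma measurableEmbedding_rot (hσ : σ = 1 ∨ σ = -1) (α : ℝ) :
    MeasurableEmbedding (rot α σ) := by
  refine (rot α σ).continuous.measurableEmbedding ?_
  have hd := det_rot hσ α
  have h : LinearMap.det (rot α σ : (Fin 2 → ℝ) →ₗ[ℝ] (Fin 2 → ℝ)) ≠ 0 :=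
    fun h => by simp [h] at hd
  exact (LinearEquiv.ofIsUnitDet (f := (rot α σ : (Fin 2 → ℝ) →ₗ[ℝ] (Fin 2 → ℝ)))
    (v := Pi.basisFun ℝ (Fin 2)) (v' := Pi.basisFun ℝ (Fin 2))
    (by rw [LinearMap.det_toMatrix]; exact h.isUnit)).injective

lemma preimage_rot_unitDisk (hσ : σ = 1 ∨ σ = -1) (α : ℝ) :
    rot α σ ⁻¹' unitDisk = unitDisk := by
  ext x
  exact rot_mem_unitDisk hσ α

lemma setIntegral_comp_rot (hσ : σ = 1 ∨ σ = -1) (α : ℝ) (F : (Fin 2 → ℝ) → ℝ) :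
    ∫ x in unitDisk, F (rot α σ x) = ∫ x in unitDisk, F x := by
  have := (measurePreserving_rot hσ α).setIntegral_preimage_emb (measurableEmbedding_rot hσ α) F
    unitDisk
  rwa [preimage_rot_unitDisk hσ] at this

lemma integrableOn_comp_rot (hσ : σ = 1 ∨ σ = -1) (α : ℝ) {F : (Fin 2 → ℝ) → ℝ}
    (hF : IntegrableOn F unitDisk) : IntegrableOn (fun x => F (rot α σ x)) unitDisk := by
  have := ((measurePreserving_rot hσ α).integrableOn_comp_preimage
    (measurableEmbedding_rot hσ α) (f := F) (s := unitDisk)).2 hF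
  rwa [preimage_rot_unitDisk hσ] at this

lemma pd_comp_rot (α σ : ℝ) {ψ : (Fin 2 → ℝ) → ℝ} {x : Fin 2 → ℝ}
    (h : DifferentiableAt ℝ ψ (rot α σ x)) :
    pd 0 (fun y => ψ (rot α σ y)) x =
      Real.cos α * pd 0 ψ (rot α σ x) + Real.sin α * pd 1 ψ (rot α σ x) ∧
    pd 1 (fun y => ψ (rot α σ y)) x =
      -(σ * Real.sin α) * pd 0 ψ (rot α σ x) + σ * Real.cos α * pd 1 ψ (rot α σ x) := by
  have h1 : HasFDerivAt (fun y => ψ (rot α σ y)) ((fderiv ℝ ψ (rot α σ x)).comp (rot α σ)) x :=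
    h.hasFDerivAt.comp x (rot α σ).hasFDerivAt
  have e : ∀ a b : ℝ, (![a, b] : Fin 2 → ℝ) =
      a • Pi.single 0 (1:ℝ) + b • Pi.single 1 (1:ℝ) := fun a b => by
    ext i; fin_cases i <;> simp
  constructor
  · simp only [pd, h1.fderiv, ContinuousLinearMap.comp_apply]
    rw [rot_apply α σ (Pi.single 0 1), e, map_add, map_smul, map_smul]
    simp
  · simp only [pd, h1.fderiv, ContinuousLinearMap.comp_apply]
    rw [rot_apply α σ (Pi.single 1 1), e, map_add, map_smul, map_smul]
    simp

lemma gradDotS_comp_rot (hσ : σ = 1 ∨ σ = -1) (α : ℝ) {φ ψ : (Fin 2 → ℝ) → ℝ} {x : Fin 2 → ℝ}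
    (h : DifferentiableAt ℝ φ (rot α σ x)) (h' : DifferentiableAt ℝ ψ (rot α σ x)) :
    gradDotS (fun y => φ (rot α σ y)) (fun y => ψ (rot α σ y)) x =
      gradDotS φ ψ (rot α σ x) := by
  have hs := Real.sin_sq_add_cos_sq α
  have h2 := sq_eq_one_of_sign hσ
  rw [gradDotS_eq, gradDotS_eq, (pd_comp_rot α σ h).1, (pd_comp_rot α σ h).2,
    (pd_comp_rot α σ h').1, (pd_comp_rot α σ h').2]
  linear_combination (pd 0 φ (rot α σ x) * pd 0 ψ (rot α σ x) +
    pd 1 φ (rot α σ x) * pd 1 ψ (rot α σ x)) * hs +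
    (Real.sin α * pd 0 φ (rot α σ x) - Real.cos α * pd 1 φ (rot α σ x)) *
    (Real.sin α * pd 0 ψ (rot α σ x) - Real.cos α * pd 1 ψ (rot α σ x)) * h2

lemma DiskH1.comp_rot (hσ : σ = 1 ∨ σ = -1) (α : ℝ) {ψ : (Fin 2 → ℝ) → ℝ} (h : DiskH1 ψ) :
    DiskH1 (fun x => ψ (rot α σ x)) := by
  refine ⟨h.smooth.comp (rot α σ).contDiff.contDiffOn fun x hx => (rot_mem_unitDisk hσ α).2 hx,
    h.cont.comp (rot α σ).continuous.continuousOn fun x hx => (rot_mem_closure hσ α).2 hx,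
    (integrableOn_comp_rot hσ α h.finite).congr_fun (fun x hx => ?_) measurableSet_unitDisk⟩
  have d := h.smooth.differentiableAt_unitDisk ((rot_mem_unitDisk hσ α).2 hx)
  exact (gradDotS_comp_rot hσ α d d).symm

lemma DiskH10.comp_rot (hσ : σ = 1 ∨ σ = -1) (α : ℝ) {ψ : (Fin 2 → ℝ) → ℝ} (h : DiskH10 ψ) :
    DiskH10 (fun x => ψ (rot α σ x)) :=
  ⟨h.toDiskH1.comp_rot hσ α, fun x hx => h.bdry _ (by rw [rot_normSq hσ, hx])⟩

lemma formB_comp_rot (hσ : σ = 1 ∨ σ = -1) (α : ℝ) {V φ ψ : (Fin 2 → ℝ) → ℝ}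
    (hV : ∀ x ∈ unitDisk, V (rot α σ x) = V x) (hφ : DiskH1 φ) (hψ : DiskH1 ψ) :
    formB V (fun x => φ (rot α σ x)) (fun x => ψ (rot α σ x)) = formB V φ ψ := by
  rw [formB, formB, ← setIntegral_comp_rot hσ α fun x => gradDotS φ ψ x - V x * φ x * ψ x]
  refine setIntegral_congr_fun measurableSet_unitDisk fun x hx => ?_
  have hx' := (rot_mem_unitDisk hσ α).2 hx
  rw [gradDotS_comp_rot hσ α (hφ.smooth.differentiableAt_unitDisk hx')
    (hψ.smooth.differentiableAt_unitDisk hx'), hV x hx]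

end rot

/-! ### Boundary data and polar coordinates -/

lemma exists_pt (x : Fin 2 → ℝ) :
    ∃ φ, x = pt (Real.sqrt (x 0 ^ 2 + x 1 ^ 2)) φ := by
  refine ⟨Complex.arg ((x 0 : ℂ) + (x 1 : ℂ) * Complex.I), ?_⟩
  have hn : ‖(x 0 : ℂ) + (x 1 : ℂ) * Complex.I‖ = Real.sqrt (x 0 ^ 2 + x 1 ^ 2) :=
    Complex.norm_add_mul_I _ _
  have h1 := Complex.norm_mul_cos_arg ((x 0 : ℂ) + (x 1 : ℂ) * Complex.I)
  have h2 := Complex.norm_mul_sin_arg ((x 0 : ℂ) + (x 1 : ℂ) * Complex.I)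
  rw [hn] at h1 h2
  ext i
  fin_cases i
  · simpa using h1.symm
  · simpa using h2.symm

lemma pt_normSq (r φ : ℝ) : pt r φ 0 ^ 2 + pt r φ 1 ^ 2 = r ^ 2 := by
  rw [pt_zero, pt_one]
  linear_combination r ^ 2 * Real.sin_sq_add_cos_sq φ

lemma ubdDeg_pt (k : ℤ) (φ : ℝ) :
    ubdDeg k (pt 1 φ) = ![Real.cos (k * φ), Real.sin (k * φ), 0] := by
  have h : (pt 1 φ 0 : ℂ) + (pt 1 φ 1 : ℂ) * Complex.I = Complex.exp (φ * Complex.I) := by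
    rw [Complex.exp_mul_I]; simp
  rw [ubdDeg, h, Complex.arg_exp_mul_I]
  obtain ⟨n, hn⟩ : ∃ n : ℤ, toIocMod Real.two_pi_pos (-Real.pi) φ = φ - n * (2 * Real.pi) :=
    ⟨toIocDiv Real.two_pi_pos (-Real.pi) φ, by rw [toIocMod]; simp⟩
  rw [hn, show (k:ℝ) * (φ - n * (2 * Real.pi)) = k * φ - (k * n : ℤ) * (2 * Real.pi) by
    push_cast; ring, Real.cos_sub_int_mul_two_pi, Real.sin_sub_int_mul_two_pi]

/-- The action of a planar rotation or reflection on maps, compatible with the boundary data of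
degree `k`. -/
def twistMap (k : ℤ) (α σ : ℝ) (u : (Fin 2 → ℝ) → Fin 3 → ℝ) (x : Fin 2 → ℝ) : Fin 3 → ℝ :=
  ![Real.cos (k * α) * u (rot α σ x) 0 + Real.sin (k * α) * u (rot α σ x) 1,
    -(σ * Real.sin (k * α)) * u (rot α σ x) 0 + σ * Real.cos (k * α) * u (rot α σ x) 1,
    u (rot α σ x) 2]

section twist

variable {k : ℤ} {σ ε : ℝ} {u : (Fin 2 → ℝ) → Fin 3 → ℝ}

lemma normSq_twist (hσ : σ = 1 ∨ σ = -1) (α : ℝ) (x : Fin 2 → ℝ) :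
    normSq (twistMap k α σ u x) = normSq (u (rot α σ x)) := by
  have hs := Real.sin_sq_add_cos_sq (k * α)
  have h2 := sq_eq_one_of_sign hσ
  simp only [normSq, Fin.sum_univ_three, twistMap, Matrix.cons_val]
  linear_combination (u (rot α σ x) 0 ^ 2 + u (rot α σ x) 1 ^ 2) * hs +
    (Real.sin (k * α) * u (rot α σ x) 0 - Real.cos (k * α) * u (rot α σ x) 1) ^ 2 * h2

lemma Admissible.twist (hσ : σ = 1 ∨ σ = -1) (α : ℝ) (hu : Admissible unitDisk (ubdDeg k) u) :
    Admissible unitDisk (ubdDeg k) (twistMap k α σ u) := by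
  have h := fun j => (hu.component j).comp_rot hσ α
  refine admissible_of_components (fun j => ?_) fun x hx => ?_
  · fin_cases j
    · exact (h 0).lincomb (h 1) _ _
    · exact (h 0).lincomb (h 1) _ _
    · exact h 2
  · obtain ⟨φ, hφ⟩ := exists_pt x
    rw [hx, Real.sqrt_one] at hφ
    have hx' : rot α σ x 0 ^ 2 + rot α σ x 1 ^ 2 = 1 := by rw [rot_normSq hσ, hx]
    have hs := Real.sin_sq_add_cos_sq (k * α)
    have h2 := sq_eq_one_of_sign hσ
    rw [twistMap, hu.bdry hx', hφ, rot_pt hσ, ubdDeg_pt, ubdDeg_pt,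
      show (k:ℝ) * (α + σ * φ) = k * α + σ * (k * φ) by ring, Real.cos_add, Real.sin_add]
    have hc : Real.cos (σ * (k * φ)) = Real.cos (k * φ) := by
      rcases hσ with rfl | rfl <;> simp
    have hsn : Real.sin (σ * (k * φ)) = σ * Real.sin (k * φ) := by
      rcases hσ with rfl | rfl <;> simp
    rw [hc, hsn]
    ext i
    fin_cases i
    · simp
      linear_combination Real.cos (k * φ) * hs
    · simp
      linear_combination σ ^ 2 * Real.sin (k * φ) * hs + Real.sin (k * φ) * h2
    · simp

lemma gradSq_twist (hσ : σ = 1 ∨ σ = -1) (α : ℝ) (hu : Admissible unitDisk (ubdDeg k) u)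
    {x : Fin 2 → ℝ} (hx : x ∈ unitDisk) :
    gradSq (twistMap k α σ u) x = gradSq u (rot α σ x) := by
  have hx' := (rot_mem_unitDisk hσ α).2 hx
  rw [gradSq_eq_sum ((hu.twist hσ α).differentiableAt hx),
    gradSq_eq_sum (hu.differentiableAt hx')]
  have hs := Real.sin_sq_add_cos_sq (k * α)
  have h2 := sq_eq_one_of_sign hσ
  have d := fun j => (hu.component j).smooth.differentiableAt_unitDisk hx'
  have d' := fun j => ((hu.component j).comp_rot hσ α).smooth.differentiableAt_unitDisk hx
  have e := fun j => gradDotS_comp_rot hσ α (d j) (d j)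
  rw [Fin.sum_univ_three, Fin.sum_univ_three]
  simp only [gradSqS, ← e]
  simp only [twistMap, Matrix.cons_val, gradDotS_eq, pd_add ((d' 0).const_mul _)
    ((d' 1).const_mul _), pd_const_mul (d' 0), pd_const_mul (d' 1)]
  generalize pd 0 (fun y => u (rot α σ y) 0) x = A
  generalize pd 1 (fun y => u (rot α σ y) 0) x = B
  generalize pd 0 (fun y => u (rot α σ y) 1) x = C
  generalize pd 1 (fun y => u (rot α σ y) 1) x = D
  linear_combination (A ^ 2 + B ^ 2 + C ^ 2 + D ^ 2) * hs +
    ((Real.sin (k * α) * A - Real.cos (k * α) * C) ^ 2 +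
      (Real.sin (k * α) * B - Real.cos (k * α) * D) ^ 2) * h2

lemma IsMinimiser.twist {W : ℝ → ℝ} (hσ : σ = 1 ∨ σ = -1) (α : ℝ)
    (hu : IsMinimiser W ε unitDisk (ubdDeg k) u) :
    IsMinimiser W ε unitDisk (ubdDeg k) (twistMap k α σ u) := by
  refine ⟨hu.1.twist hσ α, fun v hv => (le_of_eq ?_).trans (hu.2 v hv)⟩
  rw [GLenergy, GLenergy, ← setIntegral_comp_rot hσ α
    fun x => gradSq u x / 2 + W (1 - normSq (u x)) / (2 * ε ^ 2)]
  refine setIntegral_congr_fun measurableSet_unitDisk fun x hx => ?_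
  simp only [gradSq_twist hσ α hu.1 hx, normSq_twist hσ]

end twist

/-! ### Derivatives in polar coordinates -/

section polar

variable {ψ : (Fin 2 → ℝ) → ℝ} {r φ : ℝ}

lemma fderiv_apply_vec (ψ : (Fin 2 → ℝ) → ℝ) (x : Fin 2 → ℝ) (a b : ℝ) :
    fderiv ℝ ψ x ![a, b] = a * pd 0 ψ x + b * pd 1 ψ x := by
  have e : (![a, b] : Fin 2 → ℝ) = a • Pi.single 0 (1:ℝ) + b • Pi.single 1 (1:ℝ) := by
    ext i; fin_cases i <;> simp
  rw [e, map_add, map_smul, map_smul]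
  rfl

lemma hasDerivAt_pt_angle (h : DifferentiableAt ℝ ψ (pt r φ)) :
    HasDerivAt (fun t => ψ (pt r t))
      (-(r * Real.sin φ) * pd 0 ψ (pt r φ) + r * Real.cos φ * pd 1 ψ (pt r φ)) φ := by
  have h1 : HasDerivAt (fun t => pt r t) ![-(r * Real.sin φ), r * Real.cos φ] φ := by
    refine hasDerivAt_pi.2 fun i => ?_
    fin_cases i
    · simpa using (Real.hasDerivAt_cos φ).const_mul r
    · simpa using (Real.hasDerivAt_sin φ).const_mul r
  have := h.hasFDerivAt.comp_hasDerivAt φ h1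
  rwa [fderiv_apply_vec] at this

lemma hasDerivAt_pt_radius (h : DifferentiableAt ℝ ψ (pt r φ)) :
    HasDerivAt (fun t => ψ (pt t φ))
      (Real.cos φ * pd 0 ψ (pt r φ) + Real.sin φ * pd 1 ψ (pt r φ)) r := by
  have h1 : HasDerivAt (fun t => pt t φ) ![Real.cos φ, Real.sin φ] r := by
    refine hasDerivAt_pi.2 fun i => ?_
    fin_cases i
    · simpa using (hasDerivAt_id r).mul_const (Real.cos φ)
    · simpa using (hasDerivAt_id r).mul_const (Real.sin φ)
  have := h.hasFDerivAt.comp_hasDerivAt r h1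
  rwa [fderiv_apply_vec] at this

lemma pt_mem_unitDisk (h0 : 0 ≤ r) (h1 : r < 1) (φ : ℝ) : pt r φ ∈ unitDisk := by
  simp only [unitDisk, mem_ofPred_eq, pt_normSq]
  nlinarith

lemma pt_mem_closure (h0 : 0 ≤ r) (h1 : r ≤ 1) (φ : ℝ) : pt r φ ∈ closure unitDisk := by
  simp only [closure_unitDisk, mem_ofPred_eq, pt_normSq]
  nlinarith

end polar

/-- Null directions of a nonnegative rotation invariant form are radial. -/
theorem radial_of_formB_eq_zero {V ψ : (Fin 2 → ℝ) → ℝ} (hV : ContinuousOn V (closure unitDisk))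
    (hpos : ∀ ψ, DiskH10 ψ → 0 ≤ formB V ψ ψ)
    (hrot : ∀ α, ∀ x ∈ unitDisk, V (rot α 1 x) = V x) (hψ : DiskH10 ψ) (hq : formB V ψ ψ = 0)
    {r : ℝ} (h0 : 0 ≤ r) (h1 : r < 1) (φ φ' : ℝ) : ψ (pt r φ) = ψ (pt r φ') := by
  set P : ℝ → ℝ := fun t => ψ (pt r t) with hP
  have hd : ∀ t, HasDerivAt P
      (-(r * Real.sin t) * pd 0 ψ (pt r t) + r * Real.cos t * pd 1 ψ (pt r t)) t := fun t =>
    hasDerivAt_pt_angle (hψ.smooth.differentiableAt_unitDisk (pt_mem_unitDisk h0 h1 t))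
  have hw : ∀ α t, P t * deriv P (t + α) = P (t + α) * deriv P t := by
    intro α t
    have hα := hψ.comp_rot (Or.inl rfl) α (σ := 1)
    have hx := pt_mem_unitDisk h0 h1 t
    have h := wronskian_eq_zero hV hpos hψ hα hq
      (by rw [formB_comp_rot (Or.inl rfl) α (hrot α) hψ.toDiskH1 hψ.toDiskH1, hq]) _ hx
    have e : (fun s => ψ (rot α 1 (pt r s))) = fun s => P (s + α) := by
      ext s
      rw [rot_pt (Or.inl rfl), one_mul, add_comm]
    have d2 := hasDerivAt_pt_angle (hα.smooth.differentiableAt_unitDisk hx)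
    rw [e] at d2
    have d3 : deriv P (t + α) = _ := (d2.deriv.symm.trans (deriv_comp_add_const P α t)).symm
    have ev : ψ (rot α 1 (pt r t)) = P (t + α) := congrFun e t
    rw [d3, (hd t).deriv]
    have ha := h 0
    have hb := h 1
    rw [ev] at ha hb
    simp only [hP] at ha hb ⊢
    linear_combination -(r * Real.sin t) * ha + r * Real.cos t * hb
  have hcont : Continuous P := continuous_iff_continuousAt.2 fun t => (hd t).continuousAt
  have hper : Function.Periodic P (2 * Real.pi) := fun t => by
    simp only [hP, pt, Real.cos_add_two_pi, Real.sin_add_two_pi]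
  obtain ⟨t0, -, ht0⟩ := isCompact_Icc.exists_isMaxOn (s := Icc 0 (2 * Real.pi))
    ⟨0, by simp [Real.pi_pos.le]⟩ (hcont.pow 2).continuousOn
  have hmax : ∀ t, P t ^ 2 ≤ P t0 ^ 2 := fun t => by
    obtain ⟨s, hs, hs'⟩ := hper.exists_mem_Ico₀ Real.two_pi_pos t
    rw [hs']
    exact ht0 (Ico_subset_Icc_self hs)
  by_cases hz : P t0 = 0
  · have : ∀ t, P t = 0 := fun t => by
      have := hmax t
      rw [hz] at this
      nlinarith [sq_nonneg (P t)]
    exact (this φ).trans (this φ').symm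
  · have hdiff : Differentiable ℝ P := fun t => (hd t).differentiableAt
    have h2 : deriv P t0 = 0 := by
      have hloc : IsLocalMax (fun t => P t ^ 2) t0 := Filter.Eventually.of_forall hmax
      have := hloc.hasDerivAt_eq_zero ((hdiff t0).hasDerivAt.pow 2)
      simpa [hz] using this
    refine is_const_of_deriv_eq_zero hdiff (fun t => ?_) φ φ'
    have := hw (t - t0) t0
    rw [h2, mul_zero, add_sub_cancel] at this
    exact (mul_eq_zero.1 this).resolve_left hz

section structureOfMinimisers

variable {W : ℝ → ℝ} {ε : ℝ} {k : ℤ} {u : (Fin 2 → ℝ) → Fin 3 → ℝ}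

lemma IsMinimiser.normSq_rot (hε : 0 < ε) (hW : ContDiffOn ℝ 1 W (Iic (1:ℝ)))
    (hc : StrictConvexOn ℝ (Iic (1:ℝ)) W) (hu : IsMinimiser W ε unitDisk (ubdDeg k) u)
    (α : ℝ) {x : Fin 2 → ℝ} (hx : x ∈ unitDisk) :
    normSq (u (rot α 1 x)) = normSq (u x) := by
  rw [← normSq_twist (k := k) (Or.inl rfl) α x]
  exact (hu.sub_eq_zero hε hW hc (fun x hx => by rw [hu.1.bdry hx]; rfl)
    (hu.twist (Or.inl rfl) α)).1 x hx

lemma IsMinimiser.radial_null (hε : 0 < ε) (hW : ContDiffOn ℝ 1 W (Iic (1:ℝ)))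
    (hc : StrictConvexOn ℝ (Iic (1:ℝ)) W) (hu : IsMinimiser W ε unitDisk (ubdDeg k) u)
    {ψ : (Fin 2 → ℝ) → ℝ} (hψ : DiskH10 ψ) (hq : formB (potV W ε u) ψ ψ = 0)
    {r : ℝ} (h0 : 0 ≤ r) (h1 : r < 1) (φ φ' : ℝ) : ψ (pt r φ) = ψ (pt r φ') :=
  radial_of_formB_eq_zero (continuousOn_potV hW hu.1)
    (fun _ h => hu.form_nonneg hW hc (fun x hx => by rw [hu.1.bdry hx]; rfl) h)
    (fun α x hx => by rw [potV, potV, hu.normSq_rot hε hW hc α hx]) hψ hq h0 h1 φ φ'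

lemma IsMinimiser.third_diskH10 (hu : IsMinimiser W ε unitDisk (ubdDeg k) u) :
    DiskH10 (fun x => u x 2) :=
  ⟨hu.1.component 2, fun x hx => by rw [hu.1.bdry hx]; rfl⟩

lemma IsMinimiser.third_radial (hε : 0 < ε) (hW : ContDiffOn ℝ 1 W (Iic (1:ℝ)))
    (hc : StrictConvexOn ℝ (Iic (1:ℝ)) W) (hu : IsMinimiser W ε unitDisk (ubdDeg k) u)
    {r : ℝ} (h0 : 0 ≤ r) (h1 : r < 1) (φ φ' : ℝ) : u (pt r φ) 2 = u (pt r φ') 2 :=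
  hu.radial_null hε hW hc hu.third_diskH10 (hu.formB_eq_zero hW hc 2 hu.third_diskH10)
    h0 h1 φ φ'

lemma IsMinimiser.twist_sub_radial (hε : 0 < ε) (hW : ContDiffOn ℝ 1 W (Iic (1:ℝ)))
    (hc : StrictConvexOn ℝ (Iic (1:ℝ)) W) (hu : IsMinimiser W ε unitDisk (ubdDeg k) u)
    {σ : ℝ} (hσ : σ = 1 ∨ σ = -1) (α : ℝ) (j : Fin 3)
    {r : ℝ} (h0 : 0 ≤ r) (h1 : r < 1) (φ φ' : ℝ) :
    twistMap k α σ u (pt r φ) j - u (pt r φ) j = twistMap k α σ u (pt r φ') j - u (pt r φ') j := by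
  have h := hu.sub_eq_zero hε hW hc (fun x hx => by rw [hu.1.bdry hx]; rfl) (hu.twist hσ α)
  exact hu.radial_null hε hW hc (h.2.1 j) (h.2.2 j) h0 h1 φ φ'

/-- On each circle a minimiser is an equivariant field plus a constant, one of which vanishes. -/
theorem IsMinimiser.structure (hε : 0 < ε) (hW : ContDiffOn ℝ 1 W (Iic (1:ℝ)))
    (hc : StrictConvexOn ℝ (Iic (1:ℝ)) W) (hk : k ≠ 0)
    (hu : IsMinimiser W ε unitDisk (ubdDeg k) u) :
    ∃ a b : (Fin 2 → ℝ) → ℝ, DiskH1 a ∧ DiskH1 b ∧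
      (∀ ψ, DiskH10 ψ → formB (potV W ε u) a ψ = 0) ∧
      (∀ ψ, DiskH10 ψ → formB (potV W ε u) b ψ = 0) ∧
      (∀ r, 0 ≤ r → r < 1 → ∀ φ, a (pt r φ) = a (pt r 0) * Real.cos (k * φ) ∧
        b (pt r φ) = a (pt r 0) * Real.sin (k * φ)) ∧
      (∀ r, 0 ≤ r → r < 1 → a (pt r 0) ≠ 0 →
        ∀ φ, u (pt r φ) 0 = a (pt r φ) ∧ u (pt r φ) 1 = b (pt r φ)) ∧
      a (pt 1 0) = 1 := by
  have hk' : (k:ℝ) ≠ 0 := by exact_mod_cast hk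
  set β : ℝ := Real.pi / k with hβ
  have hkβ : (k:ℝ) * β = Real.pi := by rw [hβ]; field_simp
  have hv := hu.twist (Or.inl rfl) β (σ := 1)
  set v := twistMap k β 1 u with hvdef
  have hvj : ∀ (r φ : ℝ), v (pt r φ) 0 = -u (pt r (φ + β)) 0 ∧
      v (pt r φ) 1 = -u (pt r (φ + β)) 1 := fun r φ => by
    simp [hvdef, twistMap, rot_pt, hkβ, add_comm]
  have hV := continuousOn_potV (ε := ε) hW hu.1
  have hform : ∀ j ψ, DiskH10 ψ →
      formB (potV W ε u) (fun x => (1/2) * u x j + (1/2) * v x j) ψ = 0 := fun j ψ hψ => by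
    rw [formB_lincomb_left hV (hu.1.component j) (hv.1.component j) hψ.toDiskH1,
      hu.formB_eq_zero hW hc j hψ]
    have e : formB (potV W ε u) (fun x => v x j) ψ = formB (potV W ε v) (fun x => v x j) ψ := by
      refine setIntegral_congr_fun measurableSet_unitDisk fun x hx => ?_
      simp only [potV]
      rw [hvdef, normSq_twist (Or.inl rfl), hu.normSq_rot hε hW hc β hx]
    rw [e, hv.formB_eq_zero hW hc j hψ]
    ring
  have hH : ∀ j, DiskH1 (fun x => (1/2) * u x j + (1/2) * v x j) := fun j =>
    (hu.1.component j).lincomb (hv.1.component j) _ _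
  have main : ∀ r, 0 ≤ r → r < 1 → ∃ f b1 b2 : ℝ, f * b1 = 0 ∧ f * b2 = 0 ∧
      ∀ φ, u (pt r φ) 0 = f * Real.cos (k * φ) + b1 ∧
        u (pt r φ) 1 = f * Real.sin (k * φ) + b2 := by
    intro r h0 h1
    set b1 := (u (pt r 0) 0 + u (pt r β) 0) / 2 with hb1
    set b2 := (u (pt r 0) 1 + u (pt r β) 1) / 2 with hb2
    have hs1 : ∀ φ, u (pt r (φ + β)) 0 = 2 * b1 - u (pt r φ) 0 := fun φ => by
      have := hu.twist_sub_radial hε hW hc (Or.inl rfl) β 0 h0 h1 φ 0 (σ := 1)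
      rw [← hvdef, (hvj r φ).1, (hvj r 0).1, zero_add] at this
      rw [hb1]; linarith
    have hs2 : ∀ φ, u (pt r (φ + β)) 1 = 2 * b2 - u (pt r φ) 1 := fun φ => by
      have := hu.twist_sub_radial hε hW hc (Or.inl rfl) β 1 h0 h1 φ 0 (σ := 1)
      rw [← hvdef, (hvj r φ).2, (hvj r 0).2, zero_add] at this
      rw [hb2]; linarith
    have hrot : ∀ α, Real.cos (k * α) * (u (pt r α) 0 - b1) + Real.sin (k * α) *
        (u (pt r α) 1 - b2) = u (pt r 0) 0 - b1 ∧
        -Real.sin (k * α) * (u (pt r α) 0 - b1) + Real.cos (k * α) *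
        (u (pt r α) 1 - b2) = u (pt r 0) 1 - b2 := fun α => by
      have e1 := hu.twist_sub_radial hε hW hc (Or.inl rfl) α 0 h0 h1 0 (0 + β) (σ := 1)
      have e2 := hu.twist_sub_radial hε hW hc (Or.inl rfl) α 1 h0 h1 0 (0 + β) (σ := 1)
      simp only [twistMap, Matrix.cons_val, rot_pt (Or.inl rfl), one_mul] at e1 e2
      rw [← add_assoc, hs1, hs2, hs1, add_zero] at e1
      rw [← add_assoc, hs1, hs2, hs2, add_zero] at e2
      constructor <;> linarith
    have hU : ∀ α, u (pt r α) 0 - b1 = Real.cos (k * α) * (u (pt r 0) 0 - b1) -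
        Real.sin (k * α) * (u (pt r 0) 1 - b2) ∧
        u (pt r α) 1 - b2 = Real.sin (k * α) * (u (pt r 0) 0 - b1) +
        Real.cos (k * α) * (u (pt r 0) 1 - b2) := fun α => by
      obtain ⟨e1, e2⟩ := hrot α
      have hs := Real.sin_sq_add_cos_sq (k * α)
      constructor
      · linear_combination Real.cos (k * α) * e1 - Real.sin (k * α) * e2 -
          (u (pt r α) 0 - b1) * hs
      · linear_combination Real.sin (k * α) * e1 + Real.cos (k * α) * e2 -
          (u (pt r α) 1 - b2) * hs
    have ha2 : u (pt r 0) 1 - b2 = 0 := by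
      have e := hu.twist_sub_radial hε hW hc (Or.inr rfl) 0 1 h0 h1 0 β (σ := -1)
      simp only [twistMap, Matrix.cons_val, rot_pt (Or.inr rfl)] at e
      simp only [mul_zero, Real.sin_zero, Real.cos_zero, zero_add] at e
      have e1 := (hU (-1 * β)).2
      have e2 := (hU β).2
      rw [show (k:ℝ) * (-1 * β) = -Real.pi by linarith, Real.sin_neg, Real.cos_neg] at e1
      rw [hkβ] at e2
      simp only [Real.sin_pi, Real.cos_pi] at e1 e2
      linarith
    refine ⟨u (pt r 0) 0 - b1, b1, b2, ?_, ?_, fun φ => ?_⟩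
    rotate_left 2
    · obtain ⟨e1, e2⟩ := hU φ
      rw [ha2] at e1 e2
      constructor <;> linarith
    all_goals
      have hn : ∀ α, normSq (u (pt r α)) = normSq (u (pt r 0)) := fun α => by
        have := hu.normSq_rot hε hW hc α (pt_mem_unitDisk h0 h1 0)
        rwa [rot_pt (Or.inl rfl), mul_zero, add_zero] at this
      have hn' : ∀ α, u (pt r α) 0 ^ 2 + u (pt r α) 1 ^ 2 =
          u (pt r 0) 0 ^ 2 + u (pt r 0) 1 ^ 2 := fun α => by
        have := hn α
        simp only [normSq, Fin.sum_univ_three] at this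
        rw [hu.third_radial hε hW hc h0 h1 α 0] at this
        linarith
    · have e := hn' β
      obtain ⟨e1, e2⟩ := hU β
      rw [ha2, hkβ] at e1 e2
      simp only [Real.sin_pi, Real.cos_pi] at e1 e2
      rw [show u (pt r β) 0 = 2 * b1 - u (pt r 0) 0 by linarith,
        show u (pt r β) 1 = b2 by linarith, show u (pt r 0) 1 = b2 by linarith] at e
      linarith
    · have e := hn' (β / 2)
      have e' := hn' (-(β / 2))
      obtain ⟨e1, e2⟩ := hU (β / 2)
      obtain ⟨e3, e4⟩ := hU (-(β / 2))
      rw [ha2, show (k:ℝ) * (β / 2) = Real.pi / 2 by linarith] at e1 e2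
      rw [ha2, show (k:ℝ) * (-(β / 2)) = -(Real.pi / 2) by linarith] at e3 e4
      simp only [Real.sin_pi_div_two, Real.cos_pi_div_two, Real.sin_neg, Real.cos_neg]
        at e1 e2 e3 e4
      rw [show u (pt r (β / 2)) 0 = b1 by linarith,
        show u (pt r (β / 2)) 1 = b2 + (u (pt r 0) 0 - b1) by linarith] at e
      rw [show u (pt r (-(β / 2))) 0 = b1 by linarith,
        show u (pt r (-(β / 2))) 1 = b2 - (u (pt r 0) 0 - b1) by linarith] at e'
      linarith
  have hshift : ∀ φ : ℝ, (k:ℝ) * (φ + β) = k * φ + Real.pi := fun φ => by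
    rw [mul_add, hkβ]
  refine ⟨_, _, hH 0, hH 1, hform 0, hform 1, fun r h0 h1 φ => ?_, fun r h0 h1 => ?_, ?_⟩
  · obtain ⟨f, b1, b2, -, -, h⟩ := main r h0 h1
    simp only [(hvj _ _).1, (hvj _ _).2, (h _).1, (h _).2, hshift, Real.cos_add_pi,
      Real.sin_add_pi, mul_zero, Real.cos_zero]
    constructor <;> ring
  · obtain ⟨f, b1, b2, hf1, hf2, h⟩ := main r h0 h1
    simp only [(hvj _ _).1, (hvj _ _).2, (h _).1, (h _).2, hshift, Real.cos_add_pi,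
      Real.sin_add_pi, mul_zero, Real.cos_zero]
    intro hne φ
    have hf : f ≠ 0 := fun h => hne (by rw [h]; ring)
    have hb1 : b1 = 0 := (mul_eq_zero.1 hf1).resolve_left hf
    have hb2 : b2 = 0 := (mul_eq_zero.1 hf2).resolve_left hf
    rw [hb1, hb2]
    constructor <;> ring
  · have hx : pt 1 0 0 ^ 2 + pt 1 0 1 ^ 2 = 1 := by rw [pt_normSq]; norm_num
    rw [hu.1.bdry hx, hv.1.bdry hx, ubdDeg_pt]
    simp
    norm_num

end structureOfMinimisers

/-! ### Integrals of radial functions -/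

/-- The Euclidean norm on the plane. -/
def rad (x : Fin 2 → ℝ) : ℝ := Real.sqrt (x 0 ^ 2 + x 1 ^ 2)

lemma rad_pt {r : ℝ} (hr : 0 ≤ r) (φ : ℝ) : rad (pt r φ) = r := by
  rw [rad, pt_normSq, Real.sqrt_sq hr]

lemma mem_unitDisk_iff {x : Fin 2 → ℝ} : x ∈ unitDisk ↔ rad x < 1 := by
  rw [rad, Real.sqrt_lt' one_pos, one_pow]
  rfl

lemma rad_eq_norm (x : Fin 2 → ℝ) : rad x = ‖(WithLp.toLp 2 x : EuclideanSpace ℝ (Fin 2))‖ := by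
  rw [EuclideanSpace.norm_eq, Fin.sum_univ_two]
  simp [rad]

lemma preimage_ball_toLp : (WithLp.toLp 2 : (Fin 2 → ℝ) → EuclideanSpace ℝ (Fin 2)) ⁻¹'
    Metric.ball 0 1 = unitDisk := by
  ext x
  rw [mem_preimage, mem_ball_zero_iff, ← rad_eq_norm, mem_unitDisk_iff]

lemma measurableEmbedding_toLp :
    MeasurableEmbedding (WithLp.toLp 2 : (Fin 2 → ℝ) → EuclideanSpace ℝ (Fin 2)) :=
  (MeasurableEquiv.toLp 2 (Fin 2 → ℝ)).measurableEmbedding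

/-- The area of the unit disk, times two. -/
def radConst : ℝ :=
  2 * (volume : Measure (EuclideanSpace ℝ (Fin 2))).real (Metric.ball 0 1)

lemma radConst_pos : 0 < radConst :=
  mul_pos two_pos (ENNReal.toReal_pos (Metric.measure_ball_pos _ _ one_pos).ne'
    measure_ball_lt_top.ne)

lemma setIntegral_radial (F : ℝ → ℝ) :
    ∫ x in unitDisk, F (rad x) = radConst * ∫ r in Ioo (0:ℝ) 1, r * F r := by
  have h1 := (PiLp.volume_preserving_toLp (Fin 2)).setIntegral_preimage_emb
    measurableEmbedding_toLp (fun y => F ‖y‖) (Metric.ball 0 1)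
  rw [preimage_ball_toLp] at h1
  simp only [← rad_eq_norm] at h1
  rw [h1, ← integral_indicator measurableSet_ball]
  have h2 := integral_fun_norm_addHaar (volume : Measure (EuclideanSpace ℝ (Fin 2)))
    (indicator (Iio 1) F)
  have e : (fun x : EuclideanSpace ℝ (Fin 2) => indicator (Iio 1) F ‖x‖) =
      indicator (Metric.ball 0 1) fun y => F ‖y‖ := by
    ext x
    by_cases hx : ‖x‖ < 1 <;> simp [indicator, hx]
  rw [e] at h2
  rw [h2, finrank_euclideanSpace_fin, radConst, nsmul_eq_mul, smul_eq_mul]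
  have h3 : ∫ y in Ioi (0:ℝ), y ^ (2 - 1) • indicator (Iio 1) F y =
      ∫ r in Ioo (0:ℝ) 1, r * F r := by
    rw [← Ioi_inter_Iio, ← setIntegral_indicator measurableSet_Iio]
    · refine setIntegral_congr_fun measurableSet_Ioi fun y _ => ?_
      by_cases hy : y < 1 <;> simp [indicator, hy]
  rw [h3]
  push_cast
  ring

lemma integrableOn_radial_iff {F : ℝ → ℝ} :
    IntegrableOn (fun x => F (rad x)) unitDisk ↔
      IntegrableOn (fun r => r * F r) (Ioo (0:ℝ) 1) := by
  have h1 := (PiLp.volume_preserving_toLp (Fin 2)).integrableOn_comp_preimage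
    measurableEmbedding_toLp (f := fun y => F ‖y‖) (s := Metric.ball 0 1)
  rw [preimage_ball_toLp] at h1
  have h2 := integrableOn_fun_norm_addHaar (volume : Measure (EuclideanSpace ℝ (Fin 2)))
    (f := F) (r := 1)
  rw [finrank_euclideanSpace_fin] at h2
  have e : (fun x => F (rad x)) =
      (fun y : EuclideanSpace ℝ (Fin 2) => F ‖y‖) ∘ WithLp.toLp 2 := by
    ext x
    simp [rad_eq_norm]
  rw [e, h1, h2]
  simp

lemma ae_unitDisk_of_pt {P : (Fin 2 → ℝ) → Prop}
    (h : ∀ r, 0 < r → r < 1 → ∀ φ, P (pt r φ)) :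
    ∀ᵐ x ∂(volume.restrict unitDisk), P x := by
  have h0 : ∀ᵐ x : Fin 2 → ℝ ∂volume, x ≠ 0 := by
    rw [ae_iff]
    simp
  rw [ae_restrict_iff' measurableSet_unitDisk]
  filter_upwards [h0] with x hx hxd
  obtain ⟨φ, hφ⟩ := exists_pt x
  rw [hφ]
  refine h _ (lt_of_le_of_ne (Real.sqrt_nonneg _) fun h => hx ?_) (mem_unitDisk_iff.1 hxd) φ
  rw [hφ, ← h]
  ext i
  fin_cases i <;> simp

lemma setIntegral_of_radial {G : (Fin 2 → ℝ) → ℝ} {F : ℝ → ℝ}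
    (h : ∀ r, 0 < r → r < 1 → ∀ φ, G (pt r φ) = F r) :
    ∫ x in unitDisk, G x = radConst * ∫ r in Ioo (0:ℝ) 1, r * F r := by
  rw [← setIntegral_radial]
  refine integral_congr_ae (ae_unitDisk_of_pt fun r h0 h1 φ => ?_)
  show G (pt r φ) = F (rad (pt r φ))
  rw [h r h0 h1, rad_pt h0.le]

lemma integrableOn_of_radial {G : (Fin 2 → ℝ) → ℝ} {F : ℝ → ℝ}
    (h : ∀ r, 0 < r → r < 1 → ∀ φ, G (pt r φ) = F r) (hG : IntegrableOn G unitDisk) :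
    IntegrableOn (fun r => r * F r) (Ioo (0:ℝ) 1) := by
  rw [← integrableOn_radial_iff]
  refine hG.congr (ae_unitDisk_of_pt fun r h0 h1 φ => ?_)
  show G (pt r φ) = F (rad (pt r φ))
  rw [h r h0 h1, rad_pt h0.le]

lemma gradDotS_pt {F G : (Fin 2 → ℝ) → ℝ} {r φ F₁ F₂ G₁ G₂ : ℝ} (hr : 0 < r)
    (hF : DifferentiableAt ℝ F (pt r φ)) (hG : DifferentiableAt ℝ G (pt r φ))
    (hF₁ : HasDerivAt (fun t => F (pt t φ)) F₁ r) (hF₂ : HasDerivAt (fun t => F (pt r t)) F₂ φ)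
    (hG₁ : HasDerivAt (fun t => G (pt t φ)) G₁ r) (hG₂ : HasDerivAt (fun t => G (pt r t)) G₂ φ) :
    gradDotS F G (pt r φ) = F₁ * G₁ + F₂ * G₂ / r ^ 2 := by
  rw [hF₁.unique (hasDerivAt_pt_radius hF), hF₂.unique (hasDerivAt_pt_angle hF),
    hG₁.unique (hasDerivAt_pt_radius hG), hG₂.unique (hasDerivAt_pt_angle hG), gradDotS_eq]
  have hs := Real.sin_sq_add_cos_sq φ
  field_simp
  linear_combination -(pd 0 F (pt r φ) * pd 0 G (pt r φ) +
    pd 1 F (pt r φ) * pd 1 G (pt r φ)) * hs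

/-! ### Radial test functions -/

/-- Test functions: `C¹` functions with compact support in `(0, 1)`. -/
structure IsTest (η : ℝ → ℝ) : Prop where
  smooth : ContDiff ℝ 1 η
  supp : ∃ a b, 0 < a ∧ b < 1 ∧ ∀ r, r ∉ Icc a b → η r = 0

lemma DiskH10.of_contDiff {ψ : (Fin 2 → ℝ) → ℝ} (h : ContDiff ℝ 1 ψ)
    (hb : ∀ x : Fin 2 → ℝ, x 0 ^ 2 + x 1 ^ 2 = 1 → ψ x = 0) : DiskH10 ψ := by
  refine ⟨⟨h.contDiffOn, h.continuous.continuousOn, ?_⟩, hb⟩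
  refine integrableOn_unitDisk_of_continuousOn ?_
  have hc : ∀ i, Continuous (pd i ψ) := fun i =>
    (h.continuous_fderiv one_ne_zero).clm_apply continuous_const
  rw [show gradSqS ψ = fun x => pd 0 ψ x ^ 2 + pd 1 ψ x ^ 2 from funext (gradSqS_eq ψ)]
  exact (((hc 0).pow 2).add ((hc 1).pow 2)).continuousOn

lemma contDiff_mul_radial {η : ℝ → ℝ} (hη : IsTest η) {p : (Fin 2 → ℝ) → ℝ}
    (hp : ContDiff ℝ 1 p) (m : ℕ) : ContDiff ℝ 1 (fun x => η (rad x) * (p x / rad x ^ m)) := by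
  rw [contDiff_iff_contDiffAt]
  intro x
  have hcr : Continuous rad := by unfold rad; fun_prop
  by_cases hx : rad x = 0
  · obtain ⟨a, b, ha, -, hab⟩ := hη.supp
    have : (fun x => η (rad x) * (p x / rad x ^ m)) =ᶠ[nhds x] fun _ => 0 := by
      have : ∀ᶠ y in nhds x, rad y < a := hcr.continuousAt.eventually_lt continuousAt_const
        (by rw [hx]; exact ha)
      filter_upwards [this] with y hy
      rw [hab _ (fun h => absurd h.1 (not_le.2 hy)), zero_mul]
    exact contDiffAt_const.congr_of_eventuallyEq this
  · have hr : ContDiffAt ℝ 1 rad x := by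
      refine ContDiffAt.sqrt (by fun_prop) fun h => hx ?_
      rw [rad, h, Real.sqrt_zero]
    exact (hη.smooth.contDiffAt.comp x hr).mul (hp.contDiffAt.div (hr.pow m) (pow_ne_zero _ hx))

lemma exists_test_fields (k : ℤ) {η : ℝ → ℝ} (hη : IsTest η) :
    ∃ p q : (Fin 2 → ℝ) → ℝ, DiskH10 p ∧ DiskH10 q ∧ ∀ r, 0 < r → ∀ φ,
      p (pt r φ) = η r * Real.cos (k * φ) ∧ q (pt r φ) = η r * Real.sin (k * φ) := by
  obtain ⟨σ, hσ, m, hk⟩ : ∃ σ : ℝ, (σ = 1 ∨ σ = -1) ∧ ∃ m : ℕ, (k:ℝ) = σ * m := by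
    rcases Int.natAbs_eq k with h | h
    · exact ⟨1, Or.inl rfl, k.natAbs, by
        rw [one_mul, ← Int.cast_natCast]; exact congrArg _ h⟩
    · exact ⟨-1, Or.inr rfl, k.natAbs, by rw [neg_one_mul]; exact_mod_cast h⟩
  set z : (Fin 2 → ℝ) → ℂ := fun x => (x 0 : ℂ) + (x 1 : ℂ) * Complex.I with hz
  have hzs : ContDiff ℝ 1 z := by
    refine ContDiff.add ?_ (ContDiff.mul ?_ contDiff_const)
    · exact Complex.ofRealCLM.contDiff.comp (contDiff_apply ℝ ℝ 0)
    · exact Complex.ofRealCLM.contDiff.comp (contDiff_apply ℝ ℝ 1)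
  have hre : ContDiff ℝ 1 (fun x => (z x ^ m).re) :=
    Complex.reCLM.contDiff.comp (hzs.pow m)
  have him : ContDiff ℝ 1 (fun x => σ * (z x ^ m).im) :=
    contDiff_const.mul (Complex.imCLM.contDiff.comp (hzs.pow m))
  have hη1 : ∀ x : Fin 2 → ℝ, x 0 ^ 2 + x 1 ^ 2 = 1 → η (rad x) = 0 := fun x hx => by
    obtain ⟨a, b, -, hb, hab⟩ := hη.supp
    refine hab _ fun h => ?_
    rw [rad, hx, Real.sqrt_one] at h
    linarith [h.2]
  refine ⟨_, _, DiskH10.of_contDiff (contDiff_mul_radial hη hre m) fun x hx => by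
    simp [hη1 x hx], DiskH10.of_contDiff (contDiff_mul_radial hη him m) fun x hx => by
    simp [hη1 x hx], fun r hr φ => ?_⟩
  have hzp : z (pt r φ) ^ m = ((r ^ m * Real.cos (m * φ) : ℝ) : ℂ) +
      ((r ^ m * Real.sin (m * φ) : ℝ) : ℂ) * Complex.I := by
    have : z (pt r φ) = r * Complex.exp (φ * Complex.I) := by
      rw [Complex.exp_mul_I, hz]
      simp
      ring
    rw [this, mul_pow, ← Complex.exp_nat_mul, ← mul_assoc, Complex.exp_mul_I]
    push_cast
    ring
  have hrm : r ^ m ≠ 0 := (pow_pos hr m).ne'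
  rw [rad_pt hr.le, hzp, hk]
  have hc : Real.cos (σ * m * φ) = Real.cos (m * φ) := by
    rcases hσ with rfl | rfl <;> simp
  have hs : Real.sin (σ * m * φ) = σ * Real.sin (m * φ) := by
    rcases hσ with rfl | rfl <;> simp
  rw [hc, hs]
  constructor
  · simp only [Complex.add_re, Complex.ofReal_re, Complex.mul_re, Complex.I_re, mul_zero,
      Complex.ofReal_im, Complex.I_im, zero_mul, sub_zero, add_zero]
    field_simp
  · simp only [Complex.add_im, Complex.ofReal_im, Complex.mul_im, Complex.I_im, mul_one,
      Complex.ofReal_re, Complex.I_re, mul_zero, zero_add, add_zero]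
    field_simp

/-- Radial profiles `y` of weak solutions of `-Δu = v u` of the form `y(r) e^{iκφ}`. -/
structure IsProfile (κ : ℝ) (v y : ℝ → ℝ) : Prop where
  cont : ContinuousOn y (Icc 0 1)
  smooth : ContDiffOn ℝ 1 y (Ioo 0 1)
  energy : IntegrableOn (fun r => r * (deriv y r ^ 2 + κ ^ 2 * y r ^ 2 / r ^ 2)) (Ioo (0:ℝ) 1)
  weak : ∀ η, IsTest η → ∫ r in Ioo (0:ℝ) 1,
    r * (deriv y r * deriv η r + κ ^ 2 * (y r * η r) / r ^ 2 - v r * y r * η r) = 0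

lemma contDiff_pt_radius (φ : ℝ) : ContDiff ℝ 1 (fun r => pt r φ) := by
  refine contDiff_pi.2 fun i => ?_
  fin_cases i
  · exact contDiff_id.mul contDiff_const
  · exact contDiff_id.mul contDiff_const

/-- Derivatives of a field `y(r) cos (κφ)`, `y(r) sin (κφ)` in polar coordinates. -/
lemma hasDerivAt_of_equivariant {a b : (Fin 2 → ℝ) → ℝ} {κ : ℝ} {y : ℝ → ℝ} {r : ℝ} (hr : 0 < r)
    (hr1 : r < 1) (hy : DifferentiableAt ℝ y r)
    (h : ∀ r, 0 < r → r < 1 → ∀ φ, a (pt r φ) = y r * Real.cos (κ * φ) ∧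
      b (pt r φ) = y r * Real.sin (κ * φ)) (φ : ℝ) :
    HasDerivAt (fun t => a (pt t φ)) (deriv y r * Real.cos (κ * φ)) r ∧
    HasDerivAt (fun t => b (pt t φ)) (deriv y r * Real.sin (κ * φ)) r ∧
    HasDerivAt (fun t => a (pt r t)) (-(y r * κ * Real.sin (κ * φ))) φ ∧
    HasDerivAt (fun t => b (pt r t)) (y r * κ * Real.cos (κ * φ)) φ := by
  have hev : ∀ᶠ t in nhds r, t ∈ Ioo (0:ℝ) 1 := Ioo_mem_nhds hr hr1
  have hlin : HasDerivAt (fun t : ℝ => κ * t) κ φ := by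
    simpa using (hasDerivAt_id φ).const_mul κ
  refine ⟨(hy.hasDerivAt.mul_const _).congr_of_eventuallyEq ?_,
    (hy.hasDerivAt.mul_const _).congr_of_eventuallyEq ?_, ?_, ?_⟩
  · filter_upwards [hev] with t ht using (h t ht.1 ht.2 φ).1
  · filter_upwards [hev] with t ht using (h t ht.1 ht.2 φ).2
  · rw [show (fun t => a (pt r t)) = fun t => y r * Real.cos (κ * t) from
      funext fun t => (h r hr hr1 t).1]
    exact (hlin.cos.const_mul (y r)).congr_deriv (by ring)
  · rw [show (fun t => b (pt r t)) = fun t => y r * Real.sin (κ * t) from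
      funext fun t => (h r hr hr1 t).2]
    exact (hlin.sin.const_mul (y r)).congr_deriv (by ring)

lemma gradDotS_equivariant {a b p q : (Fin 2 → ℝ) → ℝ} {κ : ℝ} {y η : ℝ → ℝ} (ha : DiskH1 a)
    (hb : DiskH1 b) (hp : DiskH1 p) (hq : DiskH1 q) {r : ℝ} (hr : 0 < r) (hr1 : r < 1)
    (hy : DifferentiableAt ℝ y r) (hη : DifferentiableAt ℝ η r)
    (h : ∀ r, 0 < r → r < 1 → ∀ φ, a (pt r φ) = y r * Real.cos (κ * φ) ∧
      b (pt r φ) = y r * Real.sin (κ * φ))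
    (h' : ∀ r, 0 < r → r < 1 → ∀ φ, p (pt r φ) = η r * Real.cos (κ * φ) ∧
      q (pt r φ) = η r * Real.sin (κ * φ)) (φ : ℝ) :
    gradDotS a p (pt r φ) + gradDotS b q (pt r φ) =
      deriv y r * deriv η r + κ ^ 2 * (y r * η r) / r ^ 2 := by
  have hx := pt_mem_unitDisk hr.le hr1 φ
  obtain ⟨a1, b1, a2, b2⟩ := hasDerivAt_of_equivariant hr hr1 hy h φ
  obtain ⟨p1, q1, p2, q2⟩ := hasDerivAt_of_equivariant hr hr1 hη h' φ
  rw [gradDotS_pt hr (ha.smooth.differentiableAt_unitDisk hx)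
    (hp.smooth.differentiableAt_unitDisk hx) a1 a2 p1 p2,
    gradDotS_pt hr (hb.smooth.differentiableAt_unitDisk hx)
    (hq.smooth.differentiableAt_unitDisk hx) b1 b2 q1 q2]
  have hs := Real.sin_sq_add_cos_sq (κ * φ)
  field_simp
  linear_combination (r ^ 2 * deriv y r * deriv η r + κ ^ 2 * y r * η r) * hs

lemma isProfile_of_weak {V a b : (Fin 2 → ℝ) → ℝ} {k : ℤ} {v : ℝ → ℝ}
    (hV : ContinuousOn V (closure unitDisk))
    (hv : ∀ r, 0 < r → r < 1 → ∀ φ, V (pt r φ) = v r) (ha : DiskH1 a) (hb : DiskH1 b)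
    (wa : ∀ ψ, DiskH10 ψ → formB V a ψ = 0) (wb : ∀ ψ, DiskH10 ψ → formB V b ψ = 0)
    (h : ∀ r, 0 < r → r < 1 → ∀ φ, a (pt r φ) = a (pt r 0) * Real.cos (k * φ) ∧
      b (pt r φ) = a (pt r 0) * Real.sin (k * φ)) :
    IsProfile k v (fun r => a (pt r 0)) := by
  have hs : ContDiffOn ℝ 1 (fun r => a (pt r 0)) (Ioo 0 1) :=
    ha.smooth.comp (contDiff_pt_radius 0).contDiffOn fun r hr =>
      pt_mem_unitDisk hr.1.le hr.2 0
  have hd : ∀ r, 0 < r → r < 1 → DifferentiableAt ℝ (fun r => a (pt r 0)) r := fun r h0 h1 =>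
    (hs.contDiffAt (Ioo_mem_nhds h0 h1)).differentiableAt one_ne_zero
  refine ⟨ha.cont.comp (contDiff_pt_radius 0).continuous.continuousOn fun r hr =>
    pt_mem_closure hr.1 hr.2 0, hs, ?_, fun η hη => ?_⟩
  · refine integrableOn_of_radial (G := fun x => gradSqS a x + gradSqS b x)
      (fun r h0 h1 φ => ?_) (ha.finite.add hb.finite)
    rw [gradSqS, gradSqS, gradDotS_equivariant ha hb ha hb h0 h1 (hd r h0 h1) (hd r h0 h1) h h φ]
    ring
  · obtain ⟨p, q, hp, hq, hpq⟩ := exists_test_fields k hη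
    have h1 := wa p hp
    have h2 := wb q hq
    have h3 : ∫ x in unitDisk, ((gradDotS a p x - V x * a x * p x) +
        (gradDotS b q x - V x * b x * q x)) = 0 := by
      rw [integral_add (integrableOn_formB hV ha hp.toDiskH1)
        (integrableOn_formB hV hb hq.toDiskH1)]
      rw [formB] at h1 h2
      rw [h1, h2, add_zero]
    rw [setIntegral_of_radial (F := fun r => deriv (fun r => a (pt r 0)) r * deriv η r +
      (k:ℝ) ^ 2 * (a (pt r 0) * η r) / r ^ 2 - v r * a (pt r 0) * η r)
      (fun r h0 h1 φ => ?_)] at h3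
    · exact (mul_eq_zero.1 h3).resolve_left radConst_pos.ne'
    · have e := gradDotS_equivariant ha hb hp.toDiskH1 hq.toDiskH1 h0 h1 (hd r h0 h1)
        (hη.smooth.differentiable one_ne_zero r) h (fun r h0 _ => hpq r h0) φ
      rw [← e, hv r h0 h1, (h r h0 h1 φ).1, (h r h0 h1 φ).2, (hpq r h0 φ).1, (hpq r h0 φ).2]
      linear_combination v r * a (pt r 0) * η r * -Real.sin_sq_add_cos_sq (k * φ)

lemma radial_form_nonneg {V : (Fin 2 → ℝ) → ℝ} {v η : ℝ → ℝ}
    (hpos : ∀ ψ, DiskH10 ψ → 0 ≤ formB V ψ ψ)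
    (hv : ∀ r, 0 < r → r < 1 → ∀ φ, V (pt r φ) = v r) (hη : IsTest η) :
    0 ≤ ∫ r in Ioo (0:ℝ) 1, r * (deriv η r ^ 2 - v r * η r ^ 2) := by
  obtain ⟨p, q, hp, hq, hpq⟩ := exists_test_fields 0 hη
  have h := hpos p hp
  rw [formB, setIntegral_of_radial (F := fun r => deriv η r ^ 2 - v r * η r ^ 2)
    (fun r h0 h1 φ => ?_)] at h
  · exact nonneg_of_mul_nonneg_right h radConst_pos
  · have e := gradDotS_equivariant hp.toDiskH1 hq.toDiskH1 hp.toDiskH1 hq.toDiskH1 h0 h1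
      (hη.smooth.differentiable one_ne_zero r) (hη.smooth.differentiable one_ne_zero r)
      (fun r h0 _ => hpq r h0) (fun r h0 _ => hpq r h0) φ
    have hq0 : gradDotS q q (pt r φ) = 0 := by
      have hx := hq.smooth.differentiableAt_unitDisk (pt_mem_unitDisk h0.le h1 φ)
      obtain ⟨-, q1, -, q2⟩ := hasDerivAt_of_equivariant h0 h1
        (hη.smooth.differentiable one_ne_zero r) (fun r h0 _ => hpq r h0) φ
      rw [gradDotS_pt h0 hx hx q1 q2 q1 q2]
      simp
    rw [hq0, add_zero] at e
    rw [e, hv r h0 h1, (hpq r h0 φ).1]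
    simp
    ring

/-! ### The differential equation for a profile -/

lemma IsTest.continuous {η : ℝ → ℝ} (hη : IsTest η) : Continuous η := hη.smooth.continuous

lemma IsTest.continuous_deriv {η : ℝ → ℝ} (hη : IsTest η) : Continuous (deriv η) :=
  hη.smooth.continuous_deriv le_rfl

lemma IsTest.hasDerivAt {η : ℝ → ℝ} (hη : IsTest η) (r : ℝ) : HasDerivAt η (deriv η r) r :=
  (hη.smooth.differentiable one_ne_zero r).hasDerivAt

lemma IsTest.deriv_eq_zero {η : ℝ → ℝ} {a b r : ℝ} (h : ∀ r, r ∉ Icc a b → η r = 0)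
    (hr : r ∉ Icc a b) : deriv η r = 0 := by
  have : η =ᶠ[nhds r] fun _ => 0 := by
    filter_upwards [isClosed_Icc.isOpen_compl.mem_nhds hr] with s hs using h s hs
  rw [this.deriv_eq, deriv_const]

/-- Integration over `(0, 1)` reduces to integration over an interval containing the support. -/
lemma setIntegral_eq_intervalIntegral {F : ℝ → ℝ} {a b : ℝ} (h0 : 0 < a) (hab : a ≤ b) (h1 : b < 1)
    (h : ∀ r, r ∉ Icc a b → F r = 0) : ∫ r in Ioo (0:ℝ) 1, F r = ∫ r in a..b, F r := by
  rw [intervalIntegral.integral_of_le hab, ← integral_Icc_eq_integral_Ioc]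
  exact setIntegral_eq_of_subset_of_forall_sdiff_eq_zero measurableSet_Ioo
    (fun r hr => ⟨h0.trans_le hr.1, hr.2.trans_lt h1⟩) fun r hr => h r hr.2

/-- The du Bois-Reymond lemma. -/
lemma hasDerivAt_of_weak {P R : ℝ → ℝ} (hP : ContinuousOn P (Ioo 0 1))
    (hR : ContinuousOn R (Ioo 0 1))
    (hw : ∀ η, IsTest η → ∫ r in Ioo (0:ℝ) 1, (P r * deriv η r + R r * η r) = 0)
    {r : ℝ} (hr : r ∈ Ioo (0:ℝ) 1) : HasDerivAt P (R r) r := by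
  obtain ⟨a, ha0, har⟩ := exists_between hr.1
  obtain ⟨b, hrb, hb1⟩ := exists_between hr.2
  have hab : a < b := har.trans hrb
  have hsub : Icc a b ⊆ Ioo 0 1 := fun x hx => ⟨ha0.trans_le hx.1, hx.2.trans_lt hb1⟩
  have hII : ∀ x ∈ Ioo (0:ℝ) 1, IntervalIntegrable R volume r x := fun x hx =>
    (hR.mono fun z hz => (ordConnected_Ioo.uIcc_subset hr hx) hz).intervalIntegrable
  set G : ℝ → ℝ := fun x => ∫ s in r..x, R s with hG
  have hGd : ∀ x ∈ Ioo (0:ℝ) 1, HasDerivAt G (R x) x := fun x hx =>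
    intervalIntegral.integral_hasDerivAt_right (hII x hx)
      (hR.stronglyMeasurableAtFilter isOpen_Ioo x hx) (hR.continuousAt (Ioo_mem_nhds hx.1 hx.2))
  have hGc : ContinuousOn G (Ioo 0 1) := fun x hx => (hGd x hx).continuousAt.continuousWithinAt
  set w : ℝ → ℝ := fun x => max 0 ((x - a) * (b - x)) with hw'
  have hwc : Continuous w := by fun_prop
  have hw0 : ∀ x, x ∉ Ioo a b → w x = 0 := fun x hx => by
    refine max_eq_left ?_
    rw [mem_Ioo, not_and_or, not_lt, not_lt] at hx
    rcases hx with hx | hx <;> nlinarith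
  have hwpos : ∀ x ∈ Ioo a b, 0 < w x := fun x hx =>
    lt_max_of_lt_right (mul_pos (sub_pos.2 hx.1) (sub_pos.2 hx.2))
  set h : ℝ → ℝ := fun x => P x - G x with hh
  have hhc : ContinuousOn h (Ioo 0 1) := hP.sub hGc
  have hwi : 0 < ∫ x in a..b, w x :=
    intervalIntegral.intervalIntegral_pos_of_pos_on (hwc.intervalIntegrable _ _)
      (fun x hx => hwpos x hx) hab
  set c : ℝ := (∫ x in a..b, w x * h x) / ∫ x in a..b, w x with hc
  have hψc : Continuous fun x => w x * (h x - c) := by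
    rw [continuous_iff_continuousAt]
    intro x
    by_cases hx : x ∈ Icc a b
    · exact hwc.continuousAt.mul
        ((hhc.continuousAt (Ioo_mem_nhds (hsub hx).1 (hsub hx).2)).sub continuousAt_const)
    · refine (continuousAt_const (y := (0:ℝ))).congr ?_
      filter_upwards [isClosed_Icc.isOpen_compl.mem_nhds hx] with s hs
      rw [hw0 s fun h => hs (Ioo_subset_Icc_self h), zero_mul]
  set η : ℝ → ℝ := fun x => ∫ s in a..x, w s * (h s - c) with hη
  have hηd : ∀ x, HasDerivAt η (w x * (h x - c)) x := fun x =>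
    intervalIntegral.integral_hasDerivAt_right (hψc.intervalIntegrable _ _)
      (hψc.stronglyMeasurableAtFilter _ _) hψc.continuousAt
  have hηd' : deriv η = fun x => w x * (h x - c) := funext fun x => (hηd x).deriv
  have hhi : IntervalIntegrable (fun x => w x * h x) volume a b :=
    (hwc.continuousOn.mul (hhc.mono (by rwa [uIcc_of_le hab.le]))).intervalIntegrable
  have hwc' : Continuous fun x => w x * c := hwc.mul continuous_const
  have hηb : η b = 0 := by
    simp only [hη, mul_sub]
    rw [intervalIntegral.integral_sub hhi (hwc'.intervalIntegrable _ _),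
      intervalIntegral.integral_mul_const, hc, mul_div_cancel₀ _ hwi.ne', sub_self]
  have hηsupp : ∀ x, x ∉ Icc a b → η x = 0 := fun x hx => by
    rw [mem_Icc, not_and_or, not_le, not_le] at hx
    rcases hx with hx | hx
    · refine (intervalIntegral.integral_congr (g := fun _ => 0) fun s hs => ?_).trans (by simp)
      rw [uIcc_of_ge hx.le] at hs
      simp only
      rw [hw0 s fun h => absurd h.1 (not_lt.2 hs.2), zero_mul]
    · have : η x = η b + ∫ s in b..x, w s * (h s - c) :=
        (intervalIntegral.integral_add_adjacent_intervals (hψc.intervalIntegrable _ _)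
          (hψc.intervalIntegrable _ _)).symm
      rw [this, hηb, zero_add]
      refine (intervalIntegral.integral_congr (g := fun _ => 0) fun s hs => ?_).trans (by simp)
      rw [uIcc_of_le hx.le] at hs
      simp only
      rw [hw0 s fun h => absurd h.2 (not_lt.2 hs.1), zero_mul]
  have hηa : η a = 0 := by simp [hη]
  have hηt : IsTest η := by
    refine ⟨contDiff_one_iff_deriv.2 ⟨fun x => (hηd x).differentiableAt, ?_⟩,
      a, b, ha0, hb1, hηsupp⟩
    rw [hηd']
    exact hψc
  have hηc : Continuous η := hηt.continuous
  have hcont : ∀ {F : ℝ → ℝ}, ContinuousOn F (Ioo 0 1) → IntervalIntegrable F volume a b :=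
    fun hF => (hF.mono (by rwa [uIcc_of_le hab.le])).intervalIntegrable
  have e1 : ∫ x in a..b, (P x * deriv η x + R x * η x) = 0 := by
    rw [← setIntegral_eq_intervalIntegral ha0 hab.le hb1 fun x hx => ?_]
    · exact hw η hηt
    · rw [IsTest.deriv_eq_zero hηsupp hx, hηsupp x hx, mul_zero, mul_zero, add_zero]
  have e2 : ∫ x in a..b, (R x * η x + G x * deriv η x) = 0 := by
    have hi : IntervalIntegrable (fun x => R x * η x + G x * deriv η x) volume a b :=
      hcont ((hR.mul hηc.continuousOn).add (hGc.mul hηt.continuous_deriv.continuousOn))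
    rw [intervalIntegral.integral_eq_sub_of_hasDerivAt (f := fun x => G x * η x) (fun x hx => ?_) hi]
    · rw [hηa, hηb, mul_zero, mul_zero, sub_zero]
    · rw [uIcc_of_le hab.le] at hx
      exact (hGd x (hsub hx)).mul (hηt.hasDerivAt x)
  have e3 : ∫ x in a..b, deriv η x = 0 := by
    rw [intervalIntegral.integral_eq_sub_of_hasDerivAt (f := η) (fun x _ => hηt.hasDerivAt x)
      (hηt.continuous_deriv.intervalIntegrable _ _), hηa, hηb, sub_zero]
  have e4 : ∫ x in a..b, w x * (h x - c) ^ 2 = 0 := by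
    have : ∀ x, w x * (h x - c) ^ 2 = (P x * deriv η x + R x * η x) -
        (R x * η x + G x * deriv η x) - c * deriv η x := fun x => by
      rw [hηd']; simp only [hh]; ring
    simp only [this]
    rw [intervalIntegral.integral_sub, intervalIntegral.integral_sub, e1, e2,
      intervalIntegral.integral_const_mul, e3, mul_zero, sub_zero, sub_zero]
    · exact hcont ((hP.mul hηt.continuous_deriv.continuousOn).add (hR.mul hηc.continuousOn))
    · exact hcont ((hR.mul hηc.continuousOn).add (hGc.mul hηt.continuous_deriv.continuousOn))
    · exact hcont (((hP.mul hηt.continuous_deriv.continuousOn).add (hR.mul hηc.continuousOn)).sub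
        ((hR.mul hηc.continuousOn).add (hGc.mul hηt.continuous_deriv.continuousOn)))
    · exact hcont (continuousOn_const.mul hηt.continuous_deriv.continuousOn)
  have e5 : ∀ x ∈ Ioo a b, h x = c := fun x hx => by
    by_contra hne
    refine (intervalIntegral.integral_pos hab ?_ (fun s _ => ?_)
      ⟨x, Ioo_subset_Icc_self hx, ?_⟩).ne' e4
    · exact hwc.continuousOn.mul (((hhc.mono hsub).sub continuousOn_const).pow 2)
    · exact mul_nonneg (le_max_left _ _) (sq_nonneg _)
    · exact mul_pos (hwpos x hx) (pow_pos (abs_pos.2 (sub_ne_zero.2 hne)) 2 |>.trans_eq (sq_abs _))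
  refine ((hGd r hr).add_const c).congr_of_eventuallyEq ?_
  filter_upwards [Ioo_mem_nhds har hrb] with x hx
  have := e5 x hx
  simp only [hh] at this
  linarith

lemma IsProfile.hasDerivAt {κ : ℝ} {v y : ℝ → ℝ} (hy : IsProfile κ v y) {r : ℝ}
    (hr : r ∈ Ioo (0:ℝ) 1) : HasDerivAt y (deriv y r) r :=
  ((hy.smooth.contDiffAt (Ioo_mem_nhds hr.1 hr.2)).differentiableAt one_ne_zero).hasDerivAt

lemma IsProfile.continuousOn_deriv {κ : ℝ} {v y : ℝ → ℝ} (hy : IsProfile κ v y) :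
    ContinuousOn (deriv y) (Ioo 0 1) :=
  hy.smooth.continuousOn_deriv_of_isOpen isOpen_Ioo le_rfl

lemma IsProfile.hasDerivAt_flux {κ : ℝ} {v y : ℝ → ℝ} (hy : IsProfile κ v y)
    (hv : ContinuousOn v (Icc 0 1)) {r : ℝ} (hr : r ∈ Ioo (0:ℝ) 1) :
    HasDerivAt (fun s => s * deriv y s) ((κ ^ 2 / r - r * v r) * y r) r := by
  have hyc := hy.cont.mono Ioo_subset_Icc_self
  have hvc := hv.mono Ioo_subset_Icc_self
  have hRc : ContinuousOn (fun r => (κ ^ 2 / r - r * v r) * y r) (Ioo 0 1) :=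
    ((continuousOn_const.div continuousOn_id fun x hx => hx.1.ne').sub
      (continuousOn_id.mul hvc)).mul hyc
  refine hasDerivAt_of_weak (P := fun s => s * deriv y s)
    (continuousOn_id.mul hy.continuousOn_deriv) hRc (fun η hη => ?_) hr
  refine Eq.trans (setIntegral_congr_fun measurableSet_Ioo fun x hx => ?_) (hy.weak η hη)
  have := hx.1.ne'
  field_simp
  ring

lemma IsProfile.hasDerivAt_deriv {κ : ℝ} {v y : ℝ → ℝ} (hy : IsProfile κ v y)
    (hv : ContinuousOn v (Icc 0 1)) {r : ℝ} (hr : r ∈ Ioo (0:ℝ) 1) :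
    HasDerivAt (deriv y) (κ ^ 2 / r ^ 2 * y r - v r * y r - deriv y r / r) r := by
  have h := (hy.hasDerivAt_flux hv hr).div (hasDerivAt_id r) hr.1.ne'
  have h0 := hr.1.ne'
  refine (h.congr_of_eventuallyEq ?_).congr_deriv ?_
  · filter_upwards [Ioo_mem_nhds hr.1 hr.2] with s hs
    have := hs.1.ne'
    simp only [Pi.div_apply, id]
    field_simp
  · simp only [id]
    field_simp

lemma IsProfile.contDiffOn_two {κ : ℝ} {v y : ℝ → ℝ} (hy : IsProfile κ v y)
    (hv : ContinuousOn v (Icc 0 1)) : ContDiffOn ℝ 2 y (Ioo 0 1) := by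
  rw [show (2 : WithTop ℕ∞) = 1 + 1 by norm_num, contDiffOn_succ_iff_deriv_of_isOpen isOpen_Ioo]
  refine ⟨fun r hr => (hy.hasDerivAt hr).differentiableAt.differentiableWithinAt, by simp, ?_⟩
  rw [show (1 : WithTop ℕ∞) = 0 + 1 by norm_num, contDiffOn_succ_iff_deriv_of_isOpen isOpen_Ioo]
  refine ⟨fun r hr => (hy.hasDerivAt_deriv hv hr).differentiableAt.differentiableWithinAt,
    by simp, contDiffOn_zero.2 ?_⟩
  have hyc := hy.cont.mono Ioo_subset_Icc_self
  have hvc := hv.mono Ioo_subset_Icc_self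
  have : ContinuousOn (fun r => κ ^ 2 / r ^ 2 * y r - v r * y r - deriv y r / r) (Ioo 0 1) :=
    (((continuousOn_const.div (continuousOn_id.pow 2) fun x hx => (pow_pos hx.1 2).ne').mul
      hyc).sub (hvc.mul hyc)).sub (hy.continuousOn_deriv.div continuousOn_id fun x hx => hx.1.ne')
  exact this.congr fun r hr => (hy.hasDerivAt_deriv hv hr).deriv

/-- Uniqueness for the initial value problem. -/
lemma IsProfile.eq_zero {κ : ℝ} {v y : ℝ → ℝ} (hy : IsProfile κ v y)
    (hv : ContinuousOn v (Icc 0 1)) {r₀ : ℝ} (hr₀ : r₀ ∈ Ioo (0:ℝ) 1) (h0 : y r₀ = 0)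
    (h1 : deriv y r₀ = 0) {r : ℝ} (hr : r ∈ Ioo (0:ℝ) 1) : y r = 0 := by
  obtain ⟨a, ha0, ha⟩ := exists_between (lt_min hr₀.1 hr.1)
  obtain ⟨b, hb, hb1⟩ := exists_between (max_lt hr₀.2 hr.2)
  have hsub : Icc a b ⊆ Ioo 0 1 := fun x hx => ⟨ha0.trans_le hx.1, hx.2.trans_lt hb1⟩
  have hmem : ∀ t ∈ Ioo a b, t ∈ Ioo (0:ℝ) 1 := fun t ht => hsub (Ioo_subset_Icc_self ht)
  have hvc := hv.mono Ioo_subset_Icc_self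
  have hmc : ContinuousOn (fun s => |κ ^ 2 / s - s * v s| + |1 / s|) (Icc a b) :=
    (((continuousOn_const.div continuousOn_id fun x hx => hx.1.ne').sub
      (continuousOn_id.mul hvc)).abs.add
      (continuousOn_const.div continuousOn_id fun x hx => hx.1.ne').abs).mono hsub
  obtain ⟨K, hK⟩ := isCompact_Icc.exists_bound_of_continuousOn hmc
  set F : ℝ → ℝ × ℝ → ℝ × ℝ := fun s p => (1 / s * p.2, (κ ^ 2 / s - s * v s) * p.1) with hF
  have hL : ∀ t ∈ Ioo a b, LipschitzOnWith (Real.toNNReal K) (F t) univ := fun t ht => by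
    refine LipschitzOnWith.of_dist_le_mul fun p _ q _ => ?_
    have hKt := hK t (Ioo_subset_Icc_self ht)
    rw [Real.norm_eq_abs, abs_of_nonneg (by positivity)] at hKt
    have hK0 : 0 ≤ K := le_trans (by positivity) hKt
    rw [Real.coe_toNNReal _ hK0, Prod.dist_eq, Prod.dist_eq]
    simp only [hF, Real.dist_eq, ← mul_sub, abs_mul]
    refine max_le (mul_le_mul ?_ (le_max_right _ _) (abs_nonneg _) hK0)
      (mul_le_mul ?_ (le_max_left _ _) (abs_nonneg _) hK0)
    · exact le_trans (le_add_of_nonneg_left (abs_nonneg _)) hKt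
    · exact le_trans (le_add_of_nonneg_right (abs_nonneg _)) hKt
  have hr₀' : r₀ ∈ Ioo a b := ⟨ha.trans_le (min_le_left _ _), (le_max_left _ _).trans_lt hb⟩
  have hr' : r ∈ Ioo a b := ⟨ha.trans_le (min_le_right _ _), (le_max_right _ _).trans_lt hb⟩
  have := ODE_solution_unique_of_mem_Ioo (v := F) (s := fun _ => univ) (K := Real.toNNReal K)
    (f := fun s => (y s, s * deriv y s)) (g := fun _ => 0) hL hr₀'
    (fun t ht => ⟨?_, mem_univ _⟩) (fun t ht => ⟨?_, mem_univ _⟩) (by simp [h0, h1]) hr'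
  · exact congrArg Prod.fst this
  · refine ((hy.hasDerivAt (hmem t ht)).prodMk (hy.hasDerivAt_flux hv (hmem t ht))).congr_deriv ?_
    have := (hmem t ht).1.ne'
    simp only [hF, Prod.mk.injEq, and_true]
    field_simp
  · refine (hasDerivAt_const t _).congr_deriv ?_
    simp [hF, Prod.zero_eq_mk]

/-! ### Truncations and nodal properties of stable profiles -/

/-- A smooth function vanishing near zero and equal to the identity away from zero. -/
def softCut (s : ℝ) : ℝ := s * Real.smoothTransition (s ^ 2 - 1)

lemma softCut_contDiff : ContDiff ℝ 1 softCut :=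
  contDiff_id.mul (Real.smoothTransition.contDiff.comp ((contDiff_id.pow 2).sub contDiff_const))

lemma softCut_of_le {s : ℝ} (h : |s| ≤ 1) : softCut s = 0 := by
  rw [softCut, Real.smoothTransition.zero_of_nonpos, mul_zero]
  rw [← sq_abs]
  nlinarith [abs_nonneg s]

lemma softCut_of_ge {s : ℝ} (h : 2 ≤ |s|) : softCut s = s := by
  rw [softCut, Real.smoothTransition.one_of_one_le, mul_one]
  rw [← sq_abs]
  nlinarith

lemma abs_softCut_le (s : ℝ) : |softCut s| ≤ |s| := by
  rw [softCut, abs_mul, abs_of_nonneg (Real.smoothTransition.nonneg _)]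
  exact mul_le_of_le_one_right (abs_nonneg _) (Real.smoothTransition.le_one _)

lemma deriv_softCut_of_lt {s : ℝ} (h : |s| < 1) : deriv softCut s = 0 := by
  have : softCut =ᶠ[nhds s] fun _ => 0 := by
    filter_upwards [continuous_abs.continuousAt.eventually_lt continuousAt_const h] with t ht
    exact softCut_of_le ht.le
  rw [this.deriv_eq, deriv_const]

lemma deriv_softCut_of_gt {s : ℝ} (h : 2 < |s|) : deriv softCut s = 1 := by
  have : softCut =ᶠ[nhds s] fun t => t := by
    filter_upwards [continuousAt_const.eventually_lt continuous_abs.continuousAt h] with t ht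
    exact softCut_of_ge ht.le
  rw [this.deriv_eq, deriv_id'']

lemma exists_deriv_softCut_bound : ∃ C, 0 ≤ C ∧ ∀ s, |deriv softCut s| ≤ C := by
  obtain ⟨C, hC⟩ := (isCompact_Icc (a := (-2:ℝ)) (b := 2)).exists_bound_of_continuousOn
    (softCut_contDiff.continuous_deriv le_rfl).continuousOn
  refine ⟨max C 1, le_max_of_le_right zero_le_one, fun s => ?_⟩
  by_cases hs : 2 < |s|
  · rw [deriv_softCut_of_gt hs, abs_one]
    exact le_max_right _ _
  · exact (hC s (abs_le.1 (not_lt.1 hs))).trans (le_max_left _ _)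

/-- Approximation of `y` on a nodal interval `(c, d)` by test functions. -/
lemma exists_truncation {y : ℝ → ℝ} {c d : ℝ} (hc : 0 ≤ c) (hcd : c < d) (hd : d ≤ 1)
    (hyc : ContinuousOn y (Icc 0 1)) (hys : ContDiffOn ℝ 1 y (Ioo 0 1)) (hy0 : y c = 0)
    (hy1 : y d = 0) : ∃ C : ℝ, 0 ≤ C ∧ ∃ η : ℕ → ℝ → ℝ, (∀ n, IsTest (η n)) ∧
      (∀ n r, |η n r| ≤ |y r| ∧ |deriv (η n) r| ≤ C * |deriv y r|) ∧
      ∀ r, ∀ᶠ n in Filter.atTop,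
        η n r = indicator (Ioo c d) y r ∧
        deriv (η n) r = indicator (Ioo c d ∩ {s | y s ≠ 0}) (deriv y) r := by
  obtain ⟨C, hC0, hC⟩ := exists_deriv_softCut_bound
  set δ : ℕ → ℝ := fun n => 1 / ((n:ℝ) + 1) with hδ
  have hδ0 : ∀ n, 0 < δ n := fun n => Nat.one_div_pos_of_nat
  set η : ℕ → ℝ → ℝ := fun n => indicator (Ioo c d) fun r => δ n * softCut (y r / δ n) with hη
  have hsmall : ∀ n r, |y r| ≤ δ n → η n r = 0 := fun n r h => by
    have : softCut (y r / δ n) = 0 := softCut_of_le (by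
      rw [abs_div, abs_of_pos (hδ0 n), div_le_one (hδ0 n)]; exact h)
    simp [hη, indicator, this]
  have hsupp : ∀ n, ∃ a b, c < a ∧ b < d ∧ ∀ r, r ∉ Icc a b → η n r = 0 := fun n => by
    have h1 : ∀ᶠ r in nhdsWithin c (Ioi c), |y r| < δ n := by
      have : ContinuousWithinAt (fun r => |y r|) (Ioi c) c :=
        ((hyc c ⟨hc, hcd.le.trans hd⟩).mono_of_mem_nhdsWithin
          (Filter.mem_of_superset (Icc_mem_nhdsGT hcd) (Icc_subset_Icc hc hd))).abs
      exact this.eventually_lt continuousWithinAt_const (by simpa only [hy0, abs_zero] using hδ0 n)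
    have h2 : ∀ᶠ r in nhdsWithin d (Iio d), |y r| < δ n := by
      have : ContinuousWithinAt (fun r => |y r|) (Iio d) d :=
        ((hyc d ⟨hc.trans hcd.le, hd⟩).mono_of_mem_nhdsWithin
          (Filter.mem_of_superset (Icc_mem_nhdsLT hcd) (Icc_subset_Icc hc hd))).abs
      exact this.eventually_lt continuousWithinAt_const (by simpa only [hy1, abs_zero] using hδ0 n)
    obtain ⟨a, ha, ha'⟩ := (mem_nhdsGT_iff_exists_Ioo_subset).1 h1
    obtain ⟨b, hb, hb'⟩ := (mem_nhdsLT_iff_exists_Ioo_subset).1 h2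
    refine ⟨a, b, ha, hb, fun r hr => ?_⟩
    by_cases hI : r ∈ Ioo c d
    · refine hsmall n r ?_
      rw [mem_Icc, not_and_or, not_le, not_le] at hr
      rcases hr with hr | hr
      · exact (ha' ⟨hI.1, hr⟩ : |y r| < δ n).le
      · exact (hb' ⟨hr, hI.2⟩ : |y r| < δ n).le
    · simp [hη, hI]
  have hIoo : Ioo c d ⊆ Ioo 0 1 := Ioo_subset_Ioo hc hd
  have hyd : ∀ r ∈ Ioo c d, ContDiffAt ℝ 1 y r := fun r hr =>
    hys.contDiffAt (Ioo_mem_nhds (hIoo hr).1 (hIoo hr).2)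
  have hev : ∀ n, ∀ r ∈ Ioo c d, η n =ᶠ[nhds r] fun s => δ n * softCut (y s / δ n) :=
    fun n r hr => by
      filter_upwards [Ioo_mem_nhds hr.1 hr.2] with s hs
      simp [hη, hs.1, hs.2]
  have hderiv : ∀ n, ∀ r ∈ Ioo c d, deriv (η n) r = deriv softCut (y r / δ n) * deriv y r :=
    fun n r hr => by
      have e1 := ((hyd r hr).differentiableAt one_ne_zero).hasDerivAt.div_const (δ n)
      have e2 : HasDerivAt softCut (deriv softCut (y r / δ n)) (y r / δ n) :=
        (softCut_contDiff.differentiable one_ne_zero _).hasDerivAt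
      have e3 := (e2.comp r e1).const_mul (δ n)
      rw [(hev n r hr).deriv_eq]
      refine e3.deriv.trans ?_
      have := (hδ0 n).ne'
      field_simp
  have hderiv0 : ∀ n, ∀ r, r ∉ Ioo c d → deriv (η n) r = 0 := fun n r hr => by
    obtain ⟨a, b, ha, hb, hab⟩ := hsupp n
    exact IsTest.deriv_eq_zero hab fun h => hr ⟨ha.trans_le h.1, h.2.trans_lt hb⟩
  refine ⟨C, hC0, η, fun n => ?_, fun n r => ⟨?_, ?_⟩, fun r => ?_⟩
  · obtain ⟨a, b, ha, hb, hab⟩ := hsupp n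
    refine ⟨contDiff_iff_contDiffAt.2 fun r => ?_, a, b, hc.trans_lt ha, hb.trans_le hd, hab⟩
    by_cases hr : r ∈ Icc a b
    · have hr' : r ∈ Ioo c d := ⟨ha.trans_le hr.1, hr.2.trans_lt hb⟩
      refine ContDiffAt.congr_of_eventuallyEq ?_ (hev n r hr')
      exact contDiffAt_const.mul (softCut_contDiff.contDiffAt.comp r ((hyd r hr').div_const _))
    · refine (contDiffAt_const (c := (0:ℝ))).congr_of_eventuallyEq ?_
      filter_upwards [isClosed_Icc.isOpen_compl.mem_nhds hr] with s hs using hab s hs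
  · by_cases hr : r ∈ Ioo c d
    · simp only [hη, indicator_of_mem hr]
      rw [abs_mul, abs_of_pos (hδ0 n)]
      refine (mul_le_mul_of_nonneg_left (abs_softCut_le _) (hδ0 n).le).trans_eq ?_
      rw [abs_div, abs_of_pos (hδ0 n), mul_div_cancel₀ _ (hδ0 n).ne']
    · simp only [hη, indicator_of_notMem hr, abs_zero, abs_nonneg]
  · by_cases hr : r ∈ Ioo c d
    · rw [hderiv n r hr, abs_mul]
      exact mul_le_mul_of_nonneg_right (hC _) (abs_nonneg _)
    · rw [hderiv0 n r hr, abs_zero]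
      positivity
  · by_cases hr : r ∈ Ioo c d
    · by_cases h0 : y r = 0
      · refine Filter.Eventually.of_forall fun n => ⟨?_, ?_⟩
        · rw [hsmall n r (by rw [h0, abs_zero]; exact (hδ0 n).le), indicator_of_mem hr, h0]
        · rw [hderiv n r hr, h0, zero_div, deriv_softCut_of_lt (by simp), zero_mul,
            indicator_of_notMem fun h => h.2 h0]
      · have : ∀ᶠ n in Filter.atTop, δ n < |y r| / 2 :=
          tendsto_one_div_add_atTop_nhds_zero_nat.eventually_lt_const (by positivity)
        filter_upwards [this] with n hn
        have h2 : 2 < |y r / δ n| := by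
          rw [abs_div, abs_of_pos (hδ0 n), lt_div_iff₀ (hδ0 n)]
          linarith
        refine ⟨?_, ?_⟩
        · simp only [hη, indicator_of_mem hr]
          rw [softCut_of_ge h2.le, mul_div_cancel₀ _ (hδ0 n).ne']
        · rw [hderiv n r hr, deriv_softCut_of_gt h2, one_mul,
            indicator_of_mem (show r ∈ Ioo c d ∩ {s | y s ≠ 0} from ⟨hr, h0⟩)]
    · refine Filter.Eventually.of_forall fun n => ⟨?_, ?_⟩
      · simp only [hη, indicator_of_notMem hr]
      · rw [hderiv0 n r hr, indicator_of_notMem fun h => hr h.1]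

lemma integrableOn_Ioo_of_continuousOn {F : ℝ → ℝ} (hF : ContinuousOn F (Icc 0 1)) :
    IntegrableOn F (Ioo 0 1) :=
  (hF.integrableOn_Icc).mono_set Ioo_subset_Icc_self

lemma integrableOn_Ioo_mono {F B : ℝ → ℝ} (hF : ContinuousOn F (Ioo 0 1))
    (hB : IntegrableOn B (Ioo 0 1)) (h : ∀ r ∈ Ioo (0:ℝ) 1, |F r| ≤ B r) :
    IntegrableOn F (Ioo 0 1) :=
  Integrable.mono' hB (hF.aestronglyMeasurable measurableSet_Ioo)
    ((ae_restrict_iff' measurableSet_Ioo).2 (Filter.Eventually.of_forall h))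

namespace IsProfile

variable {κ : ℝ} {v y : ℝ → ℝ}

lemma integrableOn_deriv_sq (hy : IsProfile κ v y) :
    IntegrableOn (fun r => r * deriv y r ^ 2) (Ioo 0 1) := by
  refine integrableOn_Ioo_mono (continuousOn_id.mul (hy.continuousOn_deriv.pow 2)) hy.energy
    fun r hr => ?_
  have := hr.1
  rw [abs_of_nonneg (by positivity), mul_add]
  exact le_add_of_nonneg_right (by positivity)

lemma integrableOn_angular (hy : IsProfile κ v y) :
    IntegrableOn (fun r => r * (κ ^ 2 * y r ^ 2 / r ^ 2)) (Ioo 0 1) := by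
  have hyc := hy.cont.mono Ioo_subset_Icc_self
  refine integrableOn_Ioo_mono (continuousOn_id.mul ((continuousOn_const.mul (hyc.pow 2)).div
    (continuousOn_id.pow 2) fun r hr => (pow_pos hr.1 2).ne')) hy.energy fun r hr => ?_
  have := hr.1
  rw [abs_of_nonneg (by positivity), mul_add]
  exact le_add_of_nonneg_left (by positivity)

lemma integrableOn_deriv_mul (hy : IsProfile κ v y) {η : ℝ → ℝ} (hη : IsTest η) :
    IntegrableOn (fun r => r * (deriv y r * deriv η r)) (Ioo 0 1) := by
  refine integrableOn_Ioo_mono (continuousOn_id.mul (hy.continuousOn_deriv.mul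
    hη.continuous_deriv.continuousOn)) (hy.integrableOn_deriv_sq.add
    (integrableOn_Ioo_of_continuousOn (F := fun r => r * deriv η r ^ 2)
      (continuousOn_id.mul (hη.continuous_deriv.continuousOn.pow 2)))) fun r hr => ?_
  simp only [Pi.add_apply]
  rw [abs_mul, abs_of_pos hr.1, ← mul_add, abs_mul]
  refine mul_le_mul_of_nonneg_left ?_ hr.1.le
  nlinarith [sq_nonneg (|deriv y r| - |deriv η r|), sq_abs (deriv y r), sq_abs (deriv η r),
    sq_nonneg (deriv y r), sq_nonneg (deriv η r)]

/-- Passage to the limit in the weak equation and in the stability inequality. -/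
lemma nodal_limit (hy : IsProfile κ v y) (hv : ContinuousOn v (Icc 0 1))
    (hQ : ∀ η, IsTest η → 0 ≤ ∫ r in Ioo (0:ℝ) 1, r * (deriv η r ^ 2 - v r * η r ^ 2))
    {c d : ℝ} (hc : 0 ≤ c) (hcd : c < d) (hd : d ≤ 1) (hy0 : y c = 0) (hy1 : y d = 0) :
    (∫ r in Ioo (0:ℝ) 1, r * (deriv y r * indicator (Ioo c d ∩ {s | y s ≠ 0}) (deriv y) r +
      κ ^ 2 * (y r * indicator (Ioo c d) y r) / r ^ 2 - v r * y r * indicator (Ioo c d) y r) = 0) ∧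
    ∀ η, IsTest η → ∀ t : ℝ, 0 ≤ ∫ r in Ioo (0:ℝ) 1,
      r * ((indicator (Ioo c d ∩ {s | y s ≠ 0}) (deriv y) r + t * deriv η r) ^ 2 -
        v r * (indicator (Ioo c d) y r + t * η r) ^ 2) := by
  obtain ⟨C, hC0, ζ, hζ, hb, hlim⟩ := exists_truncation hc hcd hd hy.cont hy.smooth hy0 hy1
  have hyc := hy.cont.mono Ioo_subset_Icc_self
  have hvc := hv.mono Ioo_subset_Icc_self
  have hdc := hy.continuousOn_deriv
  obtain ⟨K, hK⟩ := isCompact_Icc.exists_bound_of_continuousOn hv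
  have hK0 : 0 ≤ K := (norm_nonneg _).trans (hK 0 ⟨le_rfl, zero_le_one⟩)
  have hI := hy.integrableOn_deriv_sq
  constructor
  · refine tendsto_nhds_unique (f := fun n => ∫ r in Ioo (0:ℝ) 1,
      r * (deriv y r * deriv (ζ n) r + κ ^ 2 * (y r * ζ n r) / r ^ 2 - v r * y r * ζ n r))
      (tendsto_integral_of_dominated_convergence (fun r => C * (r * deriv y r ^ 2) +
        r * (κ ^ 2 * y r ^ 2 / r ^ 2) + K * y r ^ 2) (fun n => ?_) ?_ (fun n => ?_) ?_) ?_
    · refine ContinuousOn.aestronglyMeasurable ?_ measurableSet_Ioo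
      have h1 := (hζ n).continuous.continuousOn (s := Ioo (0:ℝ) 1)
      have h2 := (hζ n).continuous_deriv.continuousOn (s := Ioo (0:ℝ) 1)
      exact continuousOn_id.mul (((hdc.mul h2).add ((continuousOn_const.mul (hyc.mul h1)).div
        (continuousOn_id.pow 2) fun r hr => (pow_pos hr.1 2).ne')).sub ((hvc.mul hyc).mul h1))
    · exact ((hI.const_mul C).add hy.integrableOn_angular).add
        (integrableOn_Ioo_of_continuousOn (continuousOn_const.mul (hy.cont.pow 2)))
    · refine (ae_restrict_iff' measurableSet_Ioo).2 (Filter.Eventually.of_forall fun r hr => ?_)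
      have h0 := hr.1
      obtain ⟨b1, b2⟩ := hb n r
      have b3 := hK r (Ioo_subset_Icc_self hr)
      rw [Real.norm_eq_abs] at b3 ⊢
      have e1 : |r * (deriv y r * deriv (ζ n) r)| ≤ C * (r * deriv y r ^ 2) := by
        rw [abs_mul, abs_of_pos h0, abs_mul, ← sq_abs (deriv y r)]
        nlinarith [mul_le_mul_of_nonneg_left b2 (mul_nonneg h0.le (abs_nonneg (deriv y r)))]
      have hyy : |y r * ζ n r| ≤ y r ^ 2 := by
        rw [abs_mul, ← sq_abs (y r), sq]
        exact mul_le_mul_of_nonneg_left b1 (abs_nonneg _)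
      have e2 : |r * (κ ^ 2 * (y r * ζ n r) / r ^ 2)| ≤ r * (κ ^ 2 * y r ^ 2 / r ^ 2) := by
        rw [abs_mul, abs_of_pos h0, abs_div, abs_mul, abs_of_nonneg (sq_nonneg κ),
          abs_of_nonneg (sq_nonneg r)]
        gcongr
      have e3 : |r * (v r * (y r * ζ n r))| ≤ K * y r ^ 2 := by
        rw [abs_mul, abs_of_pos h0, abs_mul (v r)]
        refine (mul_le_of_le_one_left (by positivity) hr.2.le).trans ?_
        gcongr
      calc _ = |r * (deriv y r * deriv (ζ n) r) + r * (κ ^ 2 * (y r * ζ n r) / r ^ 2) -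
            r * (v r * (y r * ζ n r))| := by congr 1; ring
        _ ≤ _ := (abs_sub _ _).trans (add_le_add ((abs_add_le _ _).trans (add_le_add e1 e2)) e3)
    · refine Filter.Eventually.of_forall fun r => tendsto_const_nhds.congr' ?_
      filter_upwards [hlim r] with n hn
      rw [hn.1, hn.2]
    · simp only [fun n => hy.weak _ (hζ n)]
      exact tendsto_const_nhds
  · intro η hη t
    have hζη : ∀ n, IsTest fun r => ζ n r + t * η r := fun n => by
      obtain ⟨a, b, ha, hb, hab⟩ := (hζ n).supp
      obtain ⟨a', b', ha', hb', hab'⟩ := hη.supp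
      refine ⟨(hζ n).smooth.add (contDiff_const.mul hη.smooth), min a a', max b b',
        lt_min ha ha', max_lt hb hb', fun r hr => ?_⟩
      rw [hab r fun h => hr ⟨(min_le_left _ _).trans h.1, h.2.trans (le_max_left _ _)⟩,
        hab' r fun h => hr ⟨(min_le_right _ _).trans h.1, h.2.trans (le_max_right _ _)⟩,
        mul_zero, add_zero]
    have hder : ∀ n r, deriv (fun r => ζ n r + t * η r) r = deriv (ζ n) r + t * deriv η r :=
      fun n r => (((hζ n).hasDerivAt r).add ((hη.hasDerivAt r).const_mul t)).deriv
    refine ge_of_tendsto' (tendsto_integral_of_dominated_convergence (F := fun n r =>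
      r * ((deriv (ζ n) r + t * deriv η r) ^ 2 - v r * (ζ n r + t * η r) ^ 2))
      (fun r => 2 * C ^ 2 * (r * deriv y r ^ 2) +
        (2 * t ^ 2 * deriv η r ^ 2 + K * (2 * y r ^ 2 + 2 * t ^ 2 * η r ^ 2)))
      (fun n => ?_) ?_ (fun n => ?_) ?_) fun n => ?_
    · refine ContinuousOn.aestronglyMeasurable ?_ measurableSet_Ioo
      have h1 := (hζ n).continuous.continuousOn (s := Ioo (0:ℝ) 1)
      have h2 := (hζ n).continuous_deriv.continuousOn (s := Ioo (0:ℝ) 1)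
      have h3 := hη.continuous.continuousOn (s := Ioo (0:ℝ) 1)
      have h4 := hη.continuous_deriv.continuousOn (s := Ioo (0:ℝ) 1)
      exact continuousOn_id.mul (((h2.add (continuousOn_const.mul h4)).pow 2).sub
        (hvc.mul ((h1.add (continuousOn_const.mul h3)).pow 2)))
    · have h3 := hη.continuous.continuousOn (s := Icc (0:ℝ) 1)
      have h4 := hη.continuous_deriv.continuousOn (s := Icc (0:ℝ) 1)
      exact (hI.const_mul _).add (integrableOn_Ioo_of_continuousOn
        ((continuousOn_const.mul (h4.pow 2)).add (continuousOn_const.mul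
          ((continuousOn_const.mul (hy.cont.pow 2)).add (continuousOn_const.mul (h3.pow 2))))))
    · refine (ae_restrict_iff' measurableSet_Ioo).2 (Filter.Eventually.of_forall fun r hr => ?_)
      have h0 := hr.1
      obtain ⟨b1, b2⟩ := hb n r
      have b3 := hK r (Ioo_subset_Icc_self hr)
      rw [Real.norm_eq_abs] at b3 ⊢
      have c1 : ζ n r ^ 2 ≤ y r ^ 2 := sq_le_sq.2 b1
      have c2 : deriv (ζ n) r ^ 2 ≤ C ^ 2 * deriv y r ^ 2 := by
        rw [← mul_pow]
        refine sq_le_sq.2 (b2.trans_eq ?_)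
        rw [abs_mul, abs_of_nonneg hC0]
      have d1 : (ζ n r + t * η r) ^ 2 ≤ 2 * y r ^ 2 + 2 * t ^ 2 * η r ^ 2 := by
        nlinarith [sq_nonneg (ζ n r - t * η r)]
      have d2 : (deriv (ζ n) r + t * deriv η r) ^ 2 ≤
          2 * C ^ 2 * deriv y r ^ 2 + 2 * t ^ 2 * deriv η r ^ 2 := by
        nlinarith [sq_nonneg (deriv (ζ n) r - t * deriv η r)]
      have e1 : |r * (deriv (ζ n) r + t * deriv η r) ^ 2| ≤
          2 * C ^ 2 * (r * deriv y r ^ 2) + 2 * t ^ 2 * deriv η r ^ 2 := by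
        rw [abs_of_nonneg (by positivity)]
        have : r * (2 * t ^ 2 * deriv η r ^ 2) ≤ 2 * t ^ 2 * deriv η r ^ 2 :=
          mul_le_of_le_one_left (by positivity) hr.2.le
        nlinarith [mul_le_mul_of_nonneg_left d2 h0.le]
      have e2 : |r * (v r * (ζ n r + t * η r) ^ 2)| ≤
          K * (2 * y r ^ 2 + 2 * t ^ 2 * η r ^ 2) := by
        rw [abs_mul, abs_of_pos h0, abs_mul (v r),
          abs_of_nonneg (sq_nonneg (ζ n r + t * η r))]
        refine (mul_le_of_le_one_left (by positivity) hr.2.le).trans ?_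
        gcongr
      calc _ = |r * (deriv (ζ n) r + t * deriv η r) ^ 2 -
            r * (v r * (ζ n r + t * η r) ^ 2)| := by congr 1; ring
        _ ≤ _ := (abs_sub _ _).trans (add_le_add e1 e2)
        _ = _ := by ring
    · refine Filter.Eventually.of_forall fun r => tendsto_const_nhds.congr' ?_
      filter_upwards [hlim r] with n hn
      rw [hn.1, hn.2]
    · have := hQ _ (hζη n)
      simpa only [hder] using this

end IsProfile

lemma sign_of_ne_zero {y : ℝ → ℝ} (hc : ContinuousOn y (Ioo 0 1))
    (h : ∀ r ∈ Ioo (0:ℝ) 1, y r ≠ 0) :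
    (∀ r ∈ Ioo (0:ℝ) 1, 0 < y r) ∨ ∀ r ∈ Ioo (0:ℝ) 1, y r < 0 := by
  by_contra hcon
  push Not at hcon
  obtain ⟨⟨r, hr, hyr⟩, s, hs, hys⟩ := hcon
  obtain ⟨t, ht, hyt⟩ := isPreconnected_Ioo.intermediate_value hr hs hc ⟨hyr, hys⟩
  exact h t ht hyt

namespace IsProfile

variable {κ : ℝ} {v y : ℝ → ℝ}

lemma isOpen_nodal (hy : IsProfile κ v y) {c d : ℝ} (hc : 0 ≤ c) (hd : d ≤ 1) :
    IsOpen (Ioo c d ∩ {s | y s ≠ 0}) :=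
  (hy.cont.mono fun _ hs => ⟨hc.trans hs.1.le, hs.2.le.trans hd⟩).isOpen_inter_preimage
    isOpen_Ioo isOpen_compl_singleton

lemma integrableOn_nodal (hy : IsProfile κ v y) (hv : ContinuousOn v (Icc 0 1)) {c d : ℝ}
    (hc : 0 ≤ c) (hd : d ≤ 1) :
    IntegrableOn (fun r => r * (indicator (Ioo c d ∩ {s | y s ≠ 0}) (deriv y) r ^ 2 -
      v r * indicator (Ioo c d) y r ^ 2)) (Ioo 0 1) := by
  have h1 := hy.integrableOn_deriv_sq.indicator (hy.isOpen_nodal hc hd).measurableSet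
  have h2 := (integrableOn_Ioo_of_continuousOn (F := fun r => r * (v r * y r ^ 2))
    (continuousOn_id.mul (hv.mul (hy.cont.pow 2)))).indicator (measurableSet_Ioo (a := c) (b := d))
  refine (h1.sub h2).congr (Filter.Eventually.of_forall fun r => ?_)
  simp only [Pi.sub_apply, indicator_apply]
  split_ifs <;> ring

lemma eq_zero_of_nodal (hy : IsProfile κ v y) (hκ : κ ≠ 0) (hv : ContinuousOn v (Icc 0 1))
    (hQ : ∀ η, IsTest η → 0 ≤ ∫ r in Ioo (0:ℝ) 1, r * (deriv η r ^ 2 - v r * η r ^ 2))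
    {d : ℝ} (h0d : 0 < d) (hd : d ≤ 1) (hy0 : y 0 = 0) (hyd : y d = 0) {r : ℝ}
    (hr : r ∈ Ioo 0 d) : y r = 0 := by
  by_contra hne
  obtain ⟨h1, h2⟩ := hy.nodal_limit hv hQ le_rfl h0d hd hy0 hyd
  have hz : IsTest fun _ => 0 := ⟨contDiff_const, 1 / 2, 1 / 2, by norm_num, by norm_num,
    fun _ _ => rfl⟩
  have h3 := h2 _ hz 0
  simp only [mul_zero, zero_mul, add_zero] at h3
  have hI1 := hy.integrableOn_nodal hv le_rfl hd
  have hI2 := hy.integrableOn_angular.indicator (measurableSet_Ioo (a := 0) (b := d))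
  have h4 : ∫ r in Ioo (0:ℝ) 1, (r * (indicator (Ioo 0 d ∩ {s | y s ≠ 0}) (deriv y) r ^ 2 -
      v r * indicator (Ioo 0 d) y r ^ 2) +
      indicator (Ioo 0 d) (fun r => r * (κ ^ 2 * y r ^ 2 / r ^ 2)) r) = 0 := by
    refine Eq.trans (setIntegral_congr_fun measurableSet_Ioo fun r _ => ?_) h1
    simp only [indicator_apply]
    split_ifs <;> ring
  rw [integral_add hI1 hI2] at h4
  have h5 : 0 < ∫ r in Ioo (0:ℝ) 1,
      indicator (Ioo 0 d) (fun r => r * (κ ^ 2 * y r ^ 2 / r ^ 2)) r := by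
    rw [setIntegral_pos_iff_support_of_nonneg_ae _ hI2]
    · refine ((hy.isOpen_nodal le_rfl hd).measure_pos volume ⟨r, hr, hne⟩).trans_le
        (measure_mono fun s hs => ⟨?_, hs.1.1, hs.1.2.trans_le hd⟩)
      rw [Function.mem_support, indicator_of_mem hs.1]
      have h1 := hs.1.1.ne'
      have h2 : y s ≠ 0 := hs.2
      positivity
    · refine Filter.Eventually.of_forall fun s => indicator_nonneg (fun s hs => ?_) s
      have := hs.1
      positivity
  linarith

lemma ne_zero (hy : IsProfile κ v y) (hκ : κ ≠ 0) (hv : ContinuousOn v (Icc 0 1))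
    (hQ : ∀ η, IsTest η → 0 ≤ ∫ r in Ioo (0:ℝ) 1, r * (deriv η r ^ 2 - v r * η r ^ 2))
    (hy0 : y 0 = 0) (hy1 : y 1 ≠ 0) {d : ℝ} (hd : d ∈ Ioo (0:ℝ) 1) : y d ≠ 0 := by
  intro hyd
  have hz : ∀ r ∈ Ioo 0 d, y r = 0 := fun r hr =>
    hy.eq_zero_of_nodal hκ hv hQ hd.1 hd.2.le hy0 hyd hr
  obtain ⟨r, hr⟩ := exists_between hd.1
  have hdr : deriv y r = 0 := by
    have : y =ᶠ[nhds r] fun _ => 0 := by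
      filter_upwards [Ioo_mem_nhds hr.1 hr.2] with s hs using hz s hs
    rw [this.deriv_eq, deriv_const]
  have h0 : ∀ s ∈ Ioo (0:ℝ) 1, y s = 0 := fun s hs =>
    hy.eq_zero hv ⟨hr.1, hr.2.trans hd.2⟩ (hz r hr) hdr hs
  refine hy1 (tendsto_nhds_unique (f := y) (l := nhdsWithin 1 (Iio 1))
    ((hy.cont 1 ⟨zero_le_one, le_rfl⟩).mono_of_mem_nhdsWithin (Icc_mem_nhdsLT zero_lt_one))
    (tendsto_const_nhds.congr' ?_))
  filter_upwards [Ioo_mem_nhdsLT zero_lt_one] with s hs using (h0 s hs).symm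

lemma deriv_eq_zero_of_nodal (hy : IsProfile 0 v y) (hv : ContinuousOn v (Icc 0 1))
    (hQ : ∀ η, IsTest η → 0 ≤ ∫ r in Ioo (0:ℝ) 1, r * (deriv η r ^ 2 - v r * η r ^ 2))
    {c : ℝ} (hc : c ∈ Ioo (0:ℝ) 1) (hyc : y c = 0) (hy1 : y 1 = 0) : deriv y c = 0 := by
  by_contra hne
  obtain ⟨h1, h2⟩ := hy.nodal_limit hv hQ hc.1.le hc.2 le_rfl hyc hy1
  have hI1 := hy.integrableOn_nodal hv hc.1.le le_rfl
  have h3 : ∫ r in Ioo (0:ℝ) 1, r * (indicator (Ioo c 1 ∩ {s | y s ≠ 0}) (deriv y) r ^ 2 -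
      v r * indicator (Ioo c 1) y r ^ 2) = 0 := by
    refine Eq.trans (setIntegral_congr_fun measurableSet_Ioo fun r _ => ?_) h1
    simp only [indicator_apply]
    split_ifs <;> ring
  have hB : ∀ η, IsTest η → ∫ r in Ioo (0:ℝ) 1,
      r * (indicator (Ioo c 1 ∩ {s | y s ≠ 0}) (deriv y) r * deriv η r -
        v r * indicator (Ioo c 1) y r * η r) = 0 := by
    intro η hη
    have hI2 : IntegrableOn (fun r => r * (indicator (Ioo c 1 ∩ {s | y s ≠ 0}) (deriv y) r *
        deriv η r - v r * indicator (Ioo c 1) y r * η r)) (Ioo 0 1) := by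
      have e1 := (hy.integrableOn_deriv_mul hη).indicator
        (hy.isOpen_nodal hc.1.le le_rfl).measurableSet
      have e2 := (integrableOn_Ioo_of_continuousOn (F := fun r => r * (v r * y r * η r))
        (continuousOn_id.mul ((hv.mul hy.cont).mul hη.continuous.continuousOn))).indicator
        (measurableSet_Ioo (a := c) (b := 1))
      refine (e1.sub e2).congr (Filter.Eventually.of_forall fun r => ?_)
      simp only [Pi.sub_apply, indicator_apply]
      split_ifs <;> ring
    have hI3 : IntegrableOn (fun r => r * (deriv η r ^ 2 - v r * η r ^ 2)) (Ioo 0 1) :=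
      integrableOn_Ioo_of_continuousOn (continuousOn_id.mul
        ((hη.continuous_deriv.continuousOn.pow 2).sub (hv.mul (hη.continuous.continuousOn.pow 2))))
    set B := ∫ r in Ioo (0:ℝ) 1,
      r * (indicator (Ioo c 1 ∩ {s | y s ≠ 0}) (deriv y) r * deriv η r -
        v r * indicator (Ioo c 1) y r * η r)
    set Q := ∫ r in Ioo (0:ℝ) 1, r * (deriv η r ^ 2 - v r * η r ^ 2)
    have hquad : ∀ t : ℝ, 0 ≤ 2 * t * B + t ^ 2 * Q := fun t => by
      refine (h2 η hη t).trans_eq ?_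
      have e := integral_add (hI1.add (hI2.const_mul (2 * t))) (hI3.const_mul (t ^ 2))
      have e' := integral_add hI1 (hI2.const_mul (2 * t))
      rw [integral_const_mul, h3, zero_add] at e'
      simp only [Pi.add_apply] at e
      rw [e', integral_const_mul] at e
      rw [← e]
      refine integral_congr_ae (Filter.Eventually.of_forall fun r => ?_)
      ring
    by_contra hB0
    have hQ0 : 0 ≤ Q := hQ η hη
    have := hquad (-B / (Q + 1))
    have hQ1 : 0 < Q + 1 := by linarith
    have e : 2 * (-B / (Q + 1)) * B + (-B / (Q + 1)) ^ 2 * Q =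
        -(B ^ 2 * (Q + 2) / (Q + 1) ^ 2) := by field_simp; ring
    rw [e] at this
    have : 0 < B ^ 2 * (Q + 2) / (Q + 1) ^ 2 := by positivity
    linarith
  have hev := (hy.hasDerivAt hc).eventually_ne hne (c := (0:ℝ))
  rw [eventually_nhdsWithin_iff] at hev
  obtain ⟨ρ, hρ, hρ'⟩ := Metric.eventually_nhds_iff_ball.1
    (hev.and (Ioo_mem_nhds hc.1 hc.2))
  let φ : ContDiffBump c := ⟨ρ / 4, ρ / 2, by positivity, by linarith⟩
  have hφ : ∀ r, r ∉ Icc (c - ρ / 2) (c + ρ / 2) → φ r = 0 := fun r hr => by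
    refine φ.zero_of_le_dist ?_
    rw [Real.dist_eq]
    by_contra h
    rw [not_le, abs_lt, show φ.rOut = ρ / 2 from rfl] at h
    exact hr ⟨by linarith [h.1], by linarith [h.2]⟩
  have hmem : ∀ r ∈ Icc (c - ρ / 2) (c + ρ / 2), r ∈ Metric.ball c ρ := fun r hr => by
    rw [Metric.mem_ball, Real.dist_eq, abs_lt]
    exact ⟨by linarith [hr.1], by linarith [hr.2]⟩
  have hIoo : ∀ r ∈ Icc (c - ρ / 2) (c + ρ / 2), r ∈ Ioo (0:ℝ) 1 := fun r hr =>
    (hρ' r (hmem r hr)).2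
  have hsub : Icc c (c + ρ / 2) ⊆ Icc (c - ρ / 2) (c + ρ / 2) := Icc_subset_Icc_left (by linarith)
  have hleft := hIoo (c - ρ / 2) ⟨le_rfl, by linarith⟩
  have hright := hIoo (c + ρ / 2) ⟨by linarith, le_rfl⟩
  have hφt : IsTest φ := ⟨φ.contDiff, c - ρ / 2, c + ρ / 2, hleft.1, hright.2, hφ⟩
  have hz := hB φ hφt
  have hyIc := hy.cont.mono Ioo_subset_Icc_self
  have hvIc := hv.mono Ioo_subset_Icc_self
  have hFc : ContinuousOn (fun r => ((0:ℝ) ^ 2 / r - r * v r) * y r * φ r +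
      r * deriv y r * deriv φ r) (uIcc c (c + ρ / 2)) := by
    rw [uIcc_of_le (by linarith)]
    refine ContinuousOn.mono ?_ (hsub.trans hIoo)
    exact ((((continuousOn_const.div continuousOn_id fun x hx => hx.1.ne').sub
      (continuousOn_id.mul hvIc)).mul hyIc).mul hφt.continuous.continuousOn).add
      ((continuousOn_id.mul hy.continuousOn_deriv).mul hφt.continuous_deriv.continuousOn)
  have hFTC : ∫ r in c..(c + ρ / 2), (((0:ℝ) ^ 2 / r - r * v r) * y r * φ r +
      r * deriv y r * deriv φ r) = (c + ρ / 2) * deriv y (c + ρ / 2) * φ (c + ρ / 2) -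
        c * deriv y c * φ c := by
    refine intervalIntegral.integral_eq_sub_of_hasDerivAt (f := fun r => r * deriv y r * φ r)
      (fun r hr => ?_) hFc.intervalIntegrable
    rw [uIcc_of_le (by linarith)] at hr
    exact (hy.hasDerivAt_flux hv (hIoo r (hsub hr))).mul (hφt.hasDerivAt r)
  have hend : φ (c + ρ / 2) = 0 := φ.zero_of_le_dist (by
    rw [Real.dist_eq, add_sub_cancel_left, abs_of_pos (by linarith)])
  have hone : φ c = 1 := φ.one_of_mem_closedBall (Metric.mem_closedBall_self (by positivity))
  have heq : ∫ r in Ioo (0:ℝ) 1, r * (indicator (Ioo c 1 ∩ {s | y s ≠ 0}) (deriv y) r * deriv φ r -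
        v r * indicator (Ioo c 1) y r * φ r) = ∫ r in c..(c + ρ / 2),
        (((0:ℝ) ^ 2 / r - r * v r) * y r * φ r + r * deriv y r * deriv φ r) := by
    rw [intervalIntegral.integral_of_le (by linarith),
      setIntegral_eq_of_subset_of_forall_sdiff_eq_zero (s := Ioc c (c + ρ / 2))
        measurableSet_Ioo (fun r hr => hIoo r (hsub (Ioc_subset_Icc_self hr))) fun r hr => ?_]
    · refine setIntegral_congr_fun measurableSet_Ioc fun r hr => ?_
      have hr' := hsub (Ioc_subset_Icc_self hr)
      have h1 : r ∈ Ioo c 1 := ⟨hr.1, (hIoo r hr').2⟩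
      have h2 : y r ≠ 0 := (hρ' r (hmem r hr')).1 hr.1.ne'
      rw [indicator_of_mem h1, indicator_of_mem (show r ∈ Ioo c 1 ∩ {s | y s ≠ 0} from ⟨h1, h2⟩)]
      ring
    · by_cases hrc : r ≤ c
      · have : r ∉ Ioo c 1 := fun h => absurd h.1 (not_lt.2 hrc)
        rw [indicator_of_notMem this, indicator_of_notMem fun h => this h.1]
        ring
      · have : r ∉ Icc (c - ρ / 2) (c + ρ / 2) := fun h => hr.2 ⟨not_le.1 hrc, h.2⟩
        rw [IsTest.deriv_eq_zero hφ this, hφ r this]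
        ring
  rw [heq, hFTC, hend, hone, mul_zero, zero_sub, mul_one, neg_eq_zero] at hz
  exact mul_ne_zero hc.1.ne' hne hz

/-- A stable zero-mode profile vanishing at `1` has a sign. -/
lemma exists_sign (hy : IsProfile 0 v y) (hv : ContinuousOn v (Icc 0 1))
    (hQ : ∀ η, IsTest η → 0 ≤ ∫ r in Ioo (0:ℝ) 1, r * (deriv η r ^ 2 - v r * η r ^ 2))
    (hy1 : y 1 = 0) : ∃ s : ℝ, (s = 1 ∨ s = -1) ∧ ∀ r ∈ Ioo (0:ℝ) 1, 0 ≤ s * y r := by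
  by_cases h : ∃ c ∈ Ioo (0:ℝ) 1, y c = 0
  · obtain ⟨c, hc, hyc⟩ := h
    refine ⟨1, Or.inl rfl, fun r hr => ?_⟩
    rw [hy.eq_zero hv hc hyc (hy.deriv_eq_zero_of_nodal hv hQ hc hyc hy1) hr, mul_zero]
  · push Not at h
    have hc := hy.cont.mono Ioo_subset_Icc_self
    rcases sign_of_ne_zero hc h with h | h
    · exact ⟨1, Or.inl rfl, fun r hr => by linarith [h r hr]⟩
    · exact ⟨-1, Or.inr rfl, fun r hr => by linarith [h r hr]⟩

end IsProfile

section

variable {W : ℝ → ℝ} {ε : ℝ} {k : ℤ} {u : (Fin 2 → ℝ) → Fin 3 → ℝ}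

lemma IsMinimiser.potV_pt (hε : 0 < ε) (hW : ContDiffOn ℝ 1 W (Iic (1:ℝ)))
    (hc : StrictConvexOn ℝ (Iic (1:ℝ)) W) (hu : IsMinimiser W ε unitDisk (ubdDeg k) u)
    {r : ℝ} (h0 : 0 < r) (h1 : r < 1) (φ : ℝ) :
    potV W ε u (pt r φ) = potV W ε u (pt r 0) := by
  have h := hu.normSq_rot hε hW hc φ (pt_mem_unitDisk h0.le h1 0)
  rw [rot_pt (Or.inl rfl), mul_zero, add_zero] at h
  rw [potV, potV, h]

lemma Admissible.continuousOn_potV_radius {ubd : (Fin 2 → ℝ) → Fin 3 → ℝ}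
    (hW : ContDiffOn ℝ 1 W (Iic (1:ℝ)))
    (hu : Admissible unitDisk ubd u) : ContinuousOn (fun r => potV W ε u (pt r 0)) (Icc 0 1) :=
  (continuousOn_potV hW hu).comp (contDiff_pt_radius 0).continuous.continuousOn
    fun _ hr => pt_mem_closure hr.1 hr.2 0

lemma IsMinimiser.third_isProfile (hε : 0 < ε) (hW : ContDiffOn ℝ 1 W (Iic (1:ℝ)))
    (hc : StrictConvexOn ℝ (Iic (1:ℝ)) W) (hu : IsMinimiser W ε unitDisk (ubdDeg k) u) :
    IsProfile 0 (fun r => potV W ε u (pt r 0)) (fun r => u (pt r 0) 2) := by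
  have h := isProfile_of_weak (k := 0) (continuousOn_potV hW hu.1)
    (fun r h0 h1 φ => hu.potV_pt hε hW hc h0 h1 φ) hu.third_diskH10.toDiskH1
    (DiskH10.of_contDiff (ψ := fun _ => 0) contDiff_const fun _ _ => rfl).toDiskH1
    (fun ψ hψ => hu.formB_eq_zero hW hc 2 hψ) (fun ψ _ => by simp [formB, gradDotS])
    (fun r h0 h1 φ => by simpa using hu.third_radial hε hW hc h0.le h1 φ 0)
  simpa only [Int.cast_zero] using h

lemma IsMinimiser.third_hasDerivAt_zero (hε : 0 < ε) (hW : ContDiffOn ℝ 1 W (Iic (1:ℝ)))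
    (hc : StrictConvexOn ℝ (Iic (1:ℝ)) W) (hu : IsMinimiser W ε unitDisk (ubdDeg k) u) :
    HasDerivAt (fun r => u (pt r 0) 2) 0 0 := by
  have hm : pt 0 0 ∈ unitDisk := pt_mem_unitDisk le_rfl one_pos 0
  have hd := hasDerivAt_pt_radius (φ := 0)
    (hu.third_diskH10.smooth.differentiableAt_unitDisk hm)
  have he : (fun r => u (pt (-r) 0) 2) =ᶠ[nhds 0] fun r => u (pt r 0) 2 := by
    filter_upwards [Ioo_mem_nhds (neg_one_lt_zero (R := ℝ)) one_pos] with r hr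
    have key : ∀ s : ℝ, 0 ≤ s → s < 1 → u (pt (-s) 0) 2 = u (pt s 0) 2 := fun s h0 h1 => by
      have hp : pt (-s) 0 = pt s Real.pi := by
        ext i
        fin_cases i <;> simp [pt]
      rw [hp, hu.third_radial hε hW hc h0 h1 Real.pi 0]
    rcases le_total 0 r with h | h
    · exact key r h hr.2
    · have := key (-r) (by linarith) (by linarith [hr.1])
      rw [neg_neg] at this
      exact this.symm
  have hn := HasDerivAt.comp (h₂ := fun r => u (pt r 0) 2) 0 (by rw [neg_zero]; exact hd)
    (hasDerivAt_neg (0:ℝ))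
  have hu' := hd.unique (hn.congr_of_eventuallyEq he.symm)
  convert hd using 1
  linarith

/-- A function without zeros in `(0, 1)` that equals one at the right end is positive. -/
lemma pos_of_ne_zero_of_end {f : ℝ → ℝ} (hf : ContinuousOn f (Icc 0 1)) (h1 : f 1 = 1)
    (h : ∀ r ∈ Ioo (0:ℝ) 1, f r ≠ 0) : ∀ r ∈ Ioo (0:ℝ) 1, 0 < f r := by
  refine fun r hr => lt_of_le_of_ne (not_lt.1 fun hlt => ?_) (h r hr).symm
  obtain ⟨t, ht, hft⟩ := intermediate_value_Ioo hr.2.le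
    (hf.mono (Icc_subset_Icc_left hr.1.le)) (show (0:ℝ) ∈ Ioo (f r) (f 1) by simp [h1, hlt])
  exact h t ⟨hr.1.trans ht.1, ht.2⟩ hft

end

/-- Theorem 1.1(1): any minimiser of `E_ε` over `𝒜` on the unit disk with
winding-number-`k` boundary data is of the rotationally symmetric form \eqref{rad-sol}. -/
theorem statement_0
    (W : ℝ → ℝ) (hW : ContDiffOn ℝ 1 W (Iic (1:ℝ))) (hW0 : W 0 = 0)
    (hWpos : ∀ t ∈ Iic (1:ℝ), t ≠ 0 → 0 < W t)
    (hWconv : StrictConvexOn ℝ (Iic (1:ℝ)) W)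
    (k : ℤ) (hk : k ≠ 0) (ε : ℝ) (hε : 0 < ε)
    (u : (Fin 2 → ℝ) → Fin 3 → ℝ)
    (hu : IsMinimiser W ε unitDisk (ubdDeg k) u) :
    ∃ f g : ℝ → ℝ, SolvesSystem W ε k f g ∧
      (∀ r ∈ Ioo (0:ℝ) 1, 0 < f r) ∧ (∀ r ∈ Ioo (0:ℝ) 1, 0 ≤ g r) ∧
      ∃ s : ℝ, (s = 1 ∨ s = -1) ∧
        ∀ r ∈ Ioo (0:ℝ) 1, ∀ φ : ℝ,
          u ![r * Real.cos φ, r * Real.sin φ] =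
            ![f r * Real.cos ((k : ℝ) * φ), f r * Real.sin ((k : ℝ) * φ), s * g r] := by
  obtain ⟨a, b, ha, hb, wa, wb, hab, hua, ha1⟩ := hu.structure hε hW hWconv hk
  have hkR : (k : ℝ) ≠ 0 := Int.cast_ne_zero.2 hk
  have hv := hu.1.continuousOn_potV_radius (ε := ε) hW
  have hV := fun r h0 h1 φ => hu.potV_pt hε hW hWconv (r := r) h0 h1 φ
  have hf := isProfile_of_weak (continuousOn_potV hW hu.1) hV ha hb wa wb
    fun r h0 h1 φ => hab r h0.le h1 φ
  have hy := hu.third_isProfile hε hW hWconv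
  have hQ : ∀ η, IsTest η → _ := fun η hη => radial_form_nonneg
    (fun ψ hψ => hu.form_nonneg hW hWconv (fun x hx => by rw [hu.1.bdry hx]; rfl) hψ) hV hη
  have hf0 : a (pt 0 0) = 0 := by
    have h := (hab 0 le_rfl one_pos (Real.pi / k)).1
    have hp : pt 0 (Real.pi / k) = pt 0 0 := by simp [pt]
    rw [mul_div_cancel₀ _ hkR, Real.cos_pi, hp] at h
    linarith
  have hfne : ∀ r ∈ Ioo (0:ℝ) 1, a (pt r 0) ≠ 0 := fun r hr =>
    hf.ne_zero hkR hv hQ hf0 (by rw [ha1]; exact one_ne_zero) hr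
  have hy1 : u (pt 1 0) 2 = 0 := hu.third_diskH10.bdry _ (by simp [pt])
  obtain ⟨s, hs, hsy⟩ := hy.exists_sign hv hQ hy1
  have hss : s * s = 1 := by rcases hs with rfl | rfl <;> norm_num
  have hpot : ∀ r ∈ Ioo (0:ℝ) 1, potV W ε u (pt r 0) =
      1 / ε ^ 2 * Wd W (1 - a (pt r 0) ^ 2 - (s * u (pt r 0) 2) ^ 2) := fun r hr => by
    obtain ⟨h0, h1⟩ := hua r hr.1.le hr.2 (hfne r hr) 0
    have h2 := (hab r hr.1.le hr.2 0).2
    rw [mul_zero, Real.sin_zero, mul_zero] at h2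
    rw [potV, normSq, Fin.sum_univ_three, h0, h1, h2]
    congr 2
    linear_combination u (pt r 0) 2 ^ 2 * hss
  refine ⟨fun r => a (pt r 0), fun r => s * u (pt r 0) 2,
    ⟨hf.cont, continuousOn_const.mul hy.cont, hf.contDiffOn_two hv,
      contDiffOn_const.mul (hy.contDiffOn_two hv), fun r hr => ?_, fun r hr => ?_, hf0, ha1, ?_, ?_⟩,
    pos_of_ne_zero_of_end hf.cont ha1 hfne, hsy, s, hs, fun r hr φ => ?_⟩
  · have hd := (hf.hasDerivAt_deriv hv hr).deriv
    rw [hd]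
    linear_combination (a (pt r 0)) * hpot r hr
  · have hd := (hy.hasDerivAt_deriv hv hr).deriv
    rw [deriv_const_mul_field', deriv_const_mul_field, hd]
    linear_combination (s * u (pt r 0) 2) * hpot r hr
  · have h := ((hu.third_hasDerivAt_zero hε hW hWconv).const_mul s).hasDerivWithinAt (s := Icc 0 1)
    rw [h.derivWithin (uniqueDiffOn_Icc one_pos 0 (by simp)), mul_zero]
  · simp only [hy1, mul_zero]
  · obtain ⟨h0, h1⟩ := hua r hr.1.le hr.2 (hfne r hr) φ
    obtain ⟨h3, h4⟩ := hab r hr.1.le hr.2 φ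
    have h2 := hu.third_radial hε hW hWconv hr.1.le hr.2 φ 0
    change u (pt r φ) = _
    ext i
    fin_cases i
    · exact h0.trans h3
    · exact h1.trans h4
    · change u (pt r φ) 2 = s * (s * u (pt r 0) 2)
      rw [h2, ← mul_assoc, hss, one_mul]
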